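/- arXiv:1808.09358 — 5 statements merged into one kernel-verified Lean document; each statement's English description precedes it below -/
import Mathlib

section
/- For every Schwartz–Bruhat function Φ on ℚ_p², the integral f(ξ) = ∫_{ℚ_p∖{0}} Φ(a, ξ/a) da/|a|_p converges for every ξ ≠ 0, and there exist Schwartz–Bruhat functions C₀, C₁ on ℚ_p such that f(ξ) = C₀(ξ) + C₁(ξ)·v_p(ξ) for all ξ ≠ 0. -/
open MeasureTheory Filter

noncomputable section

/-- A Schwartz–Bruhat function: locally constant with compact support. -/
def IsSchwartzBruhat {X : Type*} [TopologicalSpace X] (f : X → ℂ) : Prop :=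
  IsLocallyConstant f ∧ HasCompactSupport f

/-- The pushforward density of `Φ(x)dx` under `(x₁,x₂) ↦ x₁x₂` on `ℚ_p²`:
`f(ξ) = ∫_{ℚ_p∖{0}} Φ(a, ξ/a) da/|a|_p`. -/
def pushTwoP (p : ℕ) [Fact p.Prime] [MeasurableSpace ℚ_[p]] (μ : Measure ℚ_[p])
    (Φ : ℚ_[p] × ℚ_[p] → ℂ) (ξ : ℚ_[p]) : ℂ :=
  ∫ a in ({0}ᶜ : Set ℚ_[p]), Φ (a, ξ / a) * ((‖a‖⁻¹ : ℝ) : ℂ) ∂μ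

section Aux
open scoped Pointwise

lemma aux_p (p : ℕ) [Fact p.Prime] [MeasurableSpace ℚ_[p]] [BorelSpace ℚ_[p]]
    (μ : Measure ℚ_[p]) [μ.IsAddHaarMeasure] :
    μ (Metric.closedBall 0 1) = p * μ (Metric.ball 0 1) := by
  have h : Metric.closedBall (0 : ℚ_[p]) 1 = ⋃ i ∈ Finset.range p, Metric.ball (i : ℚ_[p]) 1 := by
    ext x
    simp only [Metric.mem_closedBall, Set.mem_iUnion, Finset.mem_range,
      Metric.mem_ball, dist_eq_norm, exists_prop, sub_zero]
    constructor
    · intro hx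
      obtain ⟨n, hn, hn'⟩ := PadicInt.exists_mem_range (⟨x, hx⟩ : ℤ_[p])
      refine ⟨n, hn, ?_⟩
      have := PadicInt.norm_lt_one_iff_dvd (⟨x, hx⟩ - (n : ℤ_[p]))
      have h2 : ‖(⟨x, hx⟩ - (n : ℤ_[p]))‖ < 1 := by
        rw [this]; rwa [PadicInt.maximalIdeal_eq_span_p, Ideal.mem_span_singleton] at hn'
      rw [PadicInt.norm_def] at h2
      exact_mod_cast h2
    · rintro ⟨n, hn, h⟩
      have h3 : ‖(n : ℚ_[p])‖ ≤ 1 := by simpa using Padic.norm_int_le_one (p := p) n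
      calc ‖x‖ = ‖(x - n) + n‖ := by simp
        _ ≤ max ‖x - n‖ ‖(n : ℚ_[p])‖ := Padic.nonarchimedean _ _
        _ ≤ 1 := max_le h.le h3
  rw [h, measure_biUnion_finset]
  · have : ∀ i ∈ Finset.range p, μ (Metric.ball (i : ℚ_[p]) 1) = μ (Metric.ball 0 1) := by
      intro i _
      exact Measure.addHaar_ball_center _ _ _
    rw [Finset.sum_congr rfl this]; simp
  · intro i hi j hj hij
    refine Set.disjoint_left.2 fun x hx hx' => ?_
    simp only [Metric.mem_ball, dist_eq_norm] at hx hx'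
    simp only [Finset.coe_range, Set.mem_Iio] at hi hj
    have h4 : ‖((i - j : ℤ) : ℚ_[p])‖ < 1 := by
      calc ‖((i - j : ℤ) : ℚ_[p])‖ = ‖(x - j) + (-(x - i))‖ := by congr 1; push_cast; ring
        _ ≤ max ‖x - j‖ ‖-(x - i)‖ := Padic.nonarchimedean _ _
        _ < 1 := by rw [norm_neg]; exact max_lt hx' hx
    rw [Padic.norm_intCast_lt_one_iff] at h4
    apply hij
    have := Int.eq_zero_of_abs_lt_dvd h4 (by rw [abs_lt]; omega)
    omega
  · intro i _
    exact measurableSet_ball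

lemma aux_char (p : ℕ) [Fact p.Prime] [MeasurableSpace ℚ_[p]] [BorelSpace ℚ_[p]]
    (x : ℚ_[p]ˣ) :
    distribHaarChar ℚ_[p] x = ‖(x : ℚ_[p])‖₊ := by
  let μ : Measure ℚ_[p] := Measure.addHaar
  have hp0 : (p : ℚ_[p]) ≠ 0 := by exact_mod_cast (Fact.out : p.Prime).ne_zero
  have hp0' : (p : NNReal) ≠ 0 := by exact_mod_cast (Fact.out : p.Prime).ne_zero
  have hpos : μ (Metric.closedBall 0 1) ≠ 0 := (Metric.measure_closedBall_pos μ _ one_pos).ne'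
  have hfin : μ (Metric.closedBall 0 1) ≠ ⊤ := (isCompact_closedBall (0 : ℚ_[p]) 1).measure_lt_top.ne
  have hu : ∀ u : ℚ_[p]ˣ, ‖(u : ℚ_[p])‖ = 1 → distribHaarChar ℚ_[p] u = 1 := by
    intro u hu
    apply distribHaarChar_eq_of_measure_smul_eq_mul (μ := μ) hpos hfin
    have : u • Metric.closedBall (0 : ℚ_[p]) 1 = Metric.closedBall 0 1 := by
      ext y
      rw [Set.mem_smul_set_iff_inv_smul_mem]
      simp [Units.smul_def, hu]
    rw [this]; simp
  have hpc : distribHaarChar ℚ_[p] (Units.mk0 (p : ℚ_[p]) hp0) = (p : NNReal)⁻¹ := by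
    apply distribHaarChar_eq_of_measure_smul_eq_mul (μ := μ) hpos hfin
    have : (Units.mk0 (p : ℚ_[p]) hp0) • Metric.closedBall (0 : ℚ_[p]) 1 = Metric.ball 0 1 := by
      ext y
      rw [Set.mem_smul_set_iff_inv_smul_mem]
      have := Padic.norm_le_pow_iff_norm_lt_pow_add_one y (-1)
      have hpp : (0 : ℝ) < p := by exact_mod_cast (Fact.out : p.Prime).pos
      simp [Units.smul_def] at this ⊢
      rw [← this, ← one_div, le_div_iff₀' hpp]
    rw [this, aux_p, ENNReal.coe_inv hp0', ← mul_assoc]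
    simp only [ENNReal.coe_natCast]
    rw [ENNReal.inv_mul_cancel, one_mul]
    · exact_mod_cast hp0'
    · simp
  have hx : x = (x * (Units.mk0 (p : ℚ_[p]) hp0)^(-(x : ℚ_[p]).valuation)) *
      (Units.mk0 (p : ℚ_[p]) hp0)^(x : ℚ_[p]).valuation := by
    simp
  have hn := Padic.norm_eq_zpow_neg_valuation x.ne_zero
  rw [hx, map_mul, hu, map_zpow, hpc]
  · ext; simp [hn]
  · have : (p : ℝ) ≠ 0 := by exact_mod_cast hp0'
    simp [hn]
    exact inv_mul_cancel₀ (zpow_ne_zero _ this)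

lemma aux_map (p : ℕ) [Fact p.Prime] [MeasurableSpace ℚ_[p]] [BorelSpace ℚ_[p]]
    (μ : Measure ℚ_[p]) [μ.IsAddHaarMeasure] (x : ℚ_[p]) (hx : x ≠ 0) :
    μ.map (x * ·) = ‖x⁻¹‖₊ • μ := by
  ext s hs
  rw [Measure.map_apply (by fun_prop) hs]
  have : (x * ·) ⁻¹' s = (Units.mk0 x hx)⁻¹ • s := by
    ext y
    rw [Set.mem_smul_set_iff_inv_smul_mem]
    simp [Units.smul_def]
  rw [this, ← distribHaarChar_mul, aux_char]
  simp

lemma aux_scale (p : ℕ) [Fact p.Prime] [MeasurableSpace ℚ_[p]] [BorelSpace ℚ_[p]]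
    (μ : Measure ℚ_[p]) [μ.IsAddHaarMeasure] (x : ℚ_[p]) (hx : x ≠ 0) (F : ℚ_[p] → ℂ) :
    ∫ a, F (x * a) ∂μ = (‖x‖⁻¹ : ℝ) * ∫ a, F a ∂μ := by
  have h := (Homeomorph.mulLeft₀ x hx).measurableEmbedding.integral_map (μ := μ) F
  simp only [Homeomorph.coe_mulLeft₀] at h
  rw [← h, aux_map p μ x hx, integral_smul_nnreal_measure]
  simp [NNReal.smul_def]

lemma aux_scale_int (p : ℕ) [Fact p.Prime] [MeasurableSpace ℚ_[p]] [BorelSpace ℚ_[p]]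
    (μ : Measure ℚ_[p]) [μ.IsAddHaarMeasure] (x : ℚ_[p]) (hx : x ≠ 0) (F : ℚ_[p] → ℂ)
    (hF : Integrable F μ) : Integrable (fun a => F (x * a)) μ := by
  have h := (Homeomorph.mulLeft₀ x hx).measurableEmbedding.integrable_map_iff (μ := μ) (g := F)
  simp only [Homeomorph.coe_mulLeft₀] at h
  rw [aux_map p μ x hx] at h
  exact h.1 hF.smul_measure_nnreal

lemma aux_int (p : ℕ) [Fact p.Prime] [MeasurableSpace ℚ_[p]] [BorelSpace ℚ_[p]]
    (μ : Measure ℚ_[p]) [μ.IsAddHaarMeasure] (S : Set ℚ_[p]) (hS : MeasurableSet S) (ε R : ℝ)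
    (hε : 0 < ε) (hSR : ∀ a ∈ S, ε ≤ ‖a‖ ∧ ‖a‖ ≤ R) (g : ℚ_[p] → ℂ)
    (hg : ContinuousOn g {0}ᶜ) :
    Integrable (S.indicator fun a => g a * ((‖a‖⁻¹ : ℝ) : ℂ)) μ := by
  rw [integrable_indicator_iff hS]
  let K : Set ℚ_[p] := Metric.closedBall 0 R ∩ {a | ε ≤ ‖a‖}
  have hK : IsCompact K := (isCompact_closedBall _ _).inter_right
    (isClosed_le continuous_const continuous_norm)
  have hsub : S ⊆ K := fun a ha => ⟨by simpa using (hSR a ha).2, (hSR a ha).1⟩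
  refine IntegrableOn.mono_set (ContinuousOn.integrableOn_compact hK ?_) hsub
  have h0 : ∀ a ∈ K, a ≠ 0 := fun a ha h => by
    have := ha.2; simp [h] at this; linarith
  refine (hg.mono fun a ha => h0 a ha).mul ?_
  refine Complex.continuous_ofReal.comp_continuousOn ?_
  exact continuous_norm.continuousOn.inv₀ fun a ha => norm_ne_zero_iff.2 (h0 a ha)

lemma aux_shell (p : ℕ) [Fact p.Prime] [MeasurableSpace ℚ_[p]] [BorelSpace ℚ_[p]]
    (μ : Measure ℚ_[p]) [μ.IsAddHaarMeasure] (j : ℤ) :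
    ∫ a, ({a : ℚ_[p] | ‖a‖ = (p:ℝ) ^ j}.indicator (fun a => ((‖a‖⁻¹ : ℝ) : ℂ))) a ∂μ =
      ∫ a, ({a : ℚ_[p] | ‖a‖ = 1}.indicator (fun _ => (1 : ℂ))) a ∂μ := by
  have hp0 : (p : ℚ_[p]) ≠ 0 := by exact_mod_cast (Fact.out : p.Prime).ne_zero
  have hp : (p : ℝ) ≠ 0 := by exact_mod_cast (Fact.out : p.Prime).ne_zero
  have hn : ‖(p : ℚ_[p]) ^ j‖ = ((p:ℝ) ^ j)⁻¹ := by simp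
  have hpj : (p:ℝ) ^ j ≠ 0 := zpow_ne_zero _ hp
  have h := aux_scale p μ ((p : ℚ_[p]) ^ j) (zpow_ne_zero _ hp0)
    ({a : ℚ_[p] | ‖a‖ = 1}.indicator (fun _ => (1 : ℂ)))
  have h2 : ∀ a, ({a : ℚ_[p] | ‖a‖ = (p:ℝ) ^ j}.indicator (fun a => ((‖a‖⁻¹ : ℝ) : ℂ))) a =
      ((((p:ℝ) ^ j)⁻¹ : ℝ) : ℂ) *
        ({a : ℚ_[p] | ‖a‖ = 1}.indicator (fun _ => (1 : ℂ))) ((p : ℚ_[p]) ^ j * a) := by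
    intro a
    have h3 : ‖(p : ℚ_[p]) ^ j * a‖ = 1 ↔ ‖a‖ = (p:ℝ) ^ j := by
      rw [norm_mul, hn, inv_mul_eq_one₀ hpj, eq_comm]
    simp only [Set.indicator_apply, Set.mem_ofPred_eq, h3]
    split_ifs with h4 <;> simp [h4]
  simp_rw [h2]
  rw [integral_const_mul, h, hn, ← mul_assoc, ← Complex.ofReal_mul]
  simp [hpj]

lemma aux_log (p : ℕ) [Fact p.Prime] [MeasurableSpace ℚ_[p]] [BorelSpace ℚ_[p]]
    (μ : Measure ℚ_[p]) [μ.IsAddHaarMeasure] (m n : ℕ) :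
    ∫ a, ({a : ℚ_[p] | (p:ℝ) ^ m < ‖a‖ ∧ ‖a‖ ≤ (p : ℝ) ^ (m + n)}.indicator
        (fun a => (1 : ℂ) * ((‖a‖⁻¹ : ℝ) : ℂ))) a ∂μ =
      n * ∫ a, ({a : ℚ_[p] | ‖a‖ = 1}.indicator (fun _ => (1 : ℂ))) a ∂μ := by
  have hp1 : (1 : ℝ) < p := by exact_mod_cast (Fact.out : p.Prime).one_lt
  have hp : (0 : ℝ) < p := by linarith
  induction n with
  | zero =>
    have : {a : ℚ_[p] | (p:ℝ) ^ m < ‖a‖ ∧ ‖a‖ ≤ (p : ℝ) ^ (m + 0)} = ∅ := by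
      ext a; simp
    simp [this]
  | succ n ih =>
    have key : ∀ a, ({a : ℚ_[p] | (p:ℝ) ^ m < ‖a‖ ∧ ‖a‖ ≤ (p : ℝ) ^ (m + (n+1))}.indicator
        (fun a => (1 : ℂ) * ((‖a‖⁻¹ : ℝ) : ℂ))) a =
        ({a : ℚ_[p] | (p:ℝ) ^ m < ‖a‖ ∧ ‖a‖ ≤ (p : ℝ) ^ (m + n)}.indicator
        (fun a => (1 : ℂ) * ((‖a‖⁻¹ : ℝ) : ℂ))) a +
        ({a : ℚ_[p] | ‖a‖ = (p:ℝ) ^ ((m + n + 1 : ℕ) : ℤ)}.indicator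
          (fun a => (1 : ℂ) * ((‖a‖⁻¹ : ℝ) : ℂ))) a := by
      intro a
      have h1 := Padic.norm_le_pow_iff_norm_lt_pow_add_one a ((m + n : ℕ) : ℤ)
      have h1' : ‖a‖ ≤ (p:ℝ)^(m+n) ↔ ‖a‖ < (p:ℝ)^(m+(n+1)) := by exact_mod_cast h1
      have h2 : (p:ℝ)^m < (p:ℝ)^(m+(n+1)) := pow_lt_pow_right₀ hp1 (by omega)
      simp only [Set.indicator_apply, Set.mem_ofPred_eq, h1', zpow_natCast, add_assoc]
      rcases lt_trichotomy ‖a‖ ((p:ℝ)^(m+(n+1))) with h | h | h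
      · simp [h, h.le, h.ne]
      · simp [h, h2]
      · simp [h.not_ge, h.ne', h.not_gt]
    simp_rw [key]
    rw [integral_add, ih]
    · have := aux_shell p μ ((m + n + 1 : ℕ) : ℤ)
      simp only [one_mul]
      rw [this]; push_cast; ring
    · refine aux_int p μ _ ?_ ((p:ℝ)^m) ((p:ℝ)^(m+n)) (by positivity) ?_ (fun _ => 1) continuousOn_const
      · measurability
      · intro a ha; exact ⟨ha.1.le, ha.2⟩
    · refine aux_int p μ _ ?_ ((p:ℝ)^((m+n+1:ℕ):ℤ)) ((p:ℝ)^((m+n+1:ℕ):ℤ)) (by positivity) ?_ (fun _ => 1) continuousOn_const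
      · measurability
      · intro a ha; exact ⟨ha.ge, ha.le⟩

lemma aux_unif (p : ℕ) [Fact p.Prime] (Φ : ℚ_[p] × ℚ_[p] → ℂ) (hΦ : IsSchwartzBruhat Φ) :
    ∃ R : ℝ, ∃ m : ℕ, 0 < R ∧ (∀ x y, (R < ‖x‖ ∨ R < ‖y‖) → Φ (x, y) = 0) ∧
      ∀ x y x' y', ‖x - x'‖ ≤ ((p : ℝ) ^ m)⁻¹ → ‖y - y'‖ ≤ ((p : ℝ) ^ m)⁻¹ →
        Φ (x, y) = Φ (x', y') := by
  obtain ⟨hlc, hcs⟩ := hΦ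
  have hp1 : (1 : ℝ) < p := by exact_mod_cast (Fact.out : p.Prime).one_lt
  obtain ⟨R, hR0, hR⟩ := hcs.isBounded.subset_closedBall_lt 0 0
  have hz : ∀ z, z ∉ tsupport Φ → Φ z = 0 := fun z hz => image_eq_zero_of_notMem_tsupport hz
  obtain ⟨δ, hδ, hc⟩ := lebesgue_number_lemma_of_metric (c := fun c : ℂ => Φ ⁻¹' {c}) hcs
    (fun c => hlc {c}) (fun x _ => by simp)
  have hc' : ∀ x ∈ tsupport Φ, ∀ y ∈ Metric.ball x δ, Φ y = Φ x := by
    intro x hx y hy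
    obtain ⟨c, h⟩ := hc x hx
    have h1 : Φ y = c := h hy
    have h2 : Φ x = c := h (Metric.mem_ball_self hδ)
    rw [h1, h2]
  obtain ⟨m, hm⟩ := exists_pow_lt_of_lt_one hδ (inv_lt_one_of_one_lt₀ hp1)
  refine ⟨R, m, hR0, ?_, ?_⟩
  · intro x y hxy
    apply hz
    intro hmem
    have := hR hmem
    rw [mem_closedBall_zero_iff, Prod.norm_def, max_le_iff] at this
    rcases hxy with h | h
    · exact absurd this.1 (not_le.2 h)
    · exact absurd this.2 (not_le.2 h)
  · intro x y x' y' hx hy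
    rw [inv_pow] at hm
    have hd : dist (x, y) (x', y') < δ := by
      rw [Prod.dist_eq, dist_eq_norm, dist_eq_norm]
      exact lt_of_le_of_lt (max_le hx hy) hm
    by_cases h : (x, y) ∈ tsupport Φ
    · exact (hc' _ h _ (by rwa [Metric.mem_ball, dist_comm])).symm
    · by_cases h' : (x', y') ∈ tsupport Φ
      · exact (hc' _ h' _ (by rwa [Metric.mem_ball]))
      · rw [hz _ h, hz _ h']

lemma aux_push (p : ℕ) [Fact p.Prime] [MeasurableSpace ℚ_[p]] [BorelSpace ℚ_[p]] (μ : Measure ℚ_[p])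
    (Φ : ℚ_[p] × ℚ_[p] → ℂ) (ξ : ℚ_[p]) :
    pushTwoP p μ Φ ξ = ∫ a, Φ (a, ξ / a) * ((‖a‖⁻¹ : ℝ) : ℂ) ∂μ := by
  rw [pushTwoP]
  apply setIntegral_eq_integral_of_forall_compl_eq_zero
  intro a ha
  have : a = 0 := by simpa using ha
  simp [this]

lemma aux_cont (p : ℕ) [Fact p.Prime] (Φ : ℚ_[p] × ℚ_[p] → ℂ) (hΦ : IsSchwartzBruhat Φ)
    (ξ : ℚ_[p]) : ContinuousOn (fun a => Φ (a, ξ / a)) {0}ᶜ := by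
  refine hΦ.1.continuous.comp_continuousOn ?_
  refine continuousOn_id.prodMk ?_
  exact continuousOn_const.div continuousOn_id (fun a ha => ha)

lemma aux_integrable (p : ℕ) [Fact p.Prime] [MeasurableSpace ℚ_[p]] [BorelSpace ℚ_[p]]
    (μ : Measure ℚ_[p]) [μ.IsAddHaarMeasure]
    (Φ : ℚ_[p] × ℚ_[p] → ℂ) (hΦ : IsSchwartzBruhat Φ) (ξ : ℚ_[p]) (hξ : ξ ≠ 0) :
    Integrable (fun a : ℚ_[p] => Φ (a, ξ / a) * ((‖a‖⁻¹ : ℝ) : ℂ)) μ := by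
  obtain ⟨R, m, hR, h0, -⟩ := aux_unif p Φ hΦ
  have hξ' : 0 < ‖ξ‖ := norm_pos_iff.2 hξ
  have h := aux_int p μ {a | ‖ξ‖ / R ≤ ‖a‖ ∧ ‖a‖ ≤ R} (by measurability) (‖ξ‖ / R) R (by positivity)
    (fun a ha => ha) (fun a => Φ (a, ξ / a)) (aux_cont p Φ hΦ ξ)
  refine h.congr (Eventually.of_forall fun a => ?_)
  simp only [Set.indicator_apply, Set.mem_ofPred_eq]
  split_ifs with hc
  · rfl
  · by_cases ha : a = 0
    · simp [ha]
    have ha' : 0 < ‖a‖ := norm_pos_iff.2 ha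
    rw [h0, zero_mul]
    by_contra hcon
    push Not at hcon
    apply hc
    refine ⟨?_, hcon.1⟩
    have h2 := hcon.2
    rw [norm_div, div_le_iff₀ ha'] at h2
    rwa [div_le_iff₀' hR]

lemma aux_core (p : ℕ) [Fact p.Prime] [MeasurableSpace ℚ_[p]] [BorelSpace ℚ_[p]]
    (μ : Measure ℚ_[p]) [μ.IsAddHaarMeasure]
    (Φ : ℚ_[p] × ℚ_[p] → ℂ) (hΦ : IsSchwartzBruhat Φ) (R : ℝ) (m : ℕ) (hR : 0 < R)
    (h0 : ∀ x y, (R < ‖x‖ ∨ R < ‖y‖) → Φ (x, y) = 0)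
    (hu : ∀ x y x' y', ‖x - x'‖ ≤ ((p : ℝ) ^ m)⁻¹ → ‖y - y'‖ ≤ ((p : ℝ) ^ m)⁻¹ →
        Φ (x, y) = Φ (x', y')) :
    ∃ K c : ℂ, ∀ (ξ : ℚ_[p]) (n : ℕ), ξ ≠ 0 → ‖ξ‖ = ((p : ℝ) ^ (2 * m + n))⁻¹ →
      pushTwoP p μ Φ ξ = K + c * n := by
  let P1 : ℚ_[p] → ℂ := {a : ℚ_[p] | ((p : ℝ) ^ m)⁻¹ < ‖a‖ ∧ ‖a‖ ≤ R}.indicator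
    fun a => Φ (a, 0 / a) * ((‖a‖⁻¹ : ℝ) : ℂ)
  let P2 : ℚ_[p] → ℂ := {a : ℚ_[p] | R⁻¹ ≤ ‖a‖ ∧ ‖a‖ ≤ (p : ℝ) ^ m}.indicator
    fun a => Φ (0, a⁻¹) * ((‖a‖⁻¹ : ℝ) : ℂ)
  let P3 : ℕ → ℚ_[p] → ℂ := fun n =>
    {a : ℚ_[p] | (p:ℝ) ^ m < ‖a‖ ∧ ‖a‖ ≤ (p : ℝ) ^ (m + n)}.indicator
        (fun a => (1 : ℂ) * ((‖a‖⁻¹ : ℝ) : ℂ))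
  have hp1 : (1 : ℝ) < p := by exact_mod_cast (Fact.out : p.Prime).one_lt
  have hp : (0 : ℝ) < p := by linarith
  have hP : (0 : ℝ) < (p : ℝ) ^ m := by positivity
  have i1 : Integrable P1 μ := aux_int p μ _ (by measurability) (((p : ℝ) ^ m)⁻¹) R (by positivity)
    (fun a ha => ⟨ha.1.le, ha.2⟩) _ (aux_cont p Φ hΦ 0)
  have i2 : Integrable P2 μ := by
    refine aux_int p μ {a : ℚ_[p] | R⁻¹ ≤ ‖a‖ ∧ ‖a‖ ≤ (p : ℝ) ^ m} (by measurability) R⁻¹ ((p : ℝ) ^ m) (by positivity)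
      (fun a ha => ha) (fun a => Φ (0, a⁻¹)) ?_
    refine hΦ.1.continuous.comp_continuousOn ?_
    exact continuousOn_const.prodMk (continuousOn_id.inv₀ (fun a ha => ha))
  have i3 : ∀ n, Integrable (P3 n) μ := fun n =>
    aux_int p μ _ (by measurability) ((p:ℝ)^m) ((p:ℝ)^(m+n)) (by positivity)
      (fun a ha => ⟨ha.1.le, ha.2⟩) (fun _ => 1) continuousOn_const
  refine ⟨∫ a, P1 a ∂μ + ∫ a, P2 a ∂μ, Φ (0, 0) *
    ∫ a, ({a : ℚ_[p] | ‖a‖ = 1}.indicator (fun _ => (1 : ℂ))) a ∂μ, ?_⟩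
  intro ξ n hξ hn
  have hξ' : 0 < ‖ξ‖ := norm_pos_iff.2 hξ
  have hq : 1 ≤ (p : ℝ) ^ n := one_le_pow₀ hp1.le
  have hq0 : 0 < (p : ℝ) ^ n := by positivity
  have hn' : ‖ξ‖ * ((p : ℝ) ^ m * (p : ℝ) ^ m * (p : ℝ) ^ n) = 1 := by
    rw [hn, pow_add, two_mul, pow_add]
    exact inv_mul_cancel₀ (by positivity)
  have key : ∀ a, Φ (a, ξ / a) * ((‖a‖⁻¹ : ℝ) : ℂ) =
      P1 a + ((‖ξ‖⁻¹ : ℝ) : ℂ) * (P2 (ξ⁻¹ * a) + Φ (0, 0) * P3 n (ξ⁻¹ * a)) := by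
    intro a
    by_cases ha : a = 0
    · simp [ha, P1, P2, P3, Set.indicator_apply]
    have ha' : 0 < ‖a‖ := norm_pos_iff.2 ha
    obtain ⟨b, rfl⟩ : ∃ b, a = ξ * b := ⟨ξ⁻¹ * a, by field_simp⟩
    have hb : b ≠ 0 := right_ne_zero_of_mul ha
    have hb' : 0 < ‖b‖ := norm_pos_iff.2 hb
    have e1 : ξ / (ξ * b) = b⁻¹ := by field_simp
    have e2 : ξ⁻¹ * (ξ * b) = b := by field_simp
    have e3 : ((‖ξ * b‖⁻¹ : ℝ) : ℂ) = ((‖ξ‖⁻¹ : ℝ) : ℂ) * ((‖b‖⁻¹ : ℝ) : ℂ) := by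
      rw [norm_mul, mul_inv, Complex.ofReal_mul]
    have e4 : ((p : ℝ) ^ m)⁻¹ < ‖ξ * b‖ ↔ (p : ℝ) ^ m * (p : ℝ) ^ n < ‖b‖ := by
      rw [inv_lt_iff_one_lt_mul₀' hP, norm_mul, ← hn',
        ← mul_lt_mul_iff_right₀ (mul_pos hξ' hP) (b := (p : ℝ) ^ m * (p : ℝ) ^ n)]
      ring_nf
    rw [e1, e2]
    simp only [P1, P2, P3, Set.indicator_apply, Set.mem_ofPred_eq, zero_div, pow_add]
    by_cases hc : (p : ℝ) ^ m * (p : ℝ) ^ n < ‖b‖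
    · have hPb : (p : ℝ) ^ m < ‖b‖ := lt_of_le_of_lt (le_mul_of_one_le_right hP.le hq) hc
      have : Φ (ξ * b, b⁻¹) = Φ (ξ * b, 0) := hu _ _ _ _ (by simp) (by
        rw [sub_zero, norm_inv]; exact inv_anti₀ hP hPb.le)
      simp only [e4, hc, hPb.not_ge, hc.not_ge, this]
      by_cases hr : ‖ξ * b‖ ≤ R
      · simp only [hr, and_true, if_true, and_false, if_false, mul_zero, add_zero]
      · simp [h0 (ξ * b) 0 (Or.inl (not_le.1 hr))]
    · have hlt : ‖ξ * b‖ ≤ ((p : ℝ) ^ m)⁻¹ := not_lt.1 (fun h => hc (e4.1 h))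
      have : Φ (ξ * b, b⁻¹) = Φ (0, b⁻¹) := hu _ _ _ _ (by simpa using hlt) (by simp)
      rw [this, e3]
      simp only [e4, hc, not_lt.1 hc]
      by_cases hPb : (p : ℝ) ^ m < ‖b‖
      · have : Φ (0, b⁻¹) = Φ (0, 0) := hu _ _ _ _ (by simp) (by
          rw [sub_zero, norm_inv]; exact inv_anti₀ hP hPb.le)
        simp only [hPb.not_ge, hPb, this]
        simp; ring
      · simp only [hPb, not_lt.1 hPb]
        by_cases hr : R⁻¹ ≤ ‖b‖
        · simp [hr]; ring
        · have : Φ (0, b⁻¹) = 0 := h0 _ _ (Or.inr (by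
            rw [norm_inv]; exact (lt_inv_comm₀ hb' hR).1 (not_le.1 hr)))
          simp [this]
  have hξi : ξ⁻¹ ≠ 0 := inv_ne_zero hξ
  have hcompP : ∀ P : ℚ_[p] → ℂ, Integrable P μ → Integrable (fun a => P (ξ⁻¹ * a)) μ :=
    fun P hP => aux_scale_int p μ ξ⁻¹ hξi P hP
  have hcomp : Integrable (fun a => P2 (ξ⁻¹ * a) + Φ (0, 0) * P3 n (ξ⁻¹ * a)) μ := by
    refine (hcompP _ i2).add ((hcompP _ (i3 n)).const_mul _)
  rw [aux_push]
  simp_rw [key]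
  rw [integral_add i1 (hcomp.const_mul _), integral_const_mul,
    aux_scale p μ ξ⁻¹ hξi (fun a => P2 a + Φ (0, 0) * P3 n a),
    integral_add i2 ((i3 n).const_mul _), integral_const_mul, aux_log p μ m n, ← mul_assoc,
    ← Complex.ofReal_mul, norm_inv, inv_inv, inv_mul_cancel₀ hξ'.ne']
  simp; ring

lemma aux_norm (p : ℕ) [Fact p.Prime] (ξ : ℚ_[p]) (hξ : ξ ≠ 0) (ε : ℝ) (hε : 0 < ε) :
    ∀ᶠ y in nhds ξ, y ≠ 0 ∧ ‖y‖ = ‖ξ‖ ∧ y.valuation = ξ.valuation ∧ ‖y - ξ‖ ≤ ε := by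
  have hξ' : 0 < ‖ξ‖ := norm_pos_iff.2 hξ
  filter_upwards [Metric.ball_mem_nhds ξ (lt_min hξ' hε)] with y hy
  rw [Metric.mem_ball, dist_eq_norm, lt_min_iff] at hy
  have h1 : ‖y‖ = ‖ξ‖ := by
    apply le_antisymm
    · calc ‖y‖ = ‖(y - ξ) + ξ‖ := by simp
        _ ≤ max ‖y - ξ‖ ‖ξ‖ := Padic.nonarchimedean _ _
        _ ≤ ‖ξ‖ := max_le hy.1.le le_rfl
    · by_contra hcon
      have : ‖ξ‖ < ‖ξ‖ := calc ‖ξ‖ = ‖-(y - ξ) + y‖ := by simp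
        _ ≤ max ‖-(y - ξ)‖ ‖y‖ := Padic.nonarchimedean _ _
        _ < ‖ξ‖ := by rw [norm_neg]; exact max_lt hy.1 (not_le.1 hcon)
      exact lt_irrefl _ this
  have h2 : y ≠ 0 := norm_pos_iff.1 (h1 ▸ hξ')
  refine ⟨h2, h1, ?_, hy.2.le⟩
  have hp1 : (1 : ℝ) < p := by exact_mod_cast (Fact.out : p.Prime).one_lt
  rw [Padic.norm_eq_zpow_neg_valuation hξ, Padic.norm_eq_zpow_neg_valuation h2] at h1
  have := zpow_right_injective₀ (by linarith) hp1.ne' h1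
  simpa using this

lemma aux_loc (p : ℕ) [Fact p.Prime] [MeasurableSpace ℚ_[p]] [BorelSpace ℚ_[p]]
    (μ : Measure ℚ_[p])
    (Φ : ℚ_[p] × ℚ_[p] → ℂ) (R : ℝ) (m : ℕ) (hR : 0 < R)
    (h0 : ∀ x y, (R < ‖x‖ ∨ R < ‖y‖) → Φ (x, y) = 0)
    (hu : ∀ x y x' y', ‖x - x'‖ ≤ ((p : ℝ) ^ m)⁻¹ → ‖y - y'‖ ≤ ((p : ℝ) ^ m)⁻¹ →
        Φ (x, y) = Φ (x', y')) (ξ y : ℚ_[p]) (hξ : ξ ≠ 0) (h1 : ‖y‖ = ‖ξ‖)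
    (h2 : ‖y - ξ‖ ≤ ((p : ℝ) ^ m)⁻¹ * (‖ξ‖ / R)) : pushTwoP p μ Φ y = pushTwoP p μ Φ ξ := by
  have hp : (0 : ℝ) < p := by exact_mod_cast (Fact.out : p.Prime).pos
  have hξ' : 0 < ‖ξ‖ := norm_pos_iff.2 hξ
  rw [aux_push, aux_push]
  congr 1
  ext a
  by_cases ha : a = 0
  · simp [ha]
  have ha' : 0 < ‖a‖ := norm_pos_iff.2 ha
  congr 1
  by_cases hc : ‖ξ‖ / R ≤ ‖a‖
  · apply hu
    · simp
    · rw [← sub_div, norm_div, div_le_iff₀ ha']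
      exact h2.trans (by gcongr)
  · have : R < ‖ξ‖ / ‖a‖ := by
      rw [lt_div_iff₀ ha']; rw [not_le, lt_div_iff₀' hR] at hc; exact hc
    rw [h0 _ _ (Or.inr (by rwa [norm_div, h1])), h0 _ _ (Or.inr (by rwa [norm_div]))]

lemma aux_van (p : ℕ) [Fact p.Prime] [MeasurableSpace ℚ_[p]] [BorelSpace ℚ_[p]]
    (μ : Measure ℚ_[p])
    (Φ : ℚ_[p] × ℚ_[p] → ℂ) (R : ℝ) (hR : 0 < R)
    (h0 : ∀ x y, (R < ‖x‖ ∨ R < ‖y‖) → Φ (x, y) = 0)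
    (ξ : ℚ_[p]) (h1 : R * R < ‖ξ‖) : pushTwoP p μ Φ ξ = 0 := by
  rw [aux_push]
  convert integral_zero ℚ_[p] ℂ with a
  by_cases ha : a = 0
  · simp [ha]
  have ha' : 0 < ‖a‖ := norm_pos_iff.2 ha
  rw [h0, zero_mul]
  by_contra! hcon
  rw [norm_div, div_le_iff₀ ha'] at hcon
  nlinarith

end Aux

/-- the case `d = 2` of the germ computation over `ℚ_p`:
`f(ξ) = ∫ Φ(a, ξ/a) da/|a|_p` converges for `ξ ≠ 0` and equals
`C₀(ξ) + C₁(ξ)·v_p(ξ)` with `C₀, C₁` Schwartz–Bruhat. -/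
theorem germ_pushforward_padic_two (p : ℕ) [Fact p.Prime]
    [MeasurableSpace ℚ_[p]] [BorelSpace ℚ_[p]]
    (μ : Measure ℚ_[p]) [μ.IsAddHaarMeasure]
    (Φ : ℚ_[p] × ℚ_[p] → ℂ) (hΦ : IsSchwartzBruhat Φ) :
    (∀ ξ : ℚ_[p], ξ ≠ 0 → IntegrableOn
        (fun a : ℚ_[p] => Φ (a, ξ / a) * ((‖a‖⁻¹ : ℝ) : ℂ)) ({0}ᶜ : Set ℚ_[p]) μ) ∧
    (∃ C₀ C₁ : ℚ_[p] → ℂ, IsSchwartzBruhat C₀ ∧ IsSchwartzBruhat C₁ ∧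
      ∀ ξ : ℚ_[p], ξ ≠ 0 →
        pushTwoP p μ Φ ξ = C₀ ξ + C₁ ξ * ((Padic.valuation ξ : ℤ) : ℂ)) := by
  classical
  refine ⟨fun ξ hξ => (aux_integrable p μ Φ hΦ ξ hξ).integrableOn, ?_⟩
  obtain ⟨R, m, hR, h0, hu⟩ := aux_unif p Φ hΦ
  obtain ⟨K, c, hK⟩ := aux_core p μ Φ hΦ R m hR h0 hu
  have hp1 : (1 : ℝ) < p := by exact_mod_cast (Fact.out : p.Prime).one_lt
  have hp : (0 : ℝ) < p := by linarith
  set s : ℝ := ((p : ℝ) ^ (2 * m))⁻¹ with hs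
  have hs0 : 0 < s := by positivity
  have hsmall : ∀ ξ : ℚ_[p], ξ ≠ 0 → ‖ξ‖ ≤ s →
      pushTwoP p μ Φ ξ = (K - c * (2 * m)) + c * ((ξ.valuation : ℤ) : ℂ) := by
    intro ξ hξ hle
    have hv := Padic.norm_eq_zpow_neg_valuation hξ
    have hle' : (p : ℝ) ^ (-ξ.valuation) ≤ (p : ℝ) ^ (-((2 * m : ℕ) : ℤ)) := by
      rw [← hv, zpow_neg, zpow_natCast]; exact hle
    rw [zpow_le_zpow_iff_right₀ hp1] at hle'
    obtain ⟨n, hn⟩ := Int.eq_ofNat_of_zero_le (show 0 ≤ ξ.valuation - ((2 * m : ℕ) : ℤ) by omega)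
    have hval : ξ.valuation = ((2 * m + n : ℕ) : ℤ) := by push_cast at hn ⊢; omega
    rw [hK ξ n hξ (by rw [hv, hval, zpow_neg, zpow_natCast]), hval]
    push_cast; ring
  let C₁ : ℚ_[p] → ℂ := fun ξ => if ‖ξ‖ ≤ s then c else 0
  let C₀ : ℚ_[p] → ℂ := fun ξ => if ξ = 0 then K - c * (2 * m) else
    pushTwoP p μ Φ ξ - C₁ ξ * ((ξ.valuation : ℤ) : ℂ)
  have hnear : ∀ᶠ y in nhds (0 : ℚ_[p]), ‖y‖ ≤ s := by
    filter_upwards [Metric.ball_mem_nhds (0 : ℚ_[p]) hs0] with y hy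
    exact (by simpa using hy : ‖y‖ < s).le
  refine ⟨C₀, C₁, ⟨?_, ?_⟩, ⟨?_, ?_⟩, ?_⟩
  · rw [IsLocallyConstant.iff_eventually_eq]
    intro ξ
    by_cases hξ : ξ = 0
    · subst hξ
      filter_upwards [hnear] with y hy
      by_cases hy0 : y = 0
      · rw [hy0]
      · simp only [C₀, C₁, hy0, hy, if_true, if_false, hsmall y hy0 hy]
        ring
    · have hξ' : 0 < ‖ξ‖ := norm_pos_iff.2 hξ
      filter_upwards [aux_norm p ξ hξ (((p : ℝ) ^ m)⁻¹ * (‖ξ‖ / R)) (by positivity)] with y hy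
      simp only [C₀, C₁, hy.1, hξ, if_false, hy.2.1, hy.2.2.1,
        aux_loc p μ Φ R m hR h0 hu ξ y hξ hy.2.1 hy.2.2.2]
  · refine HasCompactSupport.intro (isCompact_closedBall (0 : ℚ_[p]) (max s (R * R))) ?_
    intro ξ hξ
    rw [mem_closedBall_zero_iff, not_le, max_lt_iff] at hξ
    have hne : ξ ≠ 0 := norm_pos_iff.1 (hs0.trans hξ.1)
    simp [C₀, C₁, hne, hξ.1.not_ge, aux_van p μ Φ R hR h0 ξ hξ.2]
  · rw [IsLocallyConstant.iff_eventually_eq]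
    intro ξ
    by_cases hξ : ξ = 0
    · subst hξ
      filter_upwards [hnear] with y hy
      simp [C₁, hy, hs0.le]
    · filter_upwards [aux_norm p ξ hξ 1 one_pos] with y hy
      simp only [C₁, hy.2.1]
  · refine HasCompactSupport.intro (isCompact_closedBall (0 : ℚ_[p]) s) ?_
    intro ξ hξ
    rw [mem_closedBall_zero_iff] at hξ
    simp [C₁, hξ]
  · intro ξ hξ
    simp [C₀, hξ]
end
end

section
/- Suppose d ≥ 4 is even and let Φ be a Schwartz–Bruhat function on ℚ_p^d. Then there is a unique locally constant function f : ℚ_p∖{0} → ℂ such that ∫_{ℚ_p^d} g(q_d(x)) Φ(x) dx = ∫_{ℚ_p} g(ξ) f(ξ) dξ for every continuous compactly supported g : ℚ_p → ℂ whose support does not contain 0. Moreover f vanishes outside a compact subset of ℚ_p, and there exist Schwartz–Bruhat functions C₀, C₁ on ℚ_p such that f(ξ) = C₀(ξ) + C₁(ξ)·|ξ|_p^{d/2−1} for all ξ ≠ 0. -/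
open MeasureTheory Filter

noncomputable section

/-- Locally constant on a set. -/
def LocallyConstantOn {X : Type*} [TopologicalSpace X] (f : X → ℂ) (s : Set X) : Prop :=
  ∀ x ∈ s, ∀ᶠ y in nhds x, f y = f x

/-- Extension of a vector in `ℚ_p^d` by zeros, for convenient indexing. -/
def padP {p : ℕ} [Fact p.Prime] {d : ℕ} (x : Fin d → ℚ_[p]) (n : ℕ) : ℚ_[p] :=
  if h : n < d then x ⟨n, h⟩ else 0

/-- The split quadratic form `q_d` on `ℚ_p^d`. -/
def splitQP (p : ℕ) [Fact p.Prime] (d : ℕ) (x : Fin d → ℚ_[p]) : ℚ_[p] :=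
  if Even d then ∑ i ∈ Finset.range (d / 2), padP x (2 * i) * padP x (2 * i + 1)
  else padP x 0 ^ 2 + ∑ i ∈ Finset.range (d / 2), padP x (2 * i + 1) * padP x (2 * i + 2)

namespace Germ
open Metric
set_option linter.unusedSectionVars false

/-- volume of the ball of radius ρ -/
def bt {p : ℕ} [Fact p.Prime] [MeasurableSpace ℚ_[p]] (μ : Measure ℚ_[p]) (ρ : ℝ) : ℝ :=
  μ.real (closedBall 0 ρ)

/-- normalized indicator -/
def ker {p : ℕ} [Fact p.Prime] [MeasurableSpace ℚ_[p]] (μ : Measure ℚ_[p]) (ρ : ℝ) (z : ℚ_[p]) : ℂ :=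
  if ‖z‖ ≤ ρ then (((bt μ ρ)⁻¹ : ℝ) : ℂ) else 0

section
variable {p : ℕ} [Fact p.Prime] [MeasurableSpace ℚ_[p]] [BorelSpace ℚ_[p]]
    (μ : Measure ℚ_[p]) [μ.IsAddHaarMeasure]

lemma bt_pos {ρ : ℝ} (h : 0 < ρ) : 0 < bt μ ρ := by
  unfold bt
  rw [measureReal_def, ENNReal.toReal_pos_iff]
  exact ⟨measure_closedBall_pos μ 0 h, (isCompact_closedBall 0 ρ).measure_lt_top⟩

lemma bt_nonneg (ρ : ℝ) : 0 ≤ bt μ ρ := measureReal_nonneg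

lemma bt_mono : Monotone (bt μ) := by
  intro a b h
  exact measureReal_mono (closedBall_subset_closedBall h)
    (isCompact_closedBall (0 : ℚ_[p]) b).measure_lt_top.ne

lemma norm_add_le_iff {E : Type*} [NormedAddCommGroup E] [IsUltrametricDist E] {x t : E} {ρ : ℝ}
    (ht : ‖t‖ ≤ ρ) : ‖x + t‖ ≤ ρ ↔ ‖x‖ ≤ ρ := by
  constructor
  · intro h
    have := IsUltrametricDist.norm_add_le_max (x + t) (-t)
    rw [add_neg_cancel_right, norm_neg] at this
    exact this.trans (max_le h ht)
  · intro h
    exact (IsUltrametricDist.norm_add_le_max x t).trans (max_le h ht)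

lemma bt_mul_p (k : ℤ) : bt μ ((p : ℝ) ^ (k+1)) = p * bt μ ((p : ℝ) ^ k) := by
  have hp : (p : ℝ) ≠ 0 := by exact_mod_cast (Fact.out : p.Prime).ne_zero
  have hpp : (0 : ℝ) < p := by exact_mod_cast (Fact.out : p.Prime).pos
  have hp1 : (1 : ℝ) < p := by exact_mod_cast (Fact.out : p.Prime).one_lt
  have hpq : (p : ℚ_[p]) ≠ 0 := by exact_mod_cast (Fact.out : p.Prime).ne_zero
  set u : ℚ_[p] := (p : ℚ_[p]) ^ (-(k+1)) with hu
  have hun : ‖u‖ = (p : ℝ) ^ (k+1) := by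
    rw [hu, norm_zpow, Padic.norm_p]; simp
  have hu0 : u ≠ 0 := zpow_ne_zero _ hpq
  have hun0 : 0 < ‖u‖ := norm_pos_iff.2 hu0
  have hkk : (p : ℝ) ^ k < (p : ℝ) ^ (k+1) := zpow_lt_zpow_right₀ hp1 (by omega)
  have key : closedBall (0 : ℚ_[p]) ((p : ℝ) ^ (k+1)) =
      ⋃ a ∈ Finset.range p, closedBall ((a : ℚ_[p]) * u) ((p : ℝ) ^ k) := by
    ext x
    simp only [mem_closedBall, Set.mem_iUnion, Finset.mem_range, exists_prop,
      dist_eq_norm, sub_zero]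
    constructor
    · intro hx
      have h1 : ‖x / u‖ ≤ 1 := by
        rw [norm_div, hun]; exact div_le_one_of_le₀ hx (by positivity)
      let z : ℤ_[p] := ⟨x / u, h1⟩
      obtain ⟨n, hn, hm⟩ := PadicInt.exists_mem_range (p := p) z
      refine ⟨n, hn, ?_⟩
      rw [IsLocalRing.mem_maximalIdeal, PadicInt.mem_nonunits, PadicInt.norm_def] at hm
      have h2 : ‖x / u - n‖ < 1 := hm
      rw [Padic.norm_le_pow_iff_norm_lt_pow_add_one, ← hun]
      have : x - n * u = (x / u - n) * u := by field_simp
      rw [this, norm_mul]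
      nlinarith
    · rintro ⟨a, ha, hx⟩
      have : ‖(a : ℚ_[p]) * u‖ ≤ p ^ (k+1) := by
        rw [norm_mul, hun]
        have : ‖(a : ℚ_[p])‖ ≤ 1 := by exact_mod_cast Padic.norm_int_le_one (p := p) (a : ℤ)
        have h3 : (0 : ℝ) < p ^ (k+1) := by positivity
        nlinarith
      have h4 : x = (x - a * u) + a * u := by ring
      rw [h4, norm_add_le_iff this]
      exact hx.trans hkk.le
  have hdisj : Set.PairwiseDisjoint (↑(Finset.range p))
      (fun a : ℕ => closedBall ((a : ℚ_[p]) * u) ((p : ℝ) ^ k)) := by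
    intro a ha b hb hab
    simp only [Function.onFun]
    rw [Set.disjoint_left]
    intro x hxa hxb
    simp only [mem_closedBall, dist_eq_norm] at hxa hxb
    apply hab
    have h1 : ‖((a : ℤ) - (b : ℤ) : ℤ) * u‖ ≤ (p : ℝ) ^ k := by
      have : (((a : ℤ) - (b : ℤ) : ℤ) : ℚ_[p]) * u = (x - b * u) + -(x - a * u) := by push_cast; ring
      rw [this]
      exact (IsUltrametricDist.norm_add_le_max _ _).trans (max_le hxb (by rwa [norm_neg]))
    have h2 : ‖(((a : ℤ) - (b : ℤ) : ℤ) : ℚ_[p])‖ < 1 := by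
      rw [norm_mul] at h1
      by_contra hcon
      push Not at hcon
      have : ‖u‖ ≤ (p : ℝ) ^ k := by nlinarith
      rw [hun] at this
      linarith
    rw [Padic.norm_intCast_lt_one_iff] at h2
    simp only [Finset.coe_range, Set.mem_Iio] at ha hb
    obtain ⟨c, hc⟩ := h2
    have hc0 : c = 0 := by
      have hp0 : (0 : ℤ) < p := by exact_mod_cast (Fact.out : p.Prime).pos
      have l1 : (p : ℤ) * c < p * 1 := by omega
      have l2 : (p : ℤ) * (-1) < p * c := by omega
      have := lt_of_mul_lt_mul_left l1 hp0.le
      have := lt_of_mul_lt_mul_left l2 hp0.le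
      omega
    rw [hc0] at hc
    omega
  unfold bt
  rw [key, measureReal_biUnion_finset hdisj (fun _ _ => measurableSet_closedBall)
    (fun _ _ => (isCompact_closedBall _ _).measure_lt_top.ne)]
  have : ∀ a : ℕ, μ.real (closedBall ((a : ℚ_[p]) * u) ((p : ℝ) ^ k)) =
      μ.real (closedBall 0 ((p : ℝ) ^ k)) := by
    intro a
    rw [measureReal_def, measureReal_def, Measure.addHaar_closedBall_center]
  simp [this]

lemma bt_zpow (k : ℤ) : bt μ ((p : ℝ) ^ k) = (p : ℝ) ^ k * bt μ 1 := by
  have hp : (p : ℝ) ≠ 0 := by exact_mod_cast (Fact.out : p.Prime).ne_zero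
  induction k using Int.induction_on with
  | zero => simp
  | succ n ih => rw [bt_mul_p, ih, zpow_add_one₀ hp]; ring
  | pred n ih =>
    have := bt_mul_p μ (-(n : ℤ) - 1)
    rw [sub_add_cancel, ih] at this
    have h2 : (p : ℝ) ^ (-(n : ℤ)) = p * (p : ℝ) ^ (-(n : ℤ) - 1) := by
      rw [zpow_sub_one₀ hp]; field_simp
    rw [h2, mul_assoc] at this
    exact (mul_left_cancel₀ hp this).symm

lemma avg_lemma {u : ℚ_[p]} (hu : u ≠ 0) {r : ℝ} (hr : 0 < r) (c : ℚ_[p]) (g : ℚ_[p] → ℂ) :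
    (((bt μ r)⁻¹ : ℝ) : ℂ) * ∫ s in closedBall 0 r, g (c + s * u) ∂μ =
      ∫ ξ, g ξ * ker μ (r * ‖u‖) (ξ - c) ∂μ := by
  have hun : 0 < ‖u‖ := norm_pos_iff.2 hu
  let e : ℚ_[p] ≃ₜ ℚ_[p] := Homeomorph.mulRight₀ u hu
  have he : ∀ s, e s = s * u := fun s => rfl
  let ea : ℚ_[p] ≃+ ℚ_[p] := { e.toEquiv with map_add' := fun a b => by simp [he, add_mul] }
  have : (μ.map ea).IsAddHaarMeasure :=
    ea.isAddHaarMeasure_map μ e.continuous e.symm.continuous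
  obtain ⟨κ, hκ⟩ : ∃ κ : NNReal, μ.map e = κ • μ :=
    ⟨_, Measure.isAddLeftInvariant_eq_smul (μ.map ea) μ⟩
  have key : ∀ G : ℚ_[p] → ℂ, ∫ s in closedBall 0 r, G (s * u) ∂μ
      = κ * ∫ s in closedBall 0 (r * ‖u‖), G s ∂μ := by
    intro G
    have hpre : closedBall 0 r = e ⁻¹' (closedBall 0 (r * ‖u‖)) := by
      ext s
      simp only [mem_closedBall, dist_zero_right, Set.mem_preimage, he, norm_mul]
      exact (mul_le_mul_iff_left₀ hun).symm
    have := setIntegral_map_equiv (μ := μ) e.toMeasurableEquiv G (closedBall 0 (r * ‖u‖))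
    have h2 : ∫ s in closedBall 0 r, G (s * u) ∂μ =
      ∫ s in closedBall 0 (r * ‖u‖), G s ∂(μ.map e) := by
      rw [hpre]; exact this.symm
    rw [h2, hκ, Measure.restrict_smul, integral_smul_nnreal_measure]
    rw [NNReal.smul_def, Complex.real_smul]
  have h1 := key (fun _ => 1)
  simp only [integral_const, measureReal_restrict_apply_univ] at h1
  have h1' : bt μ r = κ * bt μ (r * ‖u‖) := by
    unfold bt
    have : ((μ.real (closedBall 0 r) : ℝ) : ℂ) = ((κ * μ.real (closedBall 0 (r * ‖u‖)) : ℝ) : ℂ) := by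
      push_cast
      simpa using h1
    exact_mod_cast this
  have hb1 := bt_pos μ hr
  have hb2 := bt_pos μ (mul_pos hr hun)
  have hκ0 : (κ : ℝ) ≠ 0 := by
    intro h; rw [h] at h1'; simp at h1'; linarith
  rw [key (fun s => g (c + s)), h1']
  have h3 : ∫ ξ, g ξ * ker μ (r * ‖u‖) (ξ - c) ∂μ =
      ∫ ξ, g (c + ξ) * ker μ (r * ‖u‖) ξ ∂μ := by
    rw [← integral_add_left_eq_self (μ := μ) _ c]
    simp
  rw [h3, ← integral_indicator measurableSet_closedBall, ← mul_assoc]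
  rw [← integral_const_mul]
  congr 1
  ext ξ
  unfold ker
  by_cases h : ‖ξ‖ ≤ r * ‖u‖
  · rw [Set.indicator_of_mem (by simpa using h), if_pos h]
    push_cast
    have : (κ : ℂ) ≠ 0 := by exact_mod_cast hκ0
    field_simp
  · rw [Set.indicator_of_notMem (by simpa using h), if_neg h]
    simp

lemma ker_shift {ρ : ℝ} {η z : ℚ_[p]} (h : ‖η‖ ≤ ρ) : ker μ ρ (z + η) = ker μ ρ z := by
  unfold ker
  simp only [norm_add_le_iff h]

end
end Germ
namespace Germ
open Metric
set_option linter.unusedSectionVars false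
section
variable {p : ℕ} [Fact p.Prime] [MeasurableSpace ℚ_[p]] [BorelSpace ℚ_[p]]
    (μ : Measure ℚ_[p]) [μ.IsAddHaarMeasure] {m : ℕ}

/-- product measure -/
abbrev mX (m : ℕ) : Measure (Fin m → ℚ_[p]) := Measure.pi (fun _ => μ)

lemma exists_norm_eq {y : Fin m → ℚ_[p]} (hy : y ≠ 0) : ∃ i, ‖y i‖ = ‖y‖ := by
  by_contra h
  push Not at h
  have : ‖y‖ < ‖y‖ := (pi_norm_lt_iff (norm_pos_iff.2 hy)).2
    (fun i => lt_of_le_of_ne (norm_le_pi_norm y i) (h i))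
  exact lt_irrefl _ this

lemma norm_dot_le (x y : Fin m → ℚ_[p]) : ‖x ⬝ᵥ y‖ ≤ ‖x‖ * ‖y‖ := by
  unfold dotProduct
  apply IsUltrametricDist.norm_sum_le_of_forall_le_of_nonneg (by positivity)
  intro i _
  rw [norm_mul]
  exact mul_le_mul (norm_le_pi_norm x i) (norm_le_pi_norm y i) (norm_nonneg _) (norm_nonneg _)

lemma continuous_dot : Continuous (fun v : (Fin m → ℚ_[p]) × (Fin m → ℚ_[p]) => v.1 ⬝ᵥ v.2) := by
  unfold dotProduct
  fun_prop

lemma inner_lemma {y : Fin m → ℚ_[p]} (hy : y ≠ 0) {r : ℝ} (hr : 0 < r)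
    (φ : (Fin m → ℚ_[p]) → ℂ) (hφ : Continuous φ) (hφc : HasCompactSupport φ)
    (hinv : ∀ x t, ‖t‖ ≤ r → φ (x + t) = φ x)
    (g : ℚ_[p] → ℂ) (hg : Continuous g) (hgc : HasCompactSupport g) :
    ∫ x, g (x ⬝ᵥ y) * φ x ∂(mX μ m) =
      ∫ x, φ x * ∫ ξ, g ξ * ker μ (r * ‖y‖) (ξ - x ⬝ᵥ y) ∂μ ∂(mX μ m) := by
  obtain ⟨i, hi⟩ := exists_norm_eq hy
  have hyi : y i ≠ 0 := by
    rw [← norm_pos_iff, hi]; exact norm_pos_iff.2 hy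
  have hdc : Continuous (fun x : Fin m → ℚ_[p] => x ⬝ᵥ y) := by
    unfold dotProduct; fun_prop
  have h1 : ∀ s ∈ closedBall (0 : ℚ_[p]) r, ∫ x, g (x ⬝ᵥ y + s * y i) * φ x ∂(mX μ m) =
      ∫ x, g (x ⬝ᵥ y) * φ x ∂(mX μ m) := by
    intro s hs
    rw [← integral_add_right_eq_self (μ := mX μ m) (fun x => g (x ⬝ᵥ y) * φ x) (Pi.single i s)]
    congr 1
    ext x
    rw [add_dotProduct, single_dotProduct, hinv]
    rw [Pi.norm_single]
    simpa using hs
  have hb := bt_pos μ hr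
  have hb' : ((bt μ r : ℝ) : ℂ) ≠ 0 := by exact_mod_cast hb.ne'
  have h2 : (bt μ r : ℂ) * ∫ x, g (x ⬝ᵥ y) * φ x ∂(mX μ m) =
      ∫ s in closedBall (0 : ℚ_[p]) r, ∫ x, g (x ⬝ᵥ y + s * y i) * φ x ∂(mX μ m) ∂μ := by
    rw [setIntegral_congr_fun measurableSet_closedBall h1]
    simp [bt]
  have hfin : IsFiniteMeasure (μ.restrict (closedBall (0 : ℚ_[p]) r)) :=
    ⟨by simpa using (isCompact_closedBall (0 : ℚ_[p]) r).measure_lt_top⟩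
  obtain ⟨M, hM⟩ := hg.bounded_above_of_compact_support hgc
  have hφi : Integrable φ (mX μ m) := hφ.integrable_of_hasCompactSupport hφc
  have hint : Integrable (Function.uncurry fun (s : ℚ_[p]) (x : Fin m → ℚ_[p]) =>
      g (x ⬝ᵥ y + s * y i) * φ x) ((μ.restrict (closedBall (0 : ℚ_[p]) r)).prod (mX μ m)) := by
    have hc : Continuous (fun q : ℚ_[p] × (Fin m → ℚ_[p]) => g (q.2 ⬝ᵥ y + q.1 * y i)) := by
      fun_prop
    have := (hφi.comp_snd (μ.restrict (closedBall (0 : ℚ_[p]) r)))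
    exact this.bdd_mul hc.aestronglyMeasurable (c := M) (Eventually.of_forall fun q => hM _)
  rw [integral_integral_swap hint] at h2
  have h3 : ∀ x, ∫ s in closedBall (0 : ℚ_[p]) r, g (x ⬝ᵥ y + s * y i) * φ x ∂μ =
      (bt μ r : ℂ) * (φ x * ∫ ξ, g ξ * ker μ (r * ‖y‖) (ξ - x ⬝ᵥ y) ∂μ) := by
    intro x
    rw [← hi, ← avg_lemma μ hyi hr, integral_mul_const]
    push_cast
    rw [mul_left_comm (φ x), ← mul_assoc (bt μ r : ℂ), mul_inv_cancel₀ hb', one_mul, mul_comm]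
  simp only [h3] at h2
  rw [integral_const_mul] at h2
  exact mul_left_cancel₀ hb' h2

/-- the density -/
def dens (r : ℝ) (Φ : (Fin m → ℚ_[p]) × (Fin m → ℚ_[p]) → ℂ) (ξ : ℚ_[p]) : ℂ :=
  ∫ v, Φ v * ker μ (r * ‖v.2‖) (ξ - v.1 ⬝ᵥ v.2) ∂((mX μ m).prod (mX μ m))

lemma measurable_ker (r : ℝ) : Measurable (fun q : ((Fin m → ℚ_[p]) × (Fin m → ℚ_[p])) × ℚ_[p] =>
    ker μ (r * ‖q.1.2‖) (q.2 - q.1.1 ⬝ᵥ q.1.2)) := by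
  unfold ker
  have hd : Continuous (fun q : ((Fin m → ℚ_[p]) × (Fin m → ℚ_[p])) × ℚ_[p] =>
      q.1.1 ⬝ᵥ q.1.2) := continuous_dot.comp continuous_fst
  have hn : Continuous (fun q : ((Fin m → ℚ_[p]) × (Fin m → ℚ_[p])) × ℚ_[p] =>
      r * ‖q.1.2‖) := by fun_prop
  refine Measurable.ite ?_ ?_ measurable_const
  · exact (isClosed_le (by fun_prop) hn).measurableSet
  · exact Complex.measurable_ofReal.comp (((bt_mono μ).measurable.comp hn.measurable).inv)

lemma dens_lemma (hm : 0 < m) {r : ℝ} (hr : 0 < r)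
    (Φ : (Fin m → ℚ_[p]) × (Fin m → ℚ_[p]) → ℂ) (hΦ : Continuous Φ) (hΦc : HasCompactSupport Φ)
    (hinv : ∀ v t, ‖t‖ ≤ r → Φ (v + t) = Φ v)
    (g : ℚ_[p] → ℂ) (hg : Continuous g) (hgc : HasCompactSupport g)
    {ε : ℝ} (hε : 0 < ε)
    (H : ∀ v ξ, Φ v ≠ 0 → g ξ ≠ 0 → ‖ξ - v.1 ⬝ᵥ v.2‖ ≤ r * ‖v.2‖ → ε ≤ ‖v.2‖) :
    ∫ v, g (v.1 ⬝ᵥ v.2) * Φ v ∂((mX μ m).prod (mX μ m)) =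
      ∫ ξ, g ξ * dens μ r Φ ξ ∂μ := by
  have hgi : Integrable g μ := hg.integrable_of_hasCompactSupport hgc
  have hΦi : Integrable Φ ((mX μ m).prod (mX μ m)) := hΦ.integrable_of_hasCompactSupport hΦc
  have hbε := bt_pos μ (mul_pos hr hε)
  -- the triple kernel is integrable
  have hint3 : Integrable (Function.uncurry fun (v : (Fin m → ℚ_[p]) × (Fin m → ℚ_[p]))
      (ξ : ℚ_[p]) => Φ v * (g ξ * ker μ (r * ‖v.2‖) (ξ - v.1 ⬝ᵥ v.2)))
      (((mX μ m).prod (mX μ m)).prod μ) := by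
    have hprod := (hΦi.mul_prod hgi).norm.mul_const ((bt μ (r * ε))⁻¹)
    refine hprod.mono' ?_ (Eventually.of_forall ?_)
    · refine Measurable.aestronglyMeasurable ?_
      exact (hΦ.measurable.comp measurable_fst).mul
        ((hg.measurable.comp measurable_snd).mul (measurable_ker μ r))
    · rintro ⟨v, ξ⟩
      simp only [Function.uncurry, norm_mul]
      by_cases h1 : Φ v = 0
      · simp [h1]
      by_cases h2 : g ξ = 0
      · simp [h2]
      rw [← mul_assoc]
      gcongr
      unfold ker
      split_ifs with h3
      · have := H v ξ h1 h2 h3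
        rw [Complex.norm_real, Real.norm_of_nonneg (inv_nonneg.2 (bt_nonneg μ _))]
        gcongr
        exact bt_mono μ (by gcongr)
      · simp [bt_nonneg]
  have hL : Integrable (fun v : (Fin m → ℚ_[p]) × (Fin m → ℚ_[p]) => g (v.1 ⬝ᵥ v.2) * Φ v)
      ((mX μ m).prod (mX μ m)) :=
    ((hg.comp continuous_dot).mul hΦ).integrable_of_hasCompactSupport hΦc.mul_left
  have hnz : ∀ᵐ y : Fin m → ℚ_[p] ∂(mX μ m), y ≠ 0 := by
    rw [ae_iff]; simp; omega
  calc ∫ v, g (v.1 ⬝ᵥ v.2) * Φ v ∂((mX μ m).prod (mX μ m))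
      = ∫ y, ∫ x, g (x ⬝ᵥ y) * Φ (x, y) ∂(mX μ m) ∂(mX μ m) := integral_prod_symm _ hL
    _ = ∫ y, ∫ x, Φ (x, y) * (∫ ξ, g ξ * ker μ (r * ‖y‖) (ξ - x ⬝ᵥ y) ∂μ) ∂(mX μ m) ∂(mX μ m) := by
        apply integral_congr_ae
        filter_upwards [hnz] with y hy
        refine inner_lemma μ hy hr (fun x => Φ (x, y)) (by fun_prop) ?_ ?_ g hg hgc
        · obtain ⟨R, hR⟩ := hΦc.isCompact.isBounded.subset_closedBall 0
          refine HasCompactSupport.intro (isCompact_closedBall 0 R) ?_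
          intro x hx
          by_contra hne
          have := hR (subset_tsupport _ hne)
          apply hx
          simp only [mem_closedBall, dist_zero_right] at this ⊢
          exact (le_max_left _ _).trans this
        · intro x t ht
          have := hinv (x, y) (t, 0) (by simpa [Prod.norm_def] using ht)
          simpa using this
    _ = ∫ v, ∫ ξ, Φ v * (g ξ * ker μ (r * ‖v.2‖) (ξ - v.1 ⬝ᵥ v.2)) ∂μ
          ∂((mX μ m).prod (mX μ m)) := by
        have := integral_prod_symm _ hint3.integral_prod_left
        simp only [Function.uncurry, integral_const_mul] at this ⊢
        exact this.symm
    _ = ∫ ξ, ∫ v, Φ v * (g ξ * ker μ (r * ‖v.2‖) (ξ - v.1 ⬝ᵥ v.2)) 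
          ∂((mX μ m).prod (mX μ m)) ∂μ := integral_integral_swap hint3
    _ = _ := by
        congr 1
        ext ξ
        unfold dens
        rw [← integral_const_mul]
        congr 1
        ext v
        ring

end
end Germ
namespace Germ
open Metric
set_option linter.unusedSectionVars false
section
variable {p : ℕ} [Fact p.Prime] [MeasurableSpace ℚ_[p]] [BorelSpace ℚ_[p]]
    (μ : Measure ℚ_[p]) [μ.IsAddHaarMeasure] {m : ℕ}

/-- has a germ expansion -/
def HasGerm (Φ : (Fin m → ℚ_[p]) × (Fin m → ℚ_[p]) → ℂ) : Prop :=
  ∃ C₀ C₁ : ℚ_[p] → ℂ, IsSchwartzBruhat C₀ ∧ IsSchwartzBruhat C₁ ∧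
    ∀ g : ℚ_[p] → ℂ, Continuous g → HasCompactSupport g → (0 : ℚ_[p]) ∉ tsupport g →
      ∫ v, g (v.1 ⬝ᵥ v.2) * Φ v ∂((mX μ m).prod (mX μ m)) =
        ∫ ξ, g ξ * (C₀ ξ + C₁ ξ * ((‖ξ‖ ^ (m - 1) : ℝ) : ℂ)) ∂μ

lemma sb_of_inv {E : Type*} [NormedAddCommGroup E] [ProperSpace E] {f : E → ℂ} {ρ R : ℝ}
    (hρ : 0 < ρ) (h1 : ∀ x t, ‖t‖ ≤ ρ → f (x + t) = f x) (h2 : ∀ x, R < ‖x‖ → f x = 0) :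
    IsSchwartzBruhat f := by
  constructor
  · rw [IsLocallyConstant.iff_eventually_eq]
    intro x
    filter_upwards [closedBall_mem_nhds x hρ] with y hy
    have := h1 x (y - x) (by rwa [mem_closedBall, dist_eq_norm] at hy)
    rwa [add_sub_cancel] at this
  · refine HasCompactSupport.intro (isCompact_closedBall 0 R) ?_
    intro x hx
    apply h2
    simpa using hx

lemma sb_zero {E : Type*} [TopologicalSpace E] : IsSchwartzBruhat (fun _ : E => (0 : ℂ)) :=
  ⟨IsLocallyConstant.const 0, HasCompactSupport.zero⟩

lemma sb_add {E : Type*} [TopologicalSpace E] {f g : E → ℂ} (hf : IsSchwartzBruhat f)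
    (hg : IsSchwartzBruhat g) : IsSchwartzBruhat (fun x => f x + g x) :=
  ⟨hf.1.add hg.1, hf.2.add hg.2⟩

lemma sb_smul {E : Type*} [TopologicalSpace E] {f : E → ℂ} (c : ℂ) (hf : IsSchwartzBruhat f) :
    IsSchwartzBruhat (fun x => c * f x) :=
  ⟨(IsLocallyConstant.const c).mul hf.1, hf.2.mul_left⟩

lemma integrable_side {C₀ C₁ g : ℚ_[p] → ℂ} (h0 : IsSchwartzBruhat C₀) (h1 : IsSchwartzBruhat C₁)
    (hg : Continuous g) (hgc : HasCompactSupport g) (k : ℕ) :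
    Integrable (fun ξ => g ξ * (C₀ ξ + C₁ ξ * ((‖ξ‖ ^ k : ℝ) : ℂ))) μ := by
  have c0 := h0.1.continuous
  have c1 := h1.1.continuous
  refine Continuous.integrable_of_hasCompactSupport ?_ hgc.mul_right
  fun_prop

lemma HasGerm.add {Φ Ψ : (Fin m → ℚ_[p]) × (Fin m → ℚ_[p]) → ℂ} (hΦ : IsSchwartzBruhat Φ)
    (hΨ : IsSchwartzBruhat Ψ) (h1 : HasGerm μ Φ) (h2 : HasGerm μ Ψ) :
    HasGerm μ (fun v => Φ v + Ψ v) := by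
  obtain ⟨A, B, hA, hB, h⟩ := h1
  obtain ⟨A', B', hA', hB', h'⟩ := h2
  refine ⟨_, _, sb_add hA hA', sb_add hB hB', ?_⟩
  intro g hg hgc hg0
  have i1 : ∀ {Φ : (Fin m → ℚ_[p]) × (Fin m → ℚ_[p]) → ℂ}, IsSchwartzBruhat Φ →
      Integrable (fun v => g (v.1 ⬝ᵥ v.2) * Φ v) ((mX μ m).prod (mX μ m)) := fun hΦ =>
    ((hg.comp continuous_dot).mul hΦ.1.continuous).integrable_of_hasCompactSupport hΦ.2.mul_left
  simp only [mul_add (g _) (Φ _)]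
  rw [integral_add (i1 hΦ) (i1 hΨ), h g hg hgc hg0, h' g hg hgc hg0, ← integral_add
    (integrable_side μ hA hB hg hgc _) (integrable_side μ hA' hB' hg hgc _)]
  congr 1
  ext ξ
  ring

lemma HasGerm.smul {Φ : (Fin m → ℚ_[p]) × (Fin m → ℚ_[p]) → ℂ} (c : ℂ) (h1 : HasGerm μ Φ) :
    HasGerm μ (fun v => c * Φ v) := by
  obtain ⟨A, B, hA, hB, h⟩ := h1
  refine ⟨_, _, sb_smul c hA, sb_smul c hB, ?_⟩
  intro g hg hgc hg0
  simp only [mul_left_comm (g _) c]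
  rw [integral_const_mul, h g hg hgc hg0, ← integral_const_mul]
  congr 1
  ext ξ
  ring

lemma case_one (hm : 0 < m) {r : ℝ} (hr : 0 < r)
    (Φ : (Fin m → ℚ_[p]) × (Fin m → ℚ_[p]) → ℂ) (hΦ : IsSchwartzBruhat Φ)
    (hinv : ∀ v t, ‖t‖ ≤ r → Φ (v + t) = Φ v)
    (hz : ∀ v, ‖v.2‖ ≤ r → Φ v = 0) : HasGerm μ Φ := by
  refine ⟨dens μ r Φ, fun _ => 0, ?_, sb_zero, ?_⟩
  · obtain ⟨R, hR⟩ := hΦ.2.isCompact.isBounded.subset_closedBall 0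
    refine sb_of_inv (ρ := r * r) (R := max (R * R) (r * R)) (by positivity) ?_ ?_
    · intro ξ η hη
      unfold dens
      congr 1
      ext v
      by_cases hv : ‖v.2‖ ≤ r
      · simp [hz v hv]
      · rw [show ξ + η - v.1 ⬝ᵥ v.2 = ξ - v.1 ⬝ᵥ v.2 + η by ring, ker_shift]
        push Not at hv
        nlinarith
    · intro ξ hξ
      unfold dens
      rw [← integral_zero ((Fin m → ℚ_[p]) × (Fin m → ℚ_[p])) ℂ]
      congr 1
      ext v
      by_cases hv : Φ v = 0
      · simp [hv]
      have hvR : ‖v‖ ≤ R := by simpa using hR (subset_tsupport _ hv)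
      have hv1 : ‖v.1‖ ≤ R := (le_max_left _ _).trans hvR
      have hv2 : ‖v.2‖ ≤ R := (le_max_right _ _).trans hvR
      have hR0 : 0 ≤ R := (norm_nonneg _).trans hv1
      have hd : ‖v.1 ⬝ᵥ v.2‖ ≤ R * R := (norm_dot_le _ _).trans (by gcongr)
      unfold ker
      rw [if_neg, mul_zero]
      intro hk
      have : ‖ξ‖ ≤ max (r * R) (R * R) := by
        have h3 := IsUltrametricDist.norm_add_le_max (ξ - v.1 ⬝ᵥ v.2) (v.1 ⬝ᵥ v.2)
        rw [sub_add_cancel] at h3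
        exact h3.trans (max_le_max (hk.trans (by gcongr)) hd)
      rw [max_comm] at this
      linarith
  · intro g hg hgc hg0
    simp only [zero_mul, add_zero]
    refine dens_lemma μ hm hr Φ hΦ.1.continuous hΦ.2 hinv g hg hgc hr ?_
    intro v ξ h1 _ _
    by_contra h
    push Not at h
    exact h1 (hz v h.le)

lemma case_two (hm : 0 < m) {r : ℝ} (hr : 0 < r)
    (Φ : (Fin m → ℚ_[p]) × (Fin m → ℚ_[p]) → ℂ) (hΦ : IsSchwartzBruhat Φ)
    (hinv : ∀ v t, ‖t‖ ≤ r → Φ (v + t) = Φ v)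
    (hz : ∀ v, ‖v.1‖ ≤ r → Φ v = 0) : HasGerm μ Φ := by
  have := case_one μ hm hr (fun v => Φ v.swap) ?_ ?_ ?_
  · obtain ⟨A, B, hA, hB, h⟩ := this
    refine ⟨A, B, hA, hB, ?_⟩
    intro g hg hgc hg0
    rw [← h g hg hgc hg0, ← integral_prod_swap]
    simp [dotProduct_comm]
  · refine ⟨hΦ.1.comp_continuous continuous_swap, ?_⟩
    exact hΦ.2.comp_homeomorph (Homeomorph.prodComm _ _)
  · intro v t ht
    rw [Prod.swap_add]
    apply hinv
    rw [Prod.norm_def] at ht ⊢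
    rwa [max_comm]
  · intro v hv
    exact hz _ hv

end
end Germ
namespace Germ
open Metric
set_option linter.unusedSectionVars false
section
variable {p : ℕ} [Fact p.Prime] [MeasurableSpace ℚ_[p]] [BorelSpace ℚ_[p]]
    (μ : Measure ℚ_[p]) [μ.IsAddHaarMeasure] {m : ℕ}

lemma norm_zpow_X {y : Fin m → ℚ_[p]} (hy : y ≠ 0) : ∃ a : ℤ, ‖y‖ = (p : ℝ) ^ a := by
  obtain ⟨i, hi⟩ := exists_norm_eq hy
  have hyi : y i ≠ 0 := by
    rw [← norm_pos_iff, hi]; exact norm_pos_iff.2 hy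
  exact ⟨_, by rw [← hi, Padic.norm_eq_zpow_neg_valuation hyi]⟩

lemma real_ball (k : ℤ) : (mX μ m).real (closedBall 0 ((p : ℝ) ^ k)) =
    ((p : ℝ) ^ k * bt μ 1) ^ m := by
  have hpp : (0 : ℝ) < p := by exact_mod_cast (Fact.out : p.Prime).pos
  rw [measureReal_def, Measure.pi_closedBall _ _ (by positivity), ENNReal.toReal_prod, ← bt_zpow]
  simp [bt, measureReal_def]

lemma real_sphere (k : ℤ) : (mX μ m).real (sphere 0 ((p : ℝ) ^ k)) =
    ((p : ℝ) ^ k * bt μ 1) ^ m * (1 - ((p : ℝ)⁻¹) ^ m) := by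
  have hpp : (0 : ℝ) < p := by exact_mod_cast (Fact.out : p.Prime).pos
  have hp1 : (1 : ℝ) < p := by exact_mod_cast (Fact.out : p.Prime).one_lt
  have hlt : (p : ℝ) ^ (k-1) < (p : ℝ) ^ k := zpow_lt_zpow_right₀ hp1 (by omega)
  have : sphere (0 : Fin m → ℚ_[p]) ((p : ℝ) ^ k) =
      closedBall 0 ((p : ℝ) ^ k) \ closedBall 0 ((p : ℝ) ^ (k-1)) := by
    ext y
    simp only [mem_sphere_iff_norm, sub_zero, Set.mem_sdiff, mem_closedBall, dist_zero_right, not_le]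
    constructor
    · intro h; rw [h]; exact ⟨le_rfl, hlt⟩
    · rintro ⟨h1, h2⟩
      have hy : y ≠ 0 := by
        rw [← norm_pos_iff]; exact lt_trans (by positivity) h2
      obtain ⟨a, ha⟩ := norm_zpow_X hy
      rw [ha] at h1 h2 ⊢
      rw [zpow_le_zpow_iff_right₀ hp1] at h1
      rw [zpow_lt_zpow_iff_right₀ hp1] at h2
      congr 1; omega
  rw [this, measureReal_sdiff (closedBall_subset_closedBall hlt.le) measurableSet_closedBall
    (isCompact_closedBall _ _).measure_lt_top.ne, real_ball, real_ball, zpow_sub_one₀ hpp.ne']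
  rw [mul_pow, mul_pow, mul_pow]
  ring

lemma dens_box (hm : 2 ≤ m) (N : ℤ) : ∃ A B : ℝ, ∀ (n : ℕ) (ξ : ℚ_[p]),
    ‖ξ‖ = (p : ℝ) ^ (2 * N - n) →
    dens μ ((p : ℝ) ^ N) (Set.indicator (closedBall (0 : Fin m → ℚ_[p]) ((p : ℝ) ^ N) ×ˢ
      closedBall (0 : Fin m → ℚ_[p]) ((p : ℝ) ^ N)) (fun _ => 1)) ξ =
      ((A + B * ‖ξ‖ ^ (m - 1) : ℝ) : ℂ) := by
  have hpp : (0 : ℝ) < p := by exact_mod_cast (Fact.out : p.Prime).pos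
  have hp1 : (1 : ℝ) < p := by exact_mod_cast (Fact.out : p.Prime).one_lt
  set q : ℝ := ((p : ℝ)⁻¹) ^ (m - 1) with hq
  have hq1 : q < 1 := pow_lt_one₀ (by positivity) (inv_lt_one_of_one_lt₀ hp1) (by omega)
  have hq1' : 1 - q ≠ 0 := by linarith
  set r : ℝ := (p : ℝ) ^ N with hr
  have hr0 : 0 < r := by positivity
  have hb : 0 < bt μ 1 := bt_pos μ one_pos
  -- constant
  set D : ℝ := (r * bt μ 1) ^ m * (r * bt μ 1) ^ m * (1 - ((p : ℝ)⁻¹) ^ m) * (r * r * bt μ 1)⁻¹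
    with hD
  refine ⟨D / (1 - q), - D / (1 - q) * q * ((r * r)⁻¹) ^ (m - 1), ?_⟩
  intro n ξ hξ
  let S : ℕ → Set ((Fin m → ℚ_[p]) × (Fin m → ℚ_[p])) := fun k =>
    closedBall 0 r ×ˢ sphere 0 ((p : ℝ) ^ (N - k))
  have hSm : ∀ k, MeasurableSet (S k) := fun k =>
    measurableSet_closedBall.prod isClosed_sphere.measurableSet
  have hSfin : ∀ k, ((mX μ m).prod (mX μ m)) (S k) ≠ ⊤ := fun k =>
    ((isCompact_closedBall _ _).prod (isCompact_sphere _ _)).measure_lt_top.ne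
  have hSv : ∀ k : ℕ, ((mX μ m).prod (mX μ m)).real (S k) * (bt μ ((p : ℝ) ^ (2 * N - k)))⁻¹ =
      D * q ^ k := by
    intro k
    rw [measureReal_prod_prod, hr, real_ball, real_sphere, bt_zpow, hD, hq]
    have e1 : (p : ℝ) ^ (N - (k : ℤ)) = r * ((p : ℝ)⁻¹) ^ k := by
      rw [zpow_sub₀ hpp.ne', hr]; simp [div_eq_mul_inv]
    have e2 : (p : ℝ) ^ (2 * N - (k : ℤ)) = r * r * ((p : ℝ)⁻¹) ^ k := by
      rw [zpow_sub₀ hpp.ne', two_mul, zpow_add₀ hpp.ne', hr]; simp [div_eq_mul_inv]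
    rw [e1, e2]
    obtain ⟨j, rfl⟩ : ∃ j, m = j + 1 := ⟨m - 1, by omega⟩
    rw [Nat.add_sub_cancel, ← hr, ← pow_mul, mul_comm j k, pow_mul]
    have hz : ((p : ℝ)⁻¹) ^ k ≠ 0 := by positivity
    generalize ((p : ℝ)⁻¹) ^ k = z at hz
    simp only [mul_pow, mul_inv]
    field_simp
    ring
  have hpt : ∀ v : (Fin m → ℚ_[p]) × (Fin m → ℚ_[p]),
      Set.indicator (closedBall 0 r ×ˢ closedBall 0 r) (fun _ => (1 : ℂ)) v *
        ker μ (r * ‖v.2‖) (ξ - v.1 ⬝ᵥ v.2) =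
      ∑ k ∈ Finset.range (n + 1), Set.indicator (S k)
        (fun _ => (((bt μ ((p : ℝ) ^ (2 * N - k)))⁻¹ : ℝ) : ℂ)) v := by
    rintro ⟨x, y⟩
    by_cases hx : ‖x‖ ≤ r
    swap
    · rw [Set.indicator_of_notMem (by simp [hx]), zero_mul]
      symm; apply Finset.sum_eq_zero
      intro k _
      rw [Set.indicator_of_notMem (by simp [S, hx])]
    have hker : ker μ (r * ‖y‖) (ξ - x ⬝ᵥ y) = ker μ (r * ‖y‖) ξ := by
      rw [sub_eq_add_neg, ker_shift]
      rw [norm_neg]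
      exact (norm_dot_le x y).trans (by gcongr)
    simp only [hker]
    by_cases hy : y = 0
    · have h0 : ¬ ‖ξ‖ ≤ r * ‖y‖ := by
        rw [hy, norm_zero, mul_zero, hξ, not_le]; positivity
      unfold ker
      rw [if_neg h0, mul_zero]
      symm; apply Finset.sum_eq_zero
      intro k _
      rw [Set.indicator_of_notMem]
      simp only [S, Set.mem_prod, mem_sphere_iff_norm, sub_zero, hy, norm_zero, not_and]
      intro _
      have : (0 : ℝ) < (p : ℝ) ^ (N - (k : ℤ)) := by positivity
      exact this.ne
    obtain ⟨a, ha⟩ := norm_zpow_X hy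
    have hS : ∀ k : ℕ, (x, y) ∈ S k ↔ a = N - k := by
      intro k
      simp only [S, Set.mem_prod, mem_closedBall, dist_zero_right, hx, true_and,
        mem_sphere_iff_norm, sub_zero, ha]
      exact zpow_right_inj₀ hpp hp1.ne'
    have hra : r * ‖y‖ = (p : ℝ) ^ (N + a) := by rw [ha, hr, zpow_add₀ hpp.ne']
    by_cases haN : a ≤ N
    · rw [Set.indicator_of_mem (by
        simp only [Set.mem_prod, mem_closedBall, dist_zero_right, ha]
        exact ⟨hx, zpow_le_zpow_right₀ hp1.le haN⟩), one_mul]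
      obtain ⟨k, hk⟩ : ∃ k : ℕ, a = N - k := ⟨(N - a).toNat, by omega⟩
      have hle : ‖ξ‖ ≤ r * ‖y‖ ↔ k ≤ n := by
        rw [hξ, hra, zpow_le_zpow_iff_right₀ hp1]; omega
      have hoff : ∀ j ∈ Finset.range (n+1), j ≠ k → Set.indicator (S j)
        (fun _ => (((bt μ ((p : ℝ) ^ (2 * N - j)))⁻¹ : ℝ) : ℂ)) (x, y) = 0 := by
        intro j _ hj
        rw [Set.indicator_of_notMem]
        rw [hS]; omega
      unfold ker
      by_cases hkn : k ≤ n
      · rw [if_pos (hle.2 hkn), Finset.sum_eq_single k hoff (by simp; omega),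
          Set.indicator_of_mem ((hS k).2 hk), hra]
        congr 4
        omega
      · rw [if_neg (by rw [hle]; exact hkn)]
        symm; apply Finset.sum_eq_zero
        intro j hj
        apply hoff j hj
        simp at hj; omega
    · rw [Set.indicator_of_notMem, zero_mul]
      · symm; apply Finset.sum_eq_zero
        intro k _
        rw [Set.indicator_of_notMem]
        rw [hS]; omega
      · simp only [Set.mem_prod, mem_closedBall, dist_zero_right, ha]
        rintro ⟨_, h⟩
        rw [hr, zpow_le_zpow_iff_right₀ hp1] at h
        exact haN h
  unfold dens
  simp only [hpt]
  rw [integral_finsetSum]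
  swap
  · intro k _
    exact (integrable_indicator_iff (hSm k)).2 (integrableOn_const (hSfin k))
  have hsum : ∀ k ∈ Finset.range (n+1), ∫ v, Set.indicator (S k)
        (fun _ => (((bt μ ((p : ℝ) ^ (2 * N - k)))⁻¹ : ℝ) : ℂ)) v ∂((mX μ m).prod (mX μ m)) =
        ((D * q ^ k : ℝ) : ℂ) := by
    intro k _
    rw [integral_indicator_const _ (hSm k), ← hSv k, Complex.real_smul]
    push_cast; rfl
  rw [Finset.sum_congr rfl hsum, ← Complex.ofReal_sum, ← Finset.mul_sum, geom_sum_eq hq1.ne]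
  congr 1
  have e2 : ‖ξ‖ = r * r * ((p : ℝ)⁻¹) ^ n := by
    rw [hξ, zpow_sub₀ hpp.ne', two_mul, zpow_add₀ hpp.ne', hr]; simp [div_eq_mul_inv]
  have e3 : ((r * r)⁻¹) ^ (m - 1) * ‖ξ‖ ^ (m - 1) = q ^ n := by
    rw [← mul_pow, e2, hq, ← pow_mul, mul_comm (m - 1) n, pow_mul]
    congr 1
    field_simp
  have e4 : q - 1 ≠ 0 := by linarith
  rw [mul_assoc _ (((r * r)⁻¹) ^ (m - 1)), e3]
  rw [← neg_sub q 1, pow_succ]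
  field_simp
  ring

lemma case_box (hm : 2 ≤ m) (N : ℤ) : HasGerm μ
    (Set.indicator (closedBall (0 : Fin m → ℚ_[p]) ((p : ℝ) ^ N) ×ˢ
      closedBall (0 : Fin m → ℚ_[p]) ((p : ℝ) ^ N)) (fun _ => (1 : ℂ))) := by
  have hpp : (0 : ℝ) < p := by exact_mod_cast (Fact.out : p.Prime).pos
  have hp1 : (1 : ℝ) < p := by exact_mod_cast (Fact.out : p.Prime).one_lt
  obtain ⟨A, B, hAB⟩ := dens_box μ hm N
  set r : ℝ := (p : ℝ) ^ N with hr
  have hr0 : 0 < r := by positivity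
  set Φ : (Fin m → ℚ_[p]) × (Fin m → ℚ_[p]) → ℂ :=
    (Set.indicator (closedBall (0 : Fin m → ℚ_[p]) r ×ˢ
      closedBall (0 : Fin m → ℚ_[p]) r) (fun _ => (1 : ℂ))) with hΦdef
  have hmem : ∀ v : (Fin m → ℚ_[p]) × (Fin m → ℚ_[p]),
      v ∈ closedBall (0 : Fin m → ℚ_[p]) r ×ˢ closedBall (0 : Fin m → ℚ_[p]) r ↔
      ‖v.1‖ ≤ r ∧ ‖v.2‖ ≤ r := by
    intro v; simp [Set.mem_prod]
  have hinv : ∀ v t, ‖t‖ ≤ r → Φ (v + t) = Φ v := by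
    intro v t ht
    have h1 : ‖t.1‖ ≤ r := (le_max_left _ _).trans ht
    have h2 : ‖t.2‖ ≤ r := (le_max_right _ _).trans ht
    have : (v + t) ∈ closedBall (0 : Fin m → ℚ_[p]) r ×ˢ closedBall (0 : Fin m → ℚ_[p]) r ↔
      v ∈ closedBall (0 : Fin m → ℚ_[p]) r ×ˢ closedBall (0 : Fin m → ℚ_[p]) r := by
      rw [hmem, hmem, Prod.fst_add, Prod.snd_add, norm_add_le_iff h1, norm_add_le_iff h2]
    by_cases h : v ∈ closedBall (0 : Fin m → ℚ_[p]) r ×ˢ closedBall (0 : Fin m → ℚ_[p]) r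
    · rw [hΦdef, Set.indicator_of_mem h, Set.indicator_of_mem (this.2 h)]
    · rw [hΦdef, Set.indicator_of_notMem h, Set.indicator_of_notMem (fun h' => h (this.1 h'))]
  have hne : ∀ v, Φ v ≠ 0 → ‖v.1‖ ≤ r ∧ ‖v.2‖ ≤ r := by
    intro v hv
    rw [← hmem]
    exact Set.mem_of_indicator_ne_zero hv
  have hΦ : IsSchwartzBruhat Φ := by
    refine sb_of_inv hr0 hinv (R := r) ?_
    intro v hv
    by_contra h
    have := hne v h
    exact absurd (max_le this.1 this.2) (not_le.2 hv)
  have hSB : ∀ c : ℂ, IsSchwartzBruhat (fun ξ : ℚ_[p] => if ‖ξ‖ ≤ r * r then c else 0) := by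
    intro c
    refine sb_of_inv (ρ := r * r) (R := r * r) (by positivity) ?_ ?_
    · intro x t ht
      simp only [norm_add_le_iff ht]
    · intro x hx
      rw [if_neg (not_le.2 hx)]
  refine ⟨_, _, hSB (A : ℂ), hSB (B : ℂ), ?_⟩
  intro g hg hgc hg0
  obtain ⟨δ, hδ, hδg⟩ : ∃ δ > 0, ∀ ξ, g ξ ≠ 0 → δ ≤ ‖ξ‖ := by
    have := (isClosed_tsupport g).isOpen_compl.mem_nhds hg0
    obtain ⟨δ, hδ, hs⟩ := Metric.mem_nhds_iff.1 this
    refine ⟨δ, hδ, fun ξ hξ => ?_⟩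
    by_contra h
    push Not at h
    exact hs (by simpa using h) (subset_tsupport _ hξ)
  rw [dens_lemma μ (by omega) hr0 Φ hΦ.1.continuous hΦ.2 hinv g hg hgc (ε := δ / r) (by positivity)]
  · congr 1
    ext ξ
    by_cases hgξ : g ξ = 0
    · simp [hgξ]
    congr 1
    have hξ0 : ξ ≠ 0 := by
      rw [← norm_pos_iff]; exact lt_of_lt_of_le hδ (hδg ξ hgξ)
    have hrr : r * r = (p : ℝ) ^ (2 * N) := by rw [two_mul, zpow_add₀ hpp.ne']
    by_cases hle : ‖ξ‖ ≤ r * r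
    · have hv := Padic.norm_eq_zpow_neg_valuation hξ0
      obtain ⟨n, hn⟩ : ∃ n : ℕ, -ξ.valuation = 2 * N - n := by
        rw [hv, hrr, zpow_le_zpow_iff_right₀ hp1] at hle
        exact ⟨(2 * N + ξ.valuation).toNat, by omega⟩
      rw [hn] at hv
      rw [hAB n ξ hv, if_pos hle, if_pos hle]
      push_cast; rfl
    · rw [if_neg hle, if_neg hle, zero_mul, add_zero]
      unfold dens
      rw [← integral_zero ((Fin m → ℚ_[p]) × (Fin m → ℚ_[p])) ℂ]
      congr 1
      ext v
      by_cases hv : Φ v = 0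
      · simp [hv]
      obtain ⟨h1, h2⟩ := hne v hv
      unfold ker
      rw [if_neg, mul_zero]
      intro hk
      apply hle
      have h3 : ‖-(v.1 ⬝ᵥ v.2)‖ ≤ r * ‖v.2‖ := by
        rw [norm_neg]; exact (norm_dot_le _ _).trans (by gcongr)
      rw [sub_eq_add_neg, norm_add_le_iff h3] at hk
      exact hk.trans (by gcongr)
  · intro v ξ hv hgξ hk
    obtain ⟨h1, h2⟩ := hne v hv
    have h3 : ‖-(v.1 ⬝ᵥ v.2)‖ ≤ r * ‖v.2‖ := by
      rw [norm_neg]; exact (norm_dot_le _ _).trans (by gcongr)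
    rw [sub_eq_add_neg, norm_add_le_iff h3] at hk
    rw [div_le_iff₀ hr0, mul_comm]
    exact (hδg ξ hgξ).trans hk

end
end Germ
namespace Germ
open Metric
set_option linter.unusedSectionVars false
section
variable {p : ℕ} [Fact p.Prime] [MeasurableSpace ℚ_[p]] [BorelSpace ℚ_[p]]
    (μ : Measure ℚ_[p]) [μ.IsAddHaarMeasure] {m : ℕ}

lemma unif_inv {E : Type*} [NormedAddCommGroup E] {f : E → ℂ} (hf : IsSchwartzBruhat f) :
    ∃ δ > 0, ∀ x t, ‖t‖ < δ → f (x + t) = f x := by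
  obtain ⟨δ, hδ, h⟩ := lebesgue_number_lemma_of_metric (c := fun z : ℂ => f ⁻¹' {z}) hf.2.isCompact
    (fun z => hf.1.isOpen_fiber z) (fun x _ => by simp)
  have key : ∀ x ∈ tsupport f, ∀ t, ‖t‖ < δ → f (x + t) = f x := by
    intro x hx t ht
    obtain ⟨z, hz⟩ := h x hx
    have h1 : f (x + t) = z := hz (by simpa [dist_eq_norm] using ht)
    have h2 : f x = z := hz (by simpa using hδ)
    rw [h1, h2]
  refine ⟨δ, hδ, fun x t ht => ?_⟩
  by_cases hx : x ∈ tsupport f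
  · exact key x hx t ht
  by_cases hx' : x + t ∈ tsupport f
  · have := key _ hx' (-t) (by rwa [norm_neg])
    rw [add_neg_cancel_right] at this
    exact this.symm
  · rw [image_eq_zero_of_notMem_tsupport hx, image_eq_zero_of_notMem_tsupport hx']

lemma hasGerm_all (hm : 2 ≤ m) (Φ : (Fin m → ℚ_[p]) × (Fin m → ℚ_[p]) → ℂ)
    (hΦ : IsSchwartzBruhat Φ) : HasGerm μ Φ := by
  have hpp : (0 : ℝ) < p := by exact_mod_cast (Fact.out : p.Prime).pos
  have hp1 : (1 : ℝ) < p := by exact_mod_cast (Fact.out : p.Prime).one_lt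
  obtain ⟨δ, hδ, hδinv⟩ := unif_inv hΦ
  obtain ⟨n, hn⟩ := exists_pow_lt_of_lt_one hδ (inv_lt_one_of_one_lt₀ hp1)
  obtain ⟨N, hN⟩ : ∃ N : ℤ, (p : ℝ) ^ N < δ := ⟨-n, by simpa using hn⟩
  have hbox := case_box μ hm N
  set r : ℝ := (p : ℝ) ^ N with hr
  have hr0 : 0 < r := by positivity
  have hinv : ∀ v t, ‖t‖ ≤ r → Φ (v + t) = Φ v := fun v t ht => hδinv v t (ht.trans_lt hN)
  obtain ⟨R, hR⟩ := hΦ.2.isCompact.isBounded.subset_closedBall 0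
  have hR' : ∀ v, R < ‖v‖ → Φ v = 0 := by
    intro v hv
    by_contra h
    have := hR (subset_tsupport _ h)
    simp at this
    linarith
  let Φ1 : (Fin m → ℚ_[p]) × (Fin m → ℚ_[p]) → ℂ := fun v => if ‖v.2‖ ≤ r then 0 else Φ v
  let Φ2 : (Fin m → ℚ_[p]) × (Fin m → ℚ_[p]) → ℂ := fun v =>
    if ‖v.2‖ ≤ r then (if ‖v.1‖ ≤ r then 0 else Φ v) else 0
  let Φ3 : (Fin m → ℚ_[p]) × (Fin m → ℚ_[p]) → ℂ := fun v =>
    Φ 0 * Set.indicator (closedBall (0 : Fin m → ℚ_[p]) r ×ˢ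
      closedBall (0 : Fin m → ℚ_[p]) r) (fun _ => (1 : ℂ)) v
  have i1 : ∀ v t, ‖t‖ ≤ r → Φ1 (v + t) = Φ1 v := by
    intro v t ht
    have h2 : ‖t.2‖ ≤ r := (le_max_right _ _).trans ht
    simp only [Φ1, hinv v t ht, Prod.snd_add, norm_add_le_iff h2]
  have i2 : ∀ v t, ‖t‖ ≤ r → Φ2 (v + t) = Φ2 v := by
    intro v t ht
    have h1 : ‖t.1‖ ≤ r := (le_max_left _ _).trans ht
    have h2 : ‖t.2‖ ≤ r := (le_max_right _ _).trans ht
    simp only [Φ2, hinv v t ht, Prod.snd_add, Prod.fst_add, norm_add_le_iff h2, norm_add_le_iff h1]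
  have s1 : IsSchwartzBruhat Φ1 := sb_of_inv hr0 i1 (R := R) (fun v hv => by simp [Φ1, hR' v hv])
  have s2 : IsSchwartzBruhat Φ2 := sb_of_inv hr0 i2 (R := R) (fun v hv => by simp [Φ2, hR' v hv])
  have heq : ∀ v, Φ v = Φ1 v + Φ2 v + Φ3 v := by
    intro v
    by_cases h2 : ‖v.2‖ ≤ r
    · by_cases h1 : ‖v.1‖ ≤ r
      · have : Φ v = Φ 0 := by
          have := hinv 0 v (max_le h1 h2)
          rwa [zero_add] at this
        have hmem : v ∈ closedBall (0 : Fin m → ℚ_[p]) r ×ˢ closedBall (0 : Fin m → ℚ_[p]) r := by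
          simp [Set.mem_prod, h1, h2]
        simp only [Φ1, Φ2, Φ3, h1, h2, Set.indicator_of_mem hmem]
        simp [this]
      · have hmem : v ∉ closedBall (0 : Fin m → ℚ_[p]) r ×ˢ closedBall (0 : Fin m → ℚ_[p]) r := by
          simp [Set.mem_prod, h1]
        simp only [Φ1, Φ2, Φ3, h1, h2, Set.indicator_of_notMem hmem]
        simp
    · have hmem : v ∉ closedBall (0 : Fin m → ℚ_[p]) r ×ˢ closedBall (0 : Fin m → ℚ_[p]) r := by
        simp [Set.mem_prod, h2]
      simp only [Φ1, Φ2, Φ3, h2, Set.indicator_of_notMem hmem]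
      simp
  have s3 : IsSchwartzBruhat Φ3 := by
    have e : Φ3 = fun v => Φ v + (-1) * (Φ1 v + Φ2 v) := by
      ext v; rw [heq v]; ring
    rw [e]
    exact sb_add hΦ (sb_smul _ (sb_add s1 s2))
  have g1 : HasGerm μ Φ1 := case_one μ (by omega) hr0 Φ1 s1 i1 (fun v hv => by simp [Φ1, hv])
  have g2 : HasGerm μ Φ2 := case_two μ (by omega) hr0 Φ2 s2 i2 (fun v hv => by simp [Φ2, hv])
  have g3 : HasGerm μ Φ3 := HasGerm.smul μ _ hbox
  have := HasGerm.add μ (sb_add s1 s2) s3 (HasGerm.add μ s1 s2 g1 g2) g3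
  rwa [show Φ = _ from funext heq]

/-- splitting coordinates -/
def spl (p : ℕ) [Fact p.Prime] (m : ℕ) :
    (Fin (m + m) → ℚ_[p]) ≃+ (Fin m → ℚ_[p]) × (Fin m → ℚ_[p]) where
  toFun x := (fun i => x ⟨2 * i, by omega⟩, fun i => x ⟨2 * i + 1, by omega⟩)
  invFun v := fun j => if (j : ℕ) % 2 = 0 then v.1 ⟨j / 2, by omega⟩ else v.2 ⟨j / 2, by omega⟩
  left_inv x := by
    ext j
    dsimp only
    split_ifs with h
    · congr 1; ext; simp only; omega
    · congr 1; ext; simp only; omega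
  right_inv v := by
    ext i
    · simp
    · have : (2 * (i : ℕ) + 1) / 2 = i := by omega
      simp [Nat.add_mod, this]
  map_add' x y := rfl

lemma spl_cont : Continuous (spl p m) := by
  change Continuous (fun x : Fin (m + m) → ℚ_[p] =>
    ((fun i : Fin m => x ⟨2 * i, by omega⟩ : Fin m → ℚ_[p]),
      (fun i : Fin m => x ⟨2 * i + 1, by omega⟩ : Fin m → ℚ_[p])))
  fun_prop

lemma spl_symm_cont : Continuous (spl p m).symm := by
  change Continuous (fun v : (Fin m → ℚ_[p]) × (Fin m → ℚ_[p]) => fun j : Fin (m + m) =>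
    if (j : ℕ) % 2 = 0 then v.1 ⟨j / 2, by omega⟩ else v.2 ⟨j / 2, by omega⟩)
  refine continuous_pi fun j => ?_
  split_ifs
  · fun_prop
  · fun_prop

lemma split_eq (x : Fin (m + m) → ℚ_[p]) :
    splitQP p (m + m) x = (spl p m x).1 ⬝ᵥ (spl p m x).2 := by
  unfold splitQP dotProduct
  rw [if_pos ⟨m, rfl⟩, show (m + m) / 2 = m by omega, Finset.sum_range]
  apply Finset.sum_congr rfl
  intro i _
  unfold padP
  rw [dif_pos (by omega), dif_pos (by omega)]
  rfl

lemma uniq {f f' : ℚ_[p] → ℂ} (hf : LocallyConstantOn f ({0}ᶜ : Set ℚ_[p]))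
    (hf' : LocallyConstantOn f' ({0}ᶜ : Set ℚ_[p]))
    (h : ∀ g : ℚ_[p] → ℂ, Continuous g → HasCompactSupport g → (0 : ℚ_[p]) ∉ tsupport g →
      ∫ ξ, g ξ * f ξ ∂μ = ∫ ξ, g ξ * f' ξ ∂μ) : Set.EqOn f' f ({0}ᶜ : Set ℚ_[p]) := by
  intro ξ hξ
  have h0 : ∀ᶠ y in nhds ξ, y ∈ ({0}ᶜ : Set ℚ_[p]) := isOpen_compl_singleton.mem_nhds hξ
  obtain ⟨ε, hε, hb⟩ := Metric.nhds_basis_closedBall.eventually_iff.1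
    ((hf ξ hξ).and ((hf' ξ hξ).and h0))
  set B := closedBall ξ ε with hB
  have hcl : IsClopen B := IsUltrametricDist.isClopen_closedBall ξ hε.ne'
  let g : ℚ_[p] → ℂ := B.indicator (fun _ => 1)
  have hts : tsupport g ⊆ B := closure_minimal Set.support_indicator_subset hcl.1
  have hgc : Continuous g := continuous_const.indicator (by simp [hcl.frontier_eq])
  have hgs : HasCompactSupport g :=
    (isCompact_closedBall ξ ε).of_isClosed_subset (isClosed_tsupport g) hts
  have := h g hgc hgs (fun h0 => (hb (hts h0)).2.2 rfl)
  have hcomp : ∀ F : ℚ_[p] → ℂ, (∀ y ∈ B, F y = F ξ) → ∫ y, g y * F y ∂μ = μ.real B * F ξ := by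
    intro F hF
    have : ∀ y, g y * F y = B.indicator (fun _ => F ξ) y := by
      intro y
      by_cases hy : y ∈ B
      · simp [g, hy, hF y hy]
      · simp [g, hy]
    simp only [this]
    rw [integral_indicator_const _ hcl.1.measurableSet, Complex.real_smul]
  rw [hcomp f (fun y hy => (hb hy).1), hcomp f' (fun y hy => (hb hy).2.1)] at this
  have hpos : (μ.real B : ℂ) ≠ 0 := by
    have : 0 < μ.real B := by
      rw [measureReal_def, ENNReal.toReal_pos_iff]
      exact ⟨measure_closedBall_pos μ ξ hε, (isCompact_closedBall ξ ε).measure_lt_top⟩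
    exact_mod_cast this.ne'
  exact (mul_left_cancel₀ hpos this).symm

end
end Germ

/-- germ of the pushforward of a Schwartz–Bruhat measure under the split
quadratic form on `ℚ_p^d`, `d ≥ 4` even: there is a unique locally constant density `f`
away from `0`; it vanishes outside a compact set, and at `0` it has the form
`C₀(ξ) + C₁(ξ)·|ξ|_p^{d/2−1}` with `C₀, C₁` Schwartz–Bruhat. -/
theorem germ_pushforward_padic_even (p : ℕ) [Fact p.Prime]
    [MeasurableSpace ℚ_[p]] [BorelSpace ℚ_[p]]
    (μ : Measure ℚ_[p]) [μ.IsAddHaarMeasure]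
    (d : ℕ) (hd : 4 ≤ d) (hde : Even d)
    (μd : Measure (Fin d → ℚ_[p])) [μd.IsAddHaarMeasure]
    (Φ : (Fin d → ℚ_[p]) → ℂ) (hΦ : IsSchwartzBruhat Φ) :
    ∃ f : ℚ_[p] → ℂ,
      LocallyConstantOn f ({0}ᶜ : Set ℚ_[p]) ∧
      (∀ g : ℚ_[p] → ℂ, Continuous g → HasCompactSupport g → (0 : ℚ_[p]) ∉ tsupport g →
        ∫ x, g (splitQP p d x) * Φ x ∂μd = ∫ ξ, g ξ * f ξ ∂μ) ∧
      (∀ f' : ℚ_[p] → ℂ, LocallyConstantOn f' ({0}ᶜ : Set ℚ_[p]) →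
        (∀ g : ℚ_[p] → ℂ, Continuous g → HasCompactSupport g → (0 : ℚ_[p]) ∉ tsupport g →
          ∫ x, g (splitQP p d x) * Φ x ∂μd = ∫ ξ, g ξ * f' ξ ∂μ) →
        Set.EqOn f' f ({0}ᶜ : Set ℚ_[p])) ∧
      (∃ K : Set ℚ_[p], IsCompact K ∧ ∀ ξ ∉ K, f ξ = 0) ∧
      (∃ C₀ C₁ : ℚ_[p] → ℂ, IsSchwartzBruhat C₀ ∧ IsSchwartzBruhat C₁ ∧
        ∀ ξ : ℚ_[p], ξ ≠ 0 →
          f ξ = C₀ ξ + C₁ ξ * ((‖ξ‖ ^ (d / 2 - 1) : ℝ) : ℂ)) := by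

  obtain ⟨m, rfl⟩ := hde
  have hm : 2 ≤ m := by omega
  let e := Germ.spl p m
  have he : Continuous e := Germ.spl_cont
  have hes : Continuous e.symm := Germ.spl_symm_cont
  let eh : (Fin (m + m) → ℚ_[p]) ≃ₜ (Fin m → ℚ_[p]) × (Fin m → ℚ_[p]) :=
    { e.toEquiv with continuous_toFun := he, continuous_invFun := hes }
  have hHaar : (μd.map e).IsAddHaarMeasure := e.isAddHaarMeasure_map μd he hes
  have hX : (Germ.mX μ m).IsAddHaarMeasure := inferInstance
  have hXX : ((Germ.mX μ m).prod (Germ.mX μ m)).IsAddHaarMeasure :=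
    Measure.prod.instIsAddHaarMeasure _ _
  obtain ⟨κ, hκ⟩ : ∃ κ : NNReal, μd.map e = κ • ((Germ.mX μ m).prod (Germ.mX μ m)) :=
    ⟨_, Measure.isAddLeftInvariant_eq_smul (μd.map e) _⟩
  have hΨ : IsSchwartzBruhat (fun v => Φ (e.symm v)) :=
    ⟨hΦ.1.comp_continuous hes, hΦ.2.comp_homeomorph eh.symm⟩
  obtain ⟨A, B, hA, hB, hAB⟩ := Germ.HasGerm.smul μ (κ : ℂ) (Germ.hasGerm_all μ hm _ hΨ)
  rw [show (m + m) / 2 = m by omega]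
  have hpush : ∀ g : ℚ_[p] → ℂ, Continuous g → HasCompactSupport g → (0 : ℚ_[p]) ∉ tsupport g →
        ∫ x, g (splitQP p (m + m) x) * Φ x ∂μd =
          ∫ ξ, g ξ * (A ξ + B ξ * ((‖ξ‖ ^ (m - 1) : ℝ) : ℂ)) ∂μ := by
    intro g hg hgc hg0
    rw [← hAB g hg hgc hg0]
    have h1 := integral_map_equiv (μ := μd) eh.toMeasurableEquiv
      (fun v => g (v.1 ⬝ᵥ v.2) * Φ (e.symm v))
    have h2 : ∫ x, g (splitQP p (m + m) x) * Φ x ∂μd =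
        ∫ x, g ((e x).1 ⬝ᵥ (e x).2) * Φ (e.symm (e x)) ∂μd := by
      congr 1
      ext x
      rw [Germ.split_eq, e.symm_apply_apply]
    have h3 : ∫ v, g (v.1 ⬝ᵥ v.2) * Φ (e.symm v) ∂(μd.map e) =
        ∫ x, g ((e x).1 ⬝ᵥ (e x).2) * Φ (e.symm (e x)) ∂μd := h1
    rw [h2, ← h3, hκ, integral_smul_nnreal_measure, NNReal.smul_def, Complex.real_smul,
      ← integral_const_mul]
    congr 1
    ext v
    change (κ : ℂ) * _ = _
    ring
  have hloc : LocallyConstantOn (fun ξ => A ξ + B ξ * ((‖ξ‖ ^ (m - 1) : ℝ) : ℂ))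
      ({0}ᶜ : Set ℚ_[p]) := by
    intro ξ hξ
    have hξ0 : 0 < ‖ξ‖ := norm_pos_iff.2 hξ
    filter_upwards [(IsLocallyConstant.iff_eventually_eq A).1 hA.1 ξ,
      (IsLocallyConstant.iff_eventually_eq B).1 hB.1 ξ, Metric.ball_mem_nhds ξ hξ0] with y h1 h2 h3
    have : ‖y‖ = ‖ξ‖ := by
      rw [Metric.mem_ball, dist_eq_norm] at h3
      have := IsUltrametricDist.norm_add_eq_max_of_norm_ne_norm (x := y - ξ) (y := ξ) h3.ne
      rw [sub_add_cancel, max_eq_right h3.le] at this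
      exact this
    rw [h1, h2, this]
  refine ⟨fun ξ => A ξ + B ξ * ((‖ξ‖ ^ (m - 1) : ℝ) : ℂ), hloc, hpush, ?_, ?_, A, B, hA, hB,
    fun ξ _ => rfl⟩
  · intro f' hf' h'
    refine Germ.uniq μ hloc hf' ?_
    intro g hg hgc hg0
    rw [← hpush g hg hgc hg0, h' g hg hgc hg0]
  · refine ⟨tsupport A ∪ tsupport B, hA.2.isCompact.union hB.2.isCompact, ?_⟩
    intro ξ hξ
    rw [Set.mem_union, not_or] at hξ
    simp [image_eq_zero_of_notMem_tsupport hξ.1, image_eq_zero_of_notMem_tsupport hξ.2]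
end
end

section
/- Suppose d ≥ 3 is odd and let Φ be a Schwartz–Bruhat function on ℚ_p^d. Then there is a unique locally constant function f : ℚ_p∖{0} → ℂ such that ∫_{ℚ_p^d} g(q_d(x)) Φ(x) dx = ∫_{ℚ_p} g(ξ) f(ξ) dξ for every continuous compactly supported g : ℚ_p → ℂ whose support does not contain 0. Moreover f vanishes outside a compact subset of ℚ_p, and there exist a Schwartz–Bruhat function C₀ on ℚ_p, a locally constant function h : ℚ_p∖{0} → ℂ satisfying h(t²ξ) = h(ξ) for all t ∈ ℚ_p∖{0} and all ξ ≠ 0, and a real ε > 0, such that f(ξ) = C₀(ξ) + h(ξ)·|ξ|_p^{(d−2)/2} for all ξ with 0 < |ξ|_p < ε. -/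
open MeasureTheory Filter

noncomputable section

lemma ball_step (p : ℕ) [Fact p.Prime] [MeasurableSpace ℚ_[p]] [BorelSpace ℚ_[p]]
    (μ : Measure ℚ_[p]) [μ.IsAddHaarMeasure] (k : ℤ) :
    μ (Metric.closedBall 0 ((p:ℝ) ^ (k+1))) = p * μ (Metric.closedBall 0 ((p:ℝ) ^ k)) := by
  have hp : (0:ℝ) < p := by exact_mod_cast (Fact.out : p.Prime).pos
  have hp0 : (p:ℚ_[p]) ≠ 0 := by exact_mod_cast (Fact.out : p.Prime).ne_zero
  have hnp : ‖(p:ℚ_[p]) ^ (-(k+1))‖ = (p:ℝ) ^ (k+1) := by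
    rw [norm_zpow, Padic.norm_p, inv_zpow, ← zpow_neg, neg_neg]
  have hlt : ∀ y : ℚ_[p], ‖y‖ < 1 ↔ ‖y‖ ≤ (p:ℝ)^(-1:ℤ) := by
    intro y
    have := Padic.norm_le_pow_iff_norm_lt_pow_add_one y (-1)
    simp at this
    simp [this]
  have key : Metric.closedBall (0:ℚ_[p]) ((p:ℝ) ^ (k+1)) =
      ⋃ i ∈ Finset.range p, Metric.closedBall ((p:ℚ_[p]) ^ (-(k+1)) * (i:ℚ_[p])) ((p:ℝ) ^ k) := by
    ext x
    simp only [Set.mem_iUnion, Finset.mem_range, exists_prop, Metric.mem_closedBall, dist_eq_norm,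
      sub_zero]
    have hsub : ∀ i : ℕ, ‖x - (p:ℚ_[p]) ^ (-(k+1)) * (i:ℚ_[p])‖ =
        (p:ℝ)^(k+1) * ‖(p:ℚ_[p])^(k+1) * x - i‖ := by
      intro i
      rw [← hnp, ← norm_mul]
      congr 1
      rw [mul_sub, ← mul_assoc, ← zpow_add₀ hp0]; simp
    have hk : (p:ℝ)^k = (p:ℝ)^(k+1) * (p:ℝ)^(-1:ℤ) := by
      rw [← zpow_add₀ hp.ne']; simp
    constructor
    · intro hx
      have h1 : ‖(p:ℚ_[p])^(k+1) * x‖ ≤ 1 := by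
        rw [norm_mul, norm_zpow, Padic.norm_p, inv_zpow]
        rw [inv_mul_le_iff₀ (by positivity)]; simpa using hx
      obtain ⟨z, hz⟩ : ∃ z : ℤ_[p], (z : ℚ_[p]) = (p:ℚ_[p])^(k+1) * x := ⟨⟨_, h1⟩, rfl⟩
      obtain ⟨n, hn, hm⟩ := PadicInt.exists_mem_range z
      refine ⟨n, hn, ?_⟩
      rw [hsub, hk]
      refine mul_le_mul_of_nonneg_left ?_ (by positivity)
      rw [← hlt]
      rw [PadicInt.maximalIdeal_eq_span_p, Ideal.mem_span_singleton,
        ← PadicInt.norm_lt_one_iff_dvd] at hm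
      rw [PadicInt.norm_def, PadicInt.coe_sub, PadicInt.coe_natCast, hz] at hm
      exact hm
    · rintro ⟨i, hi, h⟩
      have : x = (x - (p:ℚ_[p]) ^ (-(k+1)) * (i:ℚ_[p])) + (p:ℚ_[p]) ^ (-(k+1)) * (i:ℚ_[p]) := by ring
      rw [this]
      refine (Padic.nonarchimedean _ _).trans (max_le (h.trans ?_) ?_)
      · exact zpow_le_zpow_right₀ (by exact_mod_cast (Fact.out : p.Prime).one_le) (by lia)
      · rw [norm_mul, hnp]
        refine mul_le_of_le_one_right (by positivity) ?_
        exact_mod_cast Padic.norm_int_le_one (i:ℤ)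
  rw [key, measure_biUnion_finset]
  · have : ∀ i : ℕ, μ (Metric.closedBall ((p:ℚ_[p]) ^ (-(k+1)) * (i:ℚ_[p])) ((p:ℝ) ^ k)) =
      μ (Metric.closedBall 0 ((p:ℝ) ^ k)) := fun i => by
        exact Measure.addHaar_closedBall_center μ _ _
    rw [Finset.sum_congr rfl (fun i _ => this i)]
    simp
  · intro i hi j hj hij
    rw [Function.onFun, Set.disjoint_left]
    intro x hx hx'
    rw [Metric.mem_closedBall, dist_eq_norm] at hx hx'
    have h1 : ‖(p:ℚ_[p]) ^ (-(k+1)) * (((i:ℤ) - (j:ℤ) : ℤ):ℚ_[p])‖ ≤ (p:ℝ)^k := by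
      have : (p:ℚ_[p]) ^ (-(k+1)) * (((i:ℤ) - (j:ℤ) : ℤ):ℚ_[p]) =
        (x - (p:ℚ_[p]) ^ (-(k+1)) * (j:ℚ_[p])) + -(x - (p:ℚ_[p]) ^ (-(k+1)) * (i:ℚ_[p])) := by
          push_cast; ring
      rw [this]
      refine (Padic.nonarchimedean _ _).trans (max_le hx' ?_)
      rw [norm_neg]; exact hx
    rw [norm_mul, hnp, zpow_add₀ hp.ne', mul_assoc] at h1
    have h2 := le_of_mul_le_mul_left (h1.trans_eq (mul_one _).symm) (by positivity)
    have h3 : ‖(((i:ℤ) - (j:ℤ) : ℤ):ℚ_[p])‖ < 1 := by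
      rw [hlt, zpow_neg, zpow_one, ← one_div, le_div_iff₀ hp, mul_comm]; simpa using h2
    rw [Padic.norm_intCast_lt_one_iff] at h3
    simp at hi hj
    obtain ⟨c, hc⟩ := h3
    have : c = 0 := by
      by_contra hne
      rcases lt_or_gt_of_ne hne with h | h <;> nlinarith
    subst this
    simp at hc; lia
  · intro i _
    exact measurableSet_closedBall

lemma ball_pow (p : ℕ) [Fact p.Prime] [MeasurableSpace ℚ_[p]] [BorelSpace ℚ_[p]]
    (μ : Measure ℚ_[p]) [μ.IsAddHaarMeasure] (k : ℤ) :
    μ.real (Metric.closedBall 0 ((p:ℝ) ^ k)) = (p:ℝ)^k * μ.real (Metric.closedBall 0 1) := by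
  have hp : (0:ℝ) < p := by exact_mod_cast (Fact.out : p.Prime).pos
  have st : ∀ k : ℤ, μ.real (Metric.closedBall 0 ((p:ℝ) ^ (k+1))) =
      p * μ.real (Metric.closedBall 0 ((p:ℝ) ^ k)) := by
    intro k
    simp [Measure.real, ball_step]
  induction k using Int.induction_on with
  | zero => simp
  | succ n ih => rw [st, ih, zpow_add₀ hp.ne', zpow_one]; ring
  | pred n ih =>
    have := st (-(n:ℤ) - 1)
    rw [sub_add_cancel, ih] at this
    have h2 : (p:ℝ) ^ (-(n:ℤ)) = p * (p:ℝ) ^ (-(n:ℤ) - 1) := by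
      rw [zpow_sub₀ hp.ne', zpow_one]
      field_simp
    rw [h2, mul_assoc] at this
    exact (mul_left_cancel₀ hp.ne' this).symm

lemma ball_norm (p : ℕ) [Fact p.Prime] [MeasurableSpace ℚ_[p]] [BorelSpace ℚ_[p]]
    (μ : Measure ℚ_[p]) [μ.IsAddHaarMeasure] (t : ℚ_[p]) (ht : t ≠ 0) :
    μ.real (Metric.closedBall 0 ‖t‖) = ‖t‖ * μ.real (Metric.closedBall 0 1) := by
  rw [Padic.norm_eq_zpow_neg_valuation ht, ball_pow]

lemma scale_gen (p : ℕ) [Fact p.Prime] {E : Type*} [NormedAddCommGroup E] [NormedSpace ℚ_[p] E]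
    [ProperSpace E] [SecondCountableTopology E] [MeasurableSpace E] [BorelSpace E]
    (μ : Measure E) [μ.IsAddHaarMeasure] (t : ℚ_[p]) (ht : t ≠ 0) (c : ℝ)
    (hc : μ.real (Metric.closedBall 0 ‖t‖⁻¹) = c * μ.real (Metric.closedBall 0 1)) (F : E → ℂ) :
    ∫ x, F (t • x) ∂μ = c * ∫ x, F x ∂μ := by
  let L : E ≃L[ℚ_[p]] E := ContinuousLinearEquiv.smulLeft (Units.mk0 t ht)
  have hL : ∀ x, L x = t • x := fun x => rfl
  have := L.isAddHaarMeasure_map μ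
  have h1 := Measure.isAddLeftInvariant_eq_smul (Measure.map L μ) μ
  have hme : MeasurableEmbedding L := L.toHomeomorph.measurableEmbedding
  have h2 : ∫ x, F (t • x) ∂μ = ∫ x, F x ∂(Measure.map L μ) := by
    rw [hme.integral_map]; rfl
  have h0 : 0 < μ.real (Metric.closedBall (0:E) 1) :=
    ENNReal.toReal_pos (Metric.measure_closedBall_pos _ _ one_pos).ne' measure_closedBall_lt_top.ne
  have h3 : (Measure.map L μ).real (Metric.closedBall 0 1) =
      μ.real (Metric.closedBall 0 ‖t‖⁻¹) := by
    rw [Measure.real, hme.map_apply, Measure.real]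
    congr 2
    ext x
    have : 0 < ‖t‖ := norm_pos_iff.2 ht
    simp only [Set.mem_preimage, Metric.mem_closedBall, dist_zero_right, hL, norm_smul]
    rw [← one_div, le_div_iff₀ this, mul_comm]
  rw [h2]
  rw [h1] at h3 ⊢
  rw [hc, measureReal_nnreal_smul_apply] at h3
  rw [integral_smul_nnreal_measure]
  have h4 := mul_right_cancel₀ h0.ne' h3
  rw [← h4]
  simp [NNReal.smul_def]

lemma scale_one (p : ℕ) [Fact p.Prime] [MeasurableSpace ℚ_[p]] [BorelSpace ℚ_[p]]
    (μ : Measure ℚ_[p]) [μ.IsAddHaarMeasure] (t : ℚ_[p]) (ht : t ≠ 0) (F : ℚ_[p] → ℂ) :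
    ∫ x, F (t * x) ∂μ = ((‖t‖⁻¹ : ℝ) : ℂ) * ∫ x, F x ∂μ := by
  refine scale_gen p μ t ht _ ?_ F
  rw [← norm_inv, ball_norm p μ _ (inv_ne_zero ht)]

lemma scale_pi (p : ℕ) [Fact p.Prime] [MeasurableSpace ℚ_[p]] [BorelSpace ℚ_[p]] (d : ℕ)
    (μ : Measure ℚ_[p]) [μ.IsAddHaarMeasure]
    (μd : Measure (Fin d → ℚ_[p])) [μd.IsAddHaarMeasure]
    (t : ℚ_[p]) (ht : t ≠ 0) (F : (Fin d → ℚ_[p]) → ℂ) :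
    ∫ x, F (t • x) ∂μd = (((‖t‖⁻¹) ^ d : ℝ) : ℂ) * ∫ x, F x ∂μd := by
  refine scale_gen p μd t ht _ ?_ F
  rw [Measure.isAddLeftInvariant_eq_smul μd (Measure.pi (fun _ : Fin d => μ))]
  rw [measureReal_nnreal_smul_apply, measureReal_nnreal_smul_apply]
  have : ∀ r : ℝ, 0 ≤ r → (Measure.pi (fun _ : Fin d => μ)).real (Metric.closedBall 0 r) =
      (μ.real (Metric.closedBall 0 r)) ^ d := by
    intro r hr
    rw [Measure.real, Measure.pi_closedBall _ _ hr]
    simp [Measure.real]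
  rw [this _ (by positivity), this _ zero_le_one, ← norm_inv, ball_norm p μ _ (inv_ne_zero ht), mul_pow]
  ring

set_option linter.unusedSectionVars false

section SB
variable {p : ℕ} [Fact p.Prime] {E : Type*} [NormedAddCommGroup E]

lemma SB_indicator {X : Type*} [TopologicalSpace X] {Φ : X → ℂ} (hΦ : IsSchwartzBruhat Φ)
    {S : Set X} (hS : IsClopen S) :
    IsSchwartzBruhat (S.indicator Φ) := by
  constructor
  · rw [IsLocallyConstant.iff_eventually_eq]
    intro x
    have h1 := (IsLocallyConstant.iff_eventually_eq _).1 hΦ.1 x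
    by_cases hx : x ∈ S
    · filter_upwards [h1, hS.isOpen.mem_nhds hx] with y hy hyS
      simp [hx, hyS, hy]
    · filter_upwards [hS.compl.isOpen.mem_nhds hx] with y hyS
      rw [Set.indicator_of_notMem hx, Set.indicator_of_notMem hyS]
  · refine HasCompactSupport.mono hΦ.2 ?_
    intro x hx
    have := Set.support_indicator (s := S) (f := Φ)
    rw [this] at hx
    exact hx.2

lemma SB_sub {X : Type*} [TopologicalSpace X] {Φ Ψ : X → ℂ} (hΦ : IsSchwartzBruhat Φ)
    (hΨ : IsSchwartzBruhat Ψ) : IsSchwartzBruhat (fun x => Φ x - Ψ x) := by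
  refine ⟨?_, ?_⟩
  · exact hΦ.1.sub hΨ.1
  · exact HasCompactSupport.sub hΦ.2 hΨ.2

lemma SB_unif {Φ : E → ℂ} (hΦ : IsSchwartzBruhat Φ) :
    ∃ s > 0, ∀ x y : E, ‖y‖ ≤ s → Φ (x + y) = Φ x := by
  obtain ⟨δ, hδ, h⟩ := lebesgue_number_lemma_of_metric (c := fun c : ℂ => Φ ⁻¹' {c}) hΦ.2
    (fun c => hΦ.1.isOpen_fiber c) (fun x _ => by simp)
  have h' : ∀ x ∈ tsupport Φ, ∀ y ∈ Metric.ball x δ, Φ y = Φ x := by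
    intro x hx y hy
    obtain ⟨c, hc⟩ := h x hx
    have h1 := hc hy
    have h2 := hc (Metric.mem_ball_self hδ)
    simp at h1 h2
    rw [h1, h2]
  refine ⟨δ / 2, by positivity, fun x y hy => ?_⟩
  by_cases hx : x ∈ tsupport Φ
  · exact h' x hx _ (by simp; linarith)
  · by_cases hxy : x + y ∈ tsupport Φ
    · exact (h' _ hxy x (by simp; linarith)).symm
    · rw [image_eq_zero_of_notMem_tsupport hx, image_eq_zero_of_notMem_tsupport hxy]

/-- indicator of a closed ball around the origin -/
def kb (p : ℕ) [Fact p.Prime] (c : ℚ_[p]) (r : ℝ) : ℚ_[p] → ℂ :=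
  (Metric.closedBall c r).indicator (fun _ => 1)

lemma kb_cont (c : ℚ_[p]) {r : ℝ} (hr : 0 < r) : Continuous (kb p c r) :=
  (continuous_const).indicator (by
    intro a ha
    rw [(IsUltrametricDist.isClopen_closedBall c hr.ne').frontier_eq] at ha
    exact ha.elim)

lemma kb_of_le {c a : ℚ_[p]} {r : ℝ} (h : ‖a - c‖ ≤ r) : kb p c r a = 1 := by
  rw [kb, Set.indicator_of_mem]; simpa [dist_eq_norm] using h

lemma kb_of_not {c a : ℚ_[p]} {r : ℝ} (h : ¬ ‖a - c‖ ≤ r) : kb p c r a = 0 := by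
  rw [kb, Set.indicator_of_notMem]; simpa [dist_eq_norm] using h

lemma kb_cs (c : ℚ_[p]) (r : ℝ) : HasCompactSupport (kb p c r) :=
  HasCompactSupport.intro (isCompact_closedBall c r) (fun x hx => by
    rw [kb, Set.indicator_of_notMem hx])

lemma kb_shift {r : ℝ} (a b : ℚ_[p]) (hb : ‖b‖ ≤ r) : kb p 0 r (a + b) = kb p 0 r a := by
  by_cases ha : ‖a‖ ≤ r
  · rw [kb_of_le (a := a) (by simpa using ha), kb_of_le]
    simpa using (Padic.nonarchimedean a b).trans (max_le ha hb)
  · rw [kb_of_not (a := a) (by simpa using ha), kb_of_not]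
    intro h
    apply ha
    have : a = (a + b) + (-b) := by ring
    rw [this]
    exact (Padic.nonarchimedean _ _).trans (max_le (by simpa using h) (by simpa using hb))

lemma kb_int [MeasurableSpace ℚ_[p]] [BorelSpace ℚ_[p]]
    (μ : Measure ℚ_[p]) [μ.IsAddHaarMeasure] (c : ℚ_[p]) {r : ℝ} (hr : 0 < r) :
    ∫ a, kb p c r a ∂μ ≠ 0 := by
  rw [kb, integral_indicator measurableSet_closedBall]
  simp only [setIntegral_const]
  have h0 : 0 < μ.real (Metric.closedBall c r) :=
    ENNReal.toReal_pos (Metric.measure_closedBall_pos _ _ hr).ne' measure_closedBall_lt_top.ne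
  simp [h0.ne']

end SB

section dens
variable {p : ℕ} [Fact p.Prime] [MeasurableSpace ℚ_[p]] [BorelSpace ℚ_[p]]
  {E : Type*} [NormedAddCommGroup E] [NormedSpace ℚ_[p] E]
    [ProperSpace E] [SecondCountableTopology E] [MeasurableSpace E] [BorelSpace E]

/-- translation invariance of the pushforward under small shifts -/
def GoodT (ν : Measure E) (q : E → ℚ_[p]) (Φ : E → ℂ) : Prop :=
  ∃ r > 0, ∀ a : ℚ_[p], ‖a‖ ≤ r → ∀ g : ℚ_[p] → ℂ, Continuous g →
    ∫ x, g (q x + a) * Φ x ∂ν = ∫ x, g (q x) * Φ x ∂ν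

lemma GoodT_add (ν : Measure E) [ν.IsAddHaarMeasure] {q : E → ℚ_[p]} (hq : Continuous q)
    {Φ Ψ : E → ℂ}
    (hΦ : IsSchwartzBruhat Φ) (hΨ : IsSchwartzBruhat Ψ) (h1 : GoodT ν q Φ) (h2 : GoodT ν q Ψ) :
    GoodT ν q (fun x => Φ x + Ψ x) := by
  obtain ⟨r, hr, h1⟩ := h1
  obtain ⟨s, hs, h2⟩ := h2
  refine ⟨min r s, lt_min hr hs, fun a ha g hg => ?_⟩
  have e : ∀ (Θ : E → ℂ), IsSchwartzBruhat Θ → ∀ b, Integrable (fun x => g (q x + b) * Θ x) ν := by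
    intro Θ hΘ b
    have := hΘ.1.continuous
    exact Continuous.integrable_of_hasCompactSupport (by fun_prop) (hΘ.2.mul_left)
  have e0 : ∀ (Θ : E → ℂ), IsSchwartzBruhat Θ → Integrable (fun x => g (q x) * Θ x) ν := by
    intro Θ hΘ
    have := hΘ.1.continuous
    exact Continuous.integrable_of_hasCompactSupport (by fun_prop) (hΘ.2.mul_left)
  simp only [mul_add]
  rw [integral_add (e _ hΦ a) (e _ hΨ a), integral_add (e0 _ hΦ) (e0 _ hΨ),
    h1 a (ha.trans (min_le_left _ _)) g hg, h2 a (ha.trans (min_le_right _ _)) g hg]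

lemma GoodT_dir (μ : Measure ℚ_[p]) [μ.IsAddHaarMeasure]
    (ν : Measure E) [ν.IsAddHaarMeasure] {q : E → ℚ_[p]} (hq : Continuous q)
    {l : E → ℚ_[p]} (hl : Continuous l) (v : E) (hv : ∀ x (t : ℚ_[p]), q (x + t • v) = q x + t * l x)
    {Φ : E → ℂ} (hΦ : IsSchwartzBruhat Φ) (δ : ℝ) (hδ : 0 < δ) (hΦl : ∀ x, Φ x ≠ 0 → δ ≤ ‖l x‖) :
    GoodT ν q Φ := by
  obtain ⟨s, hs, hsΦ⟩ := SB_unif hΦ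
  set s' : ℝ := s / (‖v‖ + 1) with hs'
  have hs'0 : 0 < s' := by positivity
  have hcΦ := hΦ.1.continuous
  have hk := kb_cont (p := p) 0 hs'0
  have main : ∀ a : ℚ_[p], ∀ g : ℚ_[p] → ℂ, Continuous g →
      (∫ t, kb p 0 s' t ∂μ) * ∫ x, g (q x + a) * Φ x ∂ν =
      ∫ x, (∫ t, kb p 0 s' t * g (q x + t * l x + a) ∂μ) * Φ x ∂ν := by
    intro a g hg
    rw [← integral_mul_const]
    have h1 : ∀ t : ℚ_[p], kb p 0 s' t * ∫ x, g (q x + a) * Φ x ∂ν =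
        ∫ x, kb p 0 s' t * g (q x + t * l x + a) * Φ x ∂ν := by
      intro t
      by_cases ht : ‖t‖ ≤ s'
      · rw [kb_of_le (by simpa using ht), ← integral_add_right_eq_self _ (t • v)]
        simp only [one_mul]
        refine integral_congr_ae (Eventually.of_forall fun x => ?_)
        simp only
        rw [hv, hsΦ]
        rw [norm_smul]
        calc ‖t‖ * ‖v‖ ≤ s' * (‖v‖ + 1) := by gcongr; linarith
          _ = s := by rw [hs']; field_simp
      · rw [kb_of_not (by simpa using ht)]; simp
    simp only [h1]
    rw [integral_integral_swap_of_hasCompactSupport]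
    · refine integral_congr_ae (Eventually.of_forall fun x => ?_)
      simp only
      rw [← integral_mul_const]
    · simp only [Function.uncurry_def]
      fun_prop
    · refine HasCompactSupport.intro ((isCompact_closedBall (0:ℚ_[p]) s').prod hΦ.2) ?_
      rintro ⟨t, x⟩ h
      simp only [Set.mem_prod, not_and_or] at h
      rcases h with h | h
      · simp only [Function.uncurry_apply_pair]
        rw [kb_of_not (by simpa using h)]; simp
      · simp only [Function.uncurry_apply_pair]
        rw [image_eq_zero_of_notMem_tsupport h]; simp
  refine ⟨δ * s', by positivity, fun a ha g hg => ?_⟩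
  apply mul_left_cancel₀ (kb_int μ (0:ℚ_[p]) hs'0)
  have m0 := main 0 g hg
  simp only [add_zero] at m0
  rw [main a g hg, m0]
  refine integral_congr_ae (Eventually.of_forall fun x => ?_)
  simp only
  by_cases hx : Φ x = 0
  · simp [hx]
  congr 1
  have hlx := hΦl x hx
  have hlx0 : l x ≠ 0 := by
    intro h; rw [h] at hlx; simp at hlx; linarith
  have hlp : 0 < ‖l x‖ := norm_pos_iff.2 hlx0
  rw [← integral_add_right_eq_self (fun t => kb p 0 s' t * g (q x + t * l x)) (a / l x)]
  refine integral_congr_ae (Eventually.of_forall fun t => ?_)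
  simp only
  rw [kb_shift, add_mul, div_mul_cancel₀ _ hlx0, add_assoc]
  rw [norm_div, div_le_iff₀ hlp]
  refine ha.trans ?_
  rw [mul_comm]
  gcongr

lemma GoodT_density (μ : Measure ℚ_[p]) [μ.IsAddHaarMeasure]
    (ν : Measure E) [ν.IsAddHaarMeasure] {q : E → ℚ_[p]} (hq : Continuous q)
    {Φ : E → ℂ} (hΦ : IsSchwartzBruhat Φ) (h : GoodT ν q Φ) :
    ∃ D : ℚ_[p] → ℂ, IsSchwartzBruhat D ∧ ∀ g : ℚ_[p] → ℂ, Continuous g → HasCompactSupport g →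
      ∫ x, g (q x) * Φ x ∂ν = ∫ ξ, g ξ * D ξ ∂μ := by
  obtain ⟨r, hr, h⟩ := h
  have hcΦ := hΦ.1.continuous
  have hk := kb_cont (p := p) 0 hr
  have hm := kb_int μ (0:ℚ_[p]) hr
  set m := ∫ a, kb p 0 r a ∂μ with hmdef
  refine ⟨fun ξ => m⁻¹ * ∫ x, kb p 0 r (ξ - q x) * Φ x ∂ν, ⟨?_, ?_⟩, ?_⟩
  · rw [IsLocallyConstant.iff_eventually_eq]
    intro ξ
    filter_upwards [Metric.closedBall_mem_nhds ξ hr] with η hη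
    congr 1
    refine integral_congr_ae (Eventually.of_forall fun x => ?_)
    simp only
    have : η - q x = (ξ - q x) + (η - ξ) := by ring
    rw [this, kb_shift]
    simpa [dist_eq_norm] using hη
  · refine HasCompactSupport.intro (((isCompact_closedBall (0:ℚ_[p]) r).prod hΦ.2).image
      (f := fun z : ℚ_[p] × E => z.1 + q z.2) (by fun_prop)) ?_
    intro ξ hξ
    rw [integral_eq_zero_of_ae, mul_zero]
    refine Eventually.of_forall fun x => ?_
    simp only [Pi.zero_apply]
    by_cases hx : x ∈ tsupport Φ
    · rw [kb_of_not, zero_mul]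
      intro h'
      apply hξ
      exact ⟨(ξ - q x, x), ⟨by simpa using h', hx⟩, by simp⟩
    · rw [image_eq_zero_of_notMem_tsupport hx, mul_zero]
  · intro g hg hgc
    apply mul_left_cancel₀ hm
    have e1 : m * ∫ x, g (q x) * Φ x ∂ν = ∫ a, ∫ x, kb p 0 r a * g (q x + a) * Φ x ∂ν ∂μ := by
      rw [hmdef, ← integral_mul_const]
      refine integral_congr_ae (Eventually.of_forall fun a => ?_)
      simp only
      by_cases ha : ‖a‖ ≤ r
      · rw [kb_of_le (by simpa using ha)]
        simp only [one_mul]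
        exact (h a ha g hg).symm
      · rw [kb_of_not (by simpa using ha)]; simp
    rw [e1, integral_integral_swap_of_hasCompactSupport]
    · have e2 : ∀ x, ∫ a, kb p 0 r a * g (q x + a) * Φ x ∂μ =
          ∫ ξ, g ξ * (kb p 0 r (ξ - q x) * Φ x) ∂μ := by
        intro x
        rw [← integral_add_right_eq_self (fun ξ => g ξ * (kb p 0 r (ξ - q x) * Φ x)) (q x)]
        refine integral_congr_ae (Eventually.of_forall fun a => ?_)
        simp only [add_sub_cancel_right]
        rw [add_comm (q x)]; ring
      simp only [e2]
      rw [integral_integral_swap_of_hasCompactSupport]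
      · rw [← integral_const_mul]
        refine integral_congr_ae (Eventually.of_forall fun ξ => ?_)
        simp only
        rw [integral_const_mul]
        field_simp
      · simp only [Function.uncurry_def]
        fun_prop
      · refine HasCompactSupport.intro (IsCompact.prod hΦ.2 hgc) ?_
        rintro ⟨x, t⟩ h
        simp only [Set.mem_prod, not_and_or] at h
        rcases h with h | h <;>
        · simp only [Function.uncurry_apply_pair]
          rw [image_eq_zero_of_notMem_tsupport h]; simp
    · simp only [Function.uncurry_def]
      fun_prop
    · refine HasCompactSupport.intro ((isCompact_closedBall (0:ℚ_[p]) r).prod hΦ.2) ?_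
      rintro ⟨t, x⟩ h
      simp only [Set.mem_prod, not_and_or] at h
      rcases h with h | h
      · simp only [Function.uncurry_apply_pair]
        rw [kb_of_not (by simpa using h)]; simp
      · simp only [Function.uncurry_apply_pair]
        rw [image_eq_zero_of_notMem_tsupport h]; simp

lemma GoodT_finset (μ : Measure ℚ_[p]) [μ.IsAddHaarMeasure]
    (ν : Measure E) [ν.IsAddHaarMeasure] {q : E → ℚ_[p]} (hq : Continuous q)
    {ι : Type*} (l : ι → E → ℚ_[p]) (hl : ∀ i, Continuous (l i)) (v : ι → E)
    (hv : ∀ i x (t : ℚ_[p]), q (x + t • v i) = q x + t * l i x) (δ : ι → ℝ) (hδ : ∀ i, 0 < δ i)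
    (S : Finset ι) :
    ∀ {Φ : E → ℂ}, IsSchwartzBruhat Φ → (∀ x, Φ x ≠ 0 → ∃ i ∈ S, δ i ≤ ‖l i x‖) →
    GoodT ν q Φ := by
  classical
  induction S using Finset.induction_on with
  | empty =>
    intro Φ _ h
    have : ∀ x, Φ x = 0 := by
      intro x
      by_contra hx
      obtain ⟨i, hi, _⟩ := h x hx
      simp at hi
    refine ⟨1, one_pos, fun a _ g _ => by simp [this]⟩
  | insert i S hi ih =>
    intro Φ hΦ h
    have hclo : IsClopen {x | δ i ≤ ‖l i x‖} := by
      have : {x | δ i ≤ ‖l i x‖} = (l i) ⁻¹' (Metric.ball 0 (δ i))ᶜ := by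
        ext x; simp
      rw [this]
      exact (IsUltrametricDist.isClopen_ball _ _).compl.preimage (hl i)
    have e : Φ = fun x => ({x | δ i ≤ ‖l i x‖}).indicator Φ x +
        ({x | δ i ≤ ‖l i x‖}ᶜ).indicator Φ x := by
      funext x
      exact (congrFun (Set.indicator_self_add_compl {x | δ i ≤ ‖l i x‖} Φ) x).symm
    rw [e]
    refine GoodT_add ν hq (SB_indicator hΦ hclo) (SB_indicator hΦ hclo.compl) ?_ ?_
    · refine GoodT_dir μ ν hq (hl i) (v i) (hv i) (SB_indicator hΦ hclo) (δ i) (hδ i) ?_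
      intro x hx
      have h1 := Set.mem_of_indicator_ne_zero hx
      exact h1
    · refine ih (SB_indicator hΦ hclo.compl) ?_
      intro x hx
      have h1 := Set.mem_of_indicator_ne_zero hx
      rw [Set.indicator_of_mem h1] at hx
      obtain ⟨j, hj, hj'⟩ := h x hx
      rcases Finset.mem_insert.1 hj with rfl | hj
      · exact (h1 hj').elim
      · exact ⟨j, hj, hj'⟩

lemma density_of_vanish (μ : Measure ℚ_[p]) [μ.IsAddHaarMeasure]
    (ν : Measure E) [ν.IsAddHaarMeasure] {q : E → ℚ_[p]} (hq : Continuous q)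
    (hdir : ∀ x : E, x ≠ 0 → ∃ (l : E → ℚ_[p]) (v : E), Continuous l ∧
      (∀ x (t : ℚ_[p]), q (x + t • v) = q x + t * l x) ∧ l x ≠ 0)
    {Φ : E → ℂ} (hΦ : IsSchwartzBruhat Φ) (h0 : ∀ᶠ x in nhds 0, Φ x = 0) :
    ∃ D : ℚ_[p] → ℂ, IsSchwartzBruhat D ∧ ∀ g : ℚ_[p] → ℂ, Continuous g → HasCompactSupport g →
      ∫ x, g (q x) * Φ x ∂ν = ∫ ξ, g ξ * D ξ ∂μ := by
  choose! l v hl hv hlx using hdir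
  apply GoodT_density μ ν hq hΦ
  have h0' : (0:E) ∉ tsupport Φ := by
    rw [notMem_tsupport_iff_eventuallyEq]; exact h0
  let ι := {x : E // x ≠ 0}
  obtain ⟨S, hS⟩ := hΦ.2.isCompact.elim_finite_subcover
    (fun i : ι => {x | ‖l i.1 i.1‖ / 2 < ‖l i.1 x‖})
    (fun i => isOpen_lt continuous_const (hl i.1 i.2).norm) (by
      intro x hx
      have hx0 : x ≠ 0 := by rintro rfl; exact h0' hx
      rw [Set.mem_iUnion]
      refine ⟨⟨x, hx0⟩, ?_⟩
      have := norm_pos_iff.2 (hlx x hx0)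
      simp only [Set.mem_ofPred_eq]
      linarith)
  refine GoodT_finset μ ν hq (fun i : ι => l i.1) (fun i => hl i.1 i.2) (fun i : ι => v i.1)
    (fun i => hv i.1 i.2) (fun i => ‖l i.1 i.1‖ / 2) (fun i => ?_) S hΦ ?_
  · have := norm_pos_iff.2 (hlx i.1 i.2)
    positivity
  · intro x hx
    have := hS (subset_tsupport _ hx)
    simp only [Set.mem_iUnion, Set.mem_ofPred_eq, exists_prop] at this
    obtain ⟨i, hi, h⟩ := this
    exact ⟨i, hi, h.le⟩

end dens

section quad
variable {p : ℕ} [Fact p.Prime] {d : ℕ}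

lemma padP_add_smul (x v : Fin d → ℚ_[p]) (t : ℚ_[p]) (n : ℕ) :
    padP (x + t • v) n = padP x n + t * padP v n := by
  unfold padP
  split_ifs <;> simp

lemma padP_smul (x : Fin d → ℚ_[p]) (t : ℚ_[p]) (n : ℕ) :
    padP (t • x) n = t * padP x n := by
  unfold padP
  split_ifs <;> simp

lemma padP_cont (n : ℕ) : Continuous (fun x : Fin d → ℚ_[p] => padP x n) := by
  unfold padP
  split_ifs <;> fun_prop

/-- polar form -/
def polB (p : ℕ) [Fact p.Prime] (d : ℕ) (x v : Fin d → ℚ_[p]) : ℚ_[p] :=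
  2 * padP x 0 * padP v 0 + ∑ i ∈ Finset.range (d / 2),
    (padP x (2 * i + 1) * padP v (2 * i + 2) + padP v (2 * i + 1) * padP x (2 * i + 2))

lemma splitQP_odd (hdo : Odd d) (x : Fin d → ℚ_[p]) : splitQP p d x =
    padP x 0 ^ 2 + ∑ i ∈ Finset.range (d / 2), padP x (2 * i + 1) * padP x (2 * i + 2) := by
  rw [splitQP, if_neg (Nat.not_even_iff_odd.2 hdo)]

lemma splitQP_add (hdo : Odd d) (x v : Fin d → ℚ_[p]) (t : ℚ_[p]) :
    splitQP p d (x + t • v) = splitQP p d x + t * polB p d x v + t ^ 2 * splitQP p d v := by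
  rw [splitQP_odd hdo, splitQP_odd hdo, splitQP_odd hdo, polB]
  simp only [padP_add_smul]
  have : ∀ i ∈ Finset.range (d / 2), (padP x (2 * i + 1) + t * padP v (2 * i + 1)) *
      (padP x (2 * i + 2) + t * padP v (2 * i + 2)) = padP x (2 * i + 1) * padP x (2 * i + 2) +
      t * (padP x (2 * i + 1) * padP v (2 * i + 2) + padP v (2 * i + 1) * padP x (2 * i + 2)) +
      t ^ 2 * (padP v (2 * i + 1) * padP v (2 * i + 2)) := by
    intro i _; ring
  rw [Finset.sum_congr rfl this, Finset.sum_add_distrib, Finset.sum_add_distrib,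
    ← Finset.mul_sum, ← Finset.mul_sum]
  ring

lemma splitQP_smul (hdo : Odd d) (x : Fin d → ℚ_[p]) (t : ℚ_[p]) :
    splitQP p d (t • x) = t ^ 2 * splitQP p d x := by
  rw [splitQP_odd hdo, splitQP_odd hdo]
  simp only [padP_smul]
  rw [mul_add, Finset.mul_sum]
  congr 1
  · ring
  · refine Finset.sum_congr rfl fun i _ => by ring

lemma splitQP_cont (hdo : Odd d) : Continuous (splitQP p d) := by
  have : splitQP p d = fun x => padP x 0 ^ 2 +
    ∑ i ∈ Finset.range (d / 2), padP x (2 * i + 1) * padP x (2 * i + 2) :=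
    funext (splitQP_odd hdo)
  rw [this]
  have := padP_cont (p := p) (d := d)
  fun_prop

lemma polB_cont (v : Fin d → ℚ_[p]) : Continuous (fun x => polB p d x v) := by
  unfold polB
  have := padP_cont (p := p) (d := d)
  fun_prop

/-- vector from a sequence of coordinates -/
def mkV (p : ℕ) [Fact p.Prime] (d : ℕ) (s : ℕ → ℚ_[p]) : Fin d → ℚ_[p] := fun j => s j

lemma padP_mkV (s : ℕ → ℚ_[p]) (n : ℕ) (h : n < d) : padP (mkV p d s) n = s n := by
  simp [padP, h, mkV]

lemma splitQP_dir (hd : 3 ≤ d) (hdo : Odd d) (x : Fin d → ℚ_[p]) (hx : x ≠ 0) :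
    ∃ (l : (Fin d → ℚ_[p]) → ℚ_[p]) (v : Fin d → ℚ_[p]), Continuous l ∧
      (∀ x (t : ℚ_[p]), splitQP p d (x + t • v) = splitQP p d x + t * l x) ∧ l x ≠ 0 := by
  have hd2 := Nat.odd_iff.1 hdo
  suffices H : ∃ v, splitQP p d v = 0 ∧ polB p d x v ≠ 0 by
    obtain ⟨v, hv, hb⟩ := H
    refine ⟨fun x => polB p d x v, v, polB_cont v, fun x t => ?_, hb⟩
    rw [splitQP_add hdo, hv]; ring
  by_contra! H
  -- even coordinates
  have h2 : ∀ k < d / 2, padP x (2 * k + 2) = 0 := by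
    intro k hk
    have h := H (mkV p d (fun n => if n = 2 * k + 1 then 1 else 0)) (by
      rw [splitQP_odd hdo, padP_mkV _ _ (by lia), if_neg (by lia), Finset.sum_eq_zero]
      · ring
      · intro i hi
        rw [Finset.mem_range] at hi
        rw [padP_mkV _ (2 * i + 2) (by lia), if_neg (by lia), mul_zero])
    rw [polB, padP_mkV _ _ (by lia), if_neg (by lia), Finset.sum_eq_single k] at h
    · rw [padP_mkV _ _ (by lia), padP_mkV _ _ (by lia), if_pos rfl, if_neg (by lia)] at h
      simpa using h
    · intro i hi hik
      rw [Finset.mem_range] at hi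
      rw [padP_mkV _ _ (by lia), padP_mkV _ _ (by lia), if_neg (by lia), if_neg (by lia)]
      ring
    · intro h; exact (h (Finset.mem_range.2 hk)).elim
  have h1 : ∀ k < d / 2, padP x (2 * k + 1) = 0 := by
    intro k hk
    have h := H (mkV p d (fun n => if n = 2 * k + 2 then 1 else 0)) (by
      rw [splitQP_odd hdo, padP_mkV _ _ (by lia), if_neg (by lia), Finset.sum_eq_zero]
      · ring
      · intro i hi
        rw [Finset.mem_range] at hi
        rw [padP_mkV _ (2 * i + 1) (by lia), if_neg (by lia), zero_mul])
    rw [polB, padP_mkV _ _ (by lia), if_neg (by lia), Finset.sum_eq_single k] at h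
    · rw [padP_mkV _ _ (by lia), padP_mkV _ _ (by lia), if_pos rfl, if_neg (by lia)] at h
      simpa using h
    · intro i hi hik
      rw [Finset.mem_range] at hi
      rw [padP_mkV _ _ (by lia), padP_mkV _ _ (by lia), if_neg (by lia), if_neg (by lia)]
      ring
    · intro h; exact (h (Finset.mem_range.2 hk)).elim
  have h0 : padP x 0 = 0 := by
    have h := H (mkV p d (fun n => if n = 0 then 1 else if n = 1 then 1 else
        if n = 2 then -1 else 0)) (by
      rw [splitQP_odd hdo, padP_mkV _ _ (by lia), Finset.sum_eq_single 0]
      · rw [padP_mkV _ _ (by lia), padP_mkV _ _ (by lia)]; simp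
      · intro i hi hi0
        rw [Finset.mem_range] at hi
        rw [padP_mkV _ (2 * i + 1) (by lia), if_neg (by lia), if_neg (by lia), if_neg (by lia),
          zero_mul]
      · intro h; exact (h (Finset.mem_range.2 (by lia))).elim)
    rw [polB, padP_mkV _ _ (by lia), Finset.sum_eq_zero] at h
    · simpa using h
    · intro i hi
      rw [Finset.mem_range] at hi
      rw [h1 i hi, h2 i hi]; ring
  apply hx
  funext j
  have hj := j.2
  have key : padP x j.1 = 0 := by
    rcases Nat.even_or_odd' j.1 with ⟨k, hk | hk⟩
    · rcases Nat.eq_zero_or_pos k with rfl | hk0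
      · rw [hk]; exact h0
      · have := h2 (k - 1) (by lia)
        rwa [show 2 * (k - 1) + 2 = j.1 by lia] at this
    · rw [hk]; exact h1 k (by lia)
  simpa [padP, hj] using key

end quad

section fin
variable {p : ℕ} [Fact p.Prime] [MeasurableSpace ℚ_[p]] [BorelSpace ℚ_[p]]

lemma norm_loc {ξ : ℚ_[p]} (hξ : ξ ≠ 0) : ∀ᶠ η in nhds ξ, ‖η‖ = ‖ξ‖ := by
  filter_upwards [Metric.ball_mem_nhds ξ (norm_pos_iff.2 hξ)] with η hη
  rw [Metric.mem_ball, dist_eq_norm] at hη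
  have := IsUltrametricDist.norm_eq_of_add_norm_lt_max (x := η) (y := -ξ) (by
    rw [← sub_eq_add_neg, norm_neg]
    exact hη.trans_le (le_max_right _ _))
  rwa [norm_neg] at this

lemma uniq_at (μ : Measure ℚ_[p]) [μ.IsAddHaarMeasure] {f f' : ℚ_[p] → ℂ} {ξ : ℚ_[p]} (hξ : ξ ≠ 0)
    (hf : ∀ᶠ y in nhds ξ, f y = f ξ) (hf' : ∀ᶠ y in nhds ξ, f' y = f' ξ)
    (H : ∀ g : ℚ_[p] → ℂ, Continuous g → HasCompactSupport g → (∀ η, ‖η‖ ≠ ‖ξ‖ → g η = 0) →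
      ∫ η, g η * f η ∂μ = ∫ η, g η * f' η ∂μ) : f ξ = f' ξ := by
  have h3 := hf.and (hf'.and (norm_loc hξ))
  obtain ⟨r, hr, h⟩ := Metric.nhds_basis_closedBall.eventually_iff.1 h3
  have h := fun η hη => h (x := η) hη
  have hz : ∀ η, ¬ ‖η - ξ‖ ≤ r → kb p ξ r η = 0 := fun η hη => kb_of_not hη
  have e := H (kb p ξ r) (kb_cont ξ hr) (kb_cs ξ r) (by
    intro η hη
    apply hz
    intro h'
    exact hη (h η (by simpa [dist_eq_norm] using h')).2.2)
  have e1 : ∀ η, kb p ξ r η * f η = kb p ξ r η * f ξ := by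
    intro η
    by_cases h' : ‖η - ξ‖ ≤ r
    · rw [(h η (by simpa [dist_eq_norm] using h')).1]
    · rw [hz η h']; simp
  have e2 : ∀ η, kb p ξ r η * f' η = kb p ξ r η * f' ξ := by
    intro η
    by_cases h' : ‖η - ξ‖ ≤ r
    · rw [(h η (by simpa [dist_eq_norm] using h')).2.1]
    · rw [hz η h']; simp
  simp only [e1, e2] at e
  rw [integral_mul_const, integral_mul_const] at e
  exact mul_left_cancel₀ (kb_int μ ξ hr) e

lemma zero_notin {g : ℚ_[p] → ℂ} {R : ℝ} (hR : 0 < R) (h : ∀ η, ‖η‖ < R → g η = 0) :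
    (0 : ℚ_[p]) ∉ tsupport g := by
  rw [notMem_tsupport_iff_eventuallyEq]
  filter_upwards [Metric.ball_mem_nhds 0 hR] with η hη
  exact h η (by simpa using hη)

lemma notin_zero {g : ℚ_[p] → ℂ} (h : (0 : ℚ_[p]) ∉ tsupport g) :
    ∃ R > 0, ∀ η, ‖η‖ < R → g η = 0 := by
  rw [notMem_tsupport_iff_eventuallyEq] at h
  obtain ⟨R, hR, h⟩ := Metric.eventually_nhds_iff.1 h
  exact ⟨R, hR, fun η hη => h (by simpa using hη)⟩

lemma int_gf (μ : Measure ℚ_[p]) [μ.IsAddHaarMeasure] {f g : ℚ_[p] → ℂ}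
    (hf : LocallyConstantOn f ({0}ᶜ : Set ℚ_[p])) (hg : Continuous g) (hgc : HasCompactSupport g)
    (h0 : (0 : ℚ_[p]) ∉ tsupport g) : Integrable (fun ξ => g ξ * f ξ) μ := by
  refine Continuous.integrable_of_hasCompactSupport ?_ hgc.mul_right
  rw [continuous_iff_continuousAt]
  intro ξ
  by_cases hξ : ξ = 0
  · subst hξ
    obtain ⟨R, hR, h⟩ := notin_zero h0
    have : (fun _ => (0:ℂ)) =ᶠ[nhds 0] (fun ξ => g ξ * f ξ) := by
      filter_upwards [Metric.ball_mem_nhds 0 hR] with η hη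
      rw [h η (by simpa using hη), zero_mul]
    exact continuousAt_const.congr this
  · refine hg.continuousAt.mul ?_
    have : (fun _ => f ξ) =ᶠ[nhds ξ] f := by
      filter_upwards [hf ξ hξ] with η hη
      exact hη.symm
    exact continuousAt_const.congr this

variable {d : ℕ} 

/-- identity characterising the density -/
def IsDens (μ : Measure ℚ_[p]) (μd : Measure (Fin d → ℚ_[p])) (Φ : (Fin d → ℚ_[p]) → ℂ)
    (f : ℚ_[p] → ℂ) : Prop :=
  ∀ g : ℚ_[p] → ℂ, Continuous g → HasCompactSupport g → (0 : ℚ_[p]) ∉ tsupport g →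
        ∫ x, g (splitQP p d x) * Φ x ∂μd = ∫ ξ, g ξ * f ξ ∂μ

lemma exists_dens (μ : Measure ℚ_[p]) [μ.IsAddHaarMeasure] (hd : 3 ≤ d) (hdo : Odd d)
    (μd : Measure (Fin d → ℚ_[p])) [μd.IsAddHaarMeasure]
    (Φ : (Fin d → ℚ_[p]) → ℂ) (hΦ : IsSchwartzBruhat Φ) :
    ∃ f : ℚ_[p] → ℂ,
      LocallyConstantOn f ({0}ᶜ : Set ℚ_[p]) ∧ IsDens μ μd Φ f ∧
      (∃ K : Set ℚ_[p], IsCompact K ∧ ∀ ξ ∉ K, f ξ = 0) := by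
  have hqc := splitQP_cont (p := p) hdo
  have hq0 : splitQP p d 0 = 0 := by
    have := splitQP_smul (p := p) hdo 0 0
    simpa using this
  have hclo : ∀ R : ℝ, 0 < R → IsClopen {x | R ≤ ‖splitQP p d x‖} := by
    intro R hR
    have : {x | R ≤ ‖splitQP p d x‖} = (splitQP p d) ⁻¹' (Metric.ball 0 R)ᶜ := by
      ext x; simp
    rw [this]
    exact (IsUltrametricDist.isClopen_ball _ _).compl.preimage hqc
  have hD : ∀ R : ℝ, 0 < R → ∃ D : ℚ_[p] → ℂ, IsSchwartzBruhat D ∧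
      ∀ g : ℚ_[p] → ℂ, Continuous g → HasCompactSupport g → (∀ η, ‖η‖ < R → g η = 0) →
      ∫ x, g (splitQP p d x) * Φ x ∂μd = ∫ ξ, g ξ * D ξ ∂μ := by
    intro R hR
    obtain ⟨D, hD, h⟩ := density_of_vanish μ μd hqc (splitQP_dir hd hdo)
      (SB_indicator hΦ (hclo R hR)) (by
        have : {x | R ≤ ‖splitQP p d x‖}ᶜ ∈ nhds (0 : Fin d → ℚ_[p]) :=
          (hclo R hR).compl.isOpen.mem_nhds (by simp [hq0, hR])
        filter_upwards [this] with x hx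
        exact Set.indicator_of_notMem hx _)
    refine ⟨D, hD, fun g hg hgc hgR => ?_⟩
    rw [← h g hg hgc]
    refine integral_congr_ae (Eventually.of_forall fun x => ?_)
    simp only
    by_cases hx : x ∈ {x | R ≤ ‖splitQP p d x‖}
    · rw [Set.indicator_of_mem hx]
    · rw [hgR _ (not_le.1 hx)]; simp
  choose! D hSB hDg using hD
  have hloc : ∀ R, 0 < R → ∀ ξ, ∀ᶠ y in nhds ξ, D R y = D R ξ := fun R hR ξ =>
    (IsLocallyConstant.iff_eventually_eq _).1 (hSB R hR).1 ξ
  have claim : ∀ R, 0 < R → ∀ ξ, R ≤ ‖ξ‖ → D R ξ = D ‖ξ‖ ξ := by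
    intro R hR ξ hξ
    have hξp : 0 < ‖ξ‖ := hR.trans_le hξ
    refine uniq_at μ (norm_pos_iff.1 hξp) (hloc R hR ξ) (hloc _ hξp ξ) ?_
    intro g hg hgc hgξ
    rw [← hDg R hR g hg hgc, ← hDg _ hξp g hg hgc]
    · intro η hη; exact hgξ _ hη.ne
    · intro η hη; exact hgξ _ (hη.trans_le hξ).ne
  refine ⟨fun ξ => D ‖ξ‖ ξ, ?_, ?_, ?_⟩
  · intro ξ hξ
    have hξ : ξ ≠ 0 := hξ
    filter_upwards [norm_loc hξ, hloc _ (norm_pos_iff.2 hξ) ξ] with η h1 h2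
    rw [h1, h2]
  · intro g hg hgc hg0
    obtain ⟨R, hR, h⟩ := notin_zero hg0
    rw [hDg R hR g hg hgc h]
    refine integral_congr_ae (Eventually.of_forall fun ξ => ?_)
    simp only
    by_cases hξ : R ≤ ‖ξ‖
    · rw [claim R hR ξ hξ]
    · rw [h _ (not_le.1 hξ)]; simp
  · refine ⟨tsupport (D 1) ∪ Metric.closedBall 0 1,
      (hSB 1 one_pos).2.isCompact.union (isCompact_closedBall _ _), ?_⟩
    intro ξ hξ
    simp only [Set.mem_union, not_or, Metric.mem_closedBall, dist_zero_right, not_le] at hξ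
    refine (claim 1 one_pos ξ hξ.2.le).symm.trans ?_
    exact image_eq_zero_of_notMem_tsupport hξ.1

lemma dens_scale (μ : Measure ℚ_[p]) [μ.IsAddHaarMeasure] (hd : 3 ≤ d) (hdo : Odd d)
    (μd : Measure (Fin d → ℚ_[p])) [μd.IsAddHaarMeasure]
    (Φ : (Fin d → ℚ_[p]) → ℂ) (hΦ : IsSchwartzBruhat Φ) (f : ℚ_[p] → ℂ)
    (hf : LocallyConstantOn f ({0}ᶜ : Set ℚ_[p])) (hfd : IsDens μ μd Φ f)
    (t : ℚ_[p]) (ht : t ≠ 0) :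
    ∃ c : ℂ, ∃ ε : ℝ, 0 < ε ∧ ∀ ξ, ξ ≠ 0 → ‖ξ‖ < ε →
      f (t ^ 2 * ξ) = ((‖t‖ ^ d * (‖t‖ ^ 2)⁻¹ : ℝ) : ℂ) * f ξ + c := by
  have hqc := splitQP_cont (p := p) hdo
  have ht2 : t ^ 2 ≠ 0 := pow_ne_zero _ ht
  have htn : 0 < ‖t‖ := norm_pos_iff.2 ht
  set κ : ℝ := ‖t‖ ^ d * (‖t‖ ^ 2)⁻¹ with hκ
  have hΦt : IsSchwartzBruhat (fun x => Φ (t⁻¹ • x)) := by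
    constructor
    · exact hΦ.1.comp_continuous (by fun_prop)
    · exact hΦ.2.comp_homeomorph (Homeomorph.smulOfNeZero t⁻¹ (inv_ne_zero ht))
  obtain ⟨D, hD, hDg⟩ := density_of_vanish μ μd hqc (splitQP_dir hd hdo) (SB_sub hΦ hΦt) (by
    have h1 := (IsLocallyConstant.iff_eventually_eq _).1 hΦ.1 0
    have h2 := (IsLocallyConstant.iff_eventually_eq _).1 hΦt.1 0
    filter_upwards [h1, h2] with x hx1 hx2
    rw [hx1, hx2]; simp)
  have hDl := (IsLocallyConstant.iff_eventually_eq _).1 hD.1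
  set f1 : ℚ_[p] → ℂ := fun ξ => f ((t ^ 2)⁻¹ * ξ) with hf1
  have hf1l : LocallyConstantOn f1 ({0}ᶜ : Set ℚ_[p]) := by
    intro ξ hξ
    have hξ : ξ ≠ 0 := hξ
    have hc : Tendsto (fun η => (t ^ 2)⁻¹ * η) (nhds ξ) (nhds ((t ^ 2)⁻¹ * ξ)) :=
      (continuous_const_mul _).tendsto ξ
    exact hc.eventually (hf _ (mul_ne_zero (inv_ne_zero ht2) hξ))
  have key : ∀ g : ℚ_[p] → ℂ, Continuous g → HasCompactSupport g → (0 : ℚ_[p]) ∉ tsupport g →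
      ∫ x, g (splitQP p d x) * Φ (t⁻¹ • x) ∂μd = κ * ∫ ξ, g ξ * f1 ξ ∂μ := by
    intro g hg hgc hg0
    have s1 := scale_pi p d μ μd t ht (fun x => g (splitQP p d x) * Φ (t⁻¹ • x))
    have s2 := scale_one p μ (t ^ 2) ht2 (fun ξ => g ξ * f1 ξ)
    simp only [splitQP_smul hdo, inv_smul_smul₀ ht] at s1
    simp only [hf1, inv_mul_cancel_left₀ ht2] at s2
    obtain ⟨R, hR, h⟩ := notin_zero hg0
    have hcs : HasCompactSupport (fun ξ => g (t ^ 2 * ξ)) := by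
      have := hgc.comp_homeomorph (Homeomorph.mulLeft₀ (t ^ 2) ht2)
      exact this
    have s3 := hfd (fun ξ => g (t ^ 2 * ξ)) (by fun_prop)
      hcs
      (zero_notin (R := R / ‖t ^ 2‖) (by positivity) (fun η hη => by
        apply h
        rw [norm_mul, mul_comm]
        exact (lt_div_iff₀ (by positivity)).1 hη))
    rw [s1, s2, norm_pow] at s3
    simp only [hf1]
    have hc : (‖t‖ : ℂ) ≠ 0 := by exact_mod_cast htn.ne'
    rw [hκ]
    push_cast at s3 ⊢
    rw [inv_pow] at s3
    rw [mul_assoc, ← s3, ← mul_assoc, mul_inv_cancel₀ (pow_ne_zero _ hc), one_mul]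
  have main : ∀ ξ, ξ ≠ 0 → f ξ = D ξ + κ * f1 ξ := by
    intro ξ hξ
    refine uniq_at (f' := fun ξ => D ξ + κ * f1 ξ) μ hξ (hf ξ hξ) ?_ ?_
    · filter_upwards [hDl ξ, hf1l ξ hξ] with η h1 h2
      rw [h1, h2]
    · intro g hg hgc hgξ
      have hg0 : (0 : ℚ_[p]) ∉ tsupport g :=
        zero_notin (norm_pos_iff.2 hξ) (fun η hη => hgξ η hη.ne)
      have e1 := hDg g hg hgc
      simp only [mul_sub] at e1
      rw [integral_sub, key g hg hgc hg0, hfd g hg hgc hg0] at e1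
      · have e2 : ∀ η, g η * (D η + κ * f1 η) = g η * D η + κ * (g η * f1 η) := by
          intro η; ring
        simp only [e2]
        rw [integral_add, integral_const_mul, ← e1]
        · ring
        · exact int_gf μ (fun x _ => hDl x) hg hgc hg0
        · exact (int_gf μ hf1l hg hgc hg0).const_mul _
      · have := hΦ.1.continuous
        exact Continuous.integrable_of_hasCompactSupport (by fun_prop) (hΦ.2.mul_left)
      · have := hΦt.1.continuous
        exact Continuous.integrable_of_hasCompactSupport ((hg.comp hqc).mul this) (hΦt.2.mul_left)
  obtain ⟨R, hR, h⟩ := Metric.eventually_nhds_iff.1 (hDl 0)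
  refine ⟨D 0, R / ‖t ^ 2‖, by positivity, fun ξ hξ hξR => ?_⟩
  rw [main _ (mul_ne_zero ht2 hξ), h]
  · simp only [hf1, inv_mul_cancel_left₀ ht2]; ring
  · rw [dist_zero_right, norm_mul, mul_comm]
    exact (lt_div_iff₀ (by positivity)).1 hξR

end fin

section germ
variable {p : ℕ} [Fact p.Prime] [MeasurableSpace ℚ_[p]] [BorelSpace ℚ_[p]]

lemma germ_of_scale (d : ℕ) (hd : 3 ≤ d) (f : ℚ_[p] → ℂ)
    (hf : LocallyConstantOn f ({0}ᶜ : Set ℚ_[p]))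
    (hs : ∀ t : ℚ_[p], t ≠ 0 → ∃ c : ℂ, ∃ ε : ℝ, 0 < ε ∧ ∀ ξ, ξ ≠ 0 → ‖ξ‖ < ε →
      f (t ^ 2 * ξ) = ((‖t‖ ^ d * (‖t‖ ^ 2)⁻¹ : ℝ) : ℂ) * f ξ + c) :
    ∃ C₀ : ℚ_[p] → ℂ, ∃ h : ℚ_[p] → ℂ, ∃ ε : ℝ,
        IsSchwartzBruhat C₀ ∧
        LocallyConstantOn h ({0}ᶜ : Set ℚ_[p]) ∧
        (∀ t : ℚ_[p], t ≠ 0 → ∀ ξ : ℚ_[p], ξ ≠ 0 → h (t ^ 2 * ξ) = h ξ) ∧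
        0 < ε ∧
        ∀ ξ : ℚ_[p], ξ ≠ 0 → ‖ξ‖ < ε →
          f ξ = C₀ ξ + h ξ * ((‖ξ‖ ^ (((d : ℝ) - 2) / 2) : ℝ) : ℂ) := by
  set κ : ℚ_[p] → ℝ := fun t => ‖t‖ ^ d * (‖t‖ ^ 2)⁻¹ with hκ
  set w : ℚ_[p] → ℝ := fun ξ => ‖ξ‖ ^ (((d : ℝ) - 2) / 2) with hw
  have hwpos : ∀ ξ, ξ ≠ 0 → 0 < w ξ := fun ξ hξ => Real.rpow_pos_of_pos (norm_pos_iff.2 hξ) _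
  have hκpos : ∀ t, t ≠ 0 → 0 < κ t := fun t ht => by
    have := norm_pos_iff.2 ht
    simp only [hκ]; positivity
  have hwκ : ∀ t ξ : ℚ_[p], t ≠ 0 → w (t ^ 2 * ξ) = κ t * w ξ := by
    intro t ξ ht
    have htn := norm_pos_iff.2 ht
    simp only [hw, hκ]
    rw [norm_mul, Real.mul_rpow (norm_nonneg _) (norm_nonneg _), norm_pow, ← Real.rpow_natCast,
      ← Real.rpow_mul htn.le]
    congr 1
    rw [show ((2:ℕ):ℝ) * (((d:ℝ) - 2) / 2) = (d:ℝ) - ((2:ℕ):ℝ) by push_cast; ring,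
      Real.rpow_sub htn, Real.rpow_natCast, Real.rpow_natCast]
    rfl
  have hp0 : (p : ℚ_[p]) ≠ 0 := by exact_mod_cast (Fact.out : p.Prime).ne_zero
  have hnp1 : ‖(p : ℚ_[p])‖ < 1 := Padic.norm_p_lt_one
  have hnp0 : 0 < ‖(p : ℚ_[p])‖ := norm_pos_iff.2 hp0
  set π : ℚ_[p] := (p : ℚ_[p]) ^ 2 with hπ
  have hπ0 : π ≠ 0 := pow_ne_zero _ hp0
  have hπ1 : ‖π‖ < 1 := by
    rw [hπ, norm_pow]; exact pow_lt_one₀ hnp0.le hnp1 two_ne_zero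
  set a : ℝ := κ p with ha
  have ha1 : a < 1 := by
    simp only [ha, hκ]
    rw [← div_eq_mul_inv, div_lt_one (by positivity)]
    exact pow_lt_pow_right_of_lt_one₀ hnp0 hnp1 (by lia)
  have ha1' : (1 : ℂ) - a ≠ 0 := by
    rw [sub_ne_zero]
    exact_mod_cast ha1.ne'
  obtain ⟨c, ε, hε, hfε⟩ := hs p hp0
  set C : ℂ := c / (1 - a) with hC
  have hCc : c = C * (1 - a) := by rw [hC]; field_simp
  have hG : ∀ ξ, ξ ≠ 0 → ‖ξ‖ < ε → f (π * ξ) - C = a * (f ξ - C) := by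
    intro ξ h1 h2
    rw [hfε ξ h1 h2, hCc]; ring
  set h₀ : ℚ_[p] → ℂ := fun ξ => (f ξ - C) / (w ξ : ℂ) with hh₀
  have hh₀l : ∀ ξ, ξ ≠ 0 → ∀ᶠ η in nhds ξ, h₀ η = h₀ ξ := by
    intro ξ hξ
    filter_upwards [hf ξ hξ, norm_loc hξ] with η h1 h2
    simp only [hh₀, hw, h1, h2]
  have hstep : ∀ ξ, ξ ≠ 0 → ‖ξ‖ < ε → h₀ (π * ξ) = h₀ ξ := by
    intro ξ h1 h2
    have hwc : (w ξ : ℂ) ≠ 0 := by exact_mod_cast (hwpos ξ h1).ne'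
    have hac : (a : ℂ) ≠ 0 := by exact_mod_cast (hκpos p hp0).ne'
    simp only [hh₀]
    rw [hG ξ h1 h2, hπ, hwκ _ _ hp0]
    push_cast
    rw [mul_div_mul_left _ _ hac]
  have hsmall : ∀ k (ξ : ℚ_[p]) (e : ℝ), ‖ξ‖ < e → ‖π ^ k * ξ‖ < e := by
    intro k ξ e h
    rw [norm_mul, norm_pow]
    refine lt_of_le_of_lt ?_ h
    exact mul_le_of_le_one_left (norm_nonneg _) (pow_le_one₀ (norm_nonneg _) hπ1.le)
  have hstepk : ∀ (k : ℕ) ξ, ξ ≠ 0 → ‖ξ‖ < ε → h₀ (π ^ k * ξ) = h₀ ξ := by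
    intro k ξ h1 h2
    induction k with
    | zero => simp
    | succ k ih =>
      rw [pow_succ', mul_assoc, hstep _ (mul_ne_zero (pow_ne_zero _ hπ0) h1) (hsmall k ξ ε h2), ih]
  have hex : ∀ (e : ℝ) (r : ℝ), 0 < e → 0 ≤ r → ∃ k : ℕ, ‖π‖ ^ k * r < e := by
    intro e r he hr
    obtain ⟨k, hk⟩ := exists_pow_lt_of_lt_one (show 0 < e / (r + 1) by positivity) hπ1
    refine ⟨k, ?_⟩
    rw [lt_div_iff₀ (by positivity)] at hk
    have : 0 ≤ ‖π‖ ^ k := by positivity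
    nlinarith
  have hN : ∀ r : ℝ, ∃ k : ℕ, 0 ≤ r → ‖π‖ ^ k * r < ε := by
    intro r
    by_cases hr : 0 ≤ r
    · obtain ⟨k, hk⟩ := hex ε r hε hr
      exact ⟨k, fun _ => hk⟩
    · exact ⟨0, fun h => (hr h).elim⟩
  choose N hN using hN
  set h : ℚ_[p] → ℂ := fun ξ => h₀ (π ^ N ‖ξ‖ * ξ) with hh
  have hkey : ∀ (k : ℕ) ξ, ξ ≠ 0 → ‖π ^ k * ξ‖ < ε → h ξ = h₀ (π ^ k * ξ) := by
    intro k ξ h1 h2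
    have e1 := hstepk (N ‖ξ‖) _ (mul_ne_zero (pow_ne_zero k hπ0) h1) h2
    have e2 := hstepk k _ (mul_ne_zero (pow_ne_zero (N ‖ξ‖) hπ0) h1) (by
      rw [norm_mul, norm_pow]; exact hN _ (norm_nonneg _))
    simp only [hh]
    rw [← e1, ← e2]
    congr 1; ring
  refine ⟨(Metric.closedBall (0:ℚ_[p]) 1).indicator (fun _ => C), h, min ε 1, ⟨?_, ?_⟩, ?_, ?_,
    lt_min hε one_pos, ?_⟩
  · have hcl := IsUltrametricDist.isClopen_closedBall (0:ℚ_[p]) one_ne_zero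
    rw [IsLocallyConstant.iff_eventually_eq]
    intro x
    by_cases hx : x ∈ Metric.closedBall (0:ℚ_[p]) 1
    · filter_upwards [hcl.isOpen.mem_nhds hx] with y hy
      rw [Set.indicator_of_mem hx, Set.indicator_of_mem hy]
    · filter_upwards [hcl.compl.isOpen.mem_nhds hx] with y hy
      rw [Set.indicator_of_notMem hx, Set.indicator_of_notMem hy]
  · exact HasCompactSupport.intro (isCompact_closedBall (0:ℚ_[p]) 1)
      (fun x hx => Set.indicator_of_notMem hx _)
  · intro ξ hξ
    have hξ : ξ ≠ 0 := hξ
    have hc : Tendsto (fun η => π ^ N ‖ξ‖ * η) (nhds ξ) (nhds (π ^ N ‖ξ‖ * ξ)) :=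
      (continuous_const_mul _).tendsto ξ
    filter_upwards [norm_loc hξ,
      hc.eventually (hh₀l _ (mul_ne_zero (pow_ne_zero _ hπ0) hξ))] with η h1 h2
    simp only [hh]
    rw [h1, h2]
  · intro t ht ξ hξ
    have ht2 : t ^ 2 ≠ 0 := pow_ne_zero _ ht
    have ht2n : 0 < ‖t ^ 2‖ := norm_pos_iff.2 ht2
    obtain ⟨c', ε', hε', hf'⟩ := hs t ht
    obtain ⟨k, hk⟩ := hex (min (min ε ε') (ε / ‖t ^ 2‖)) ‖ξ‖ (by positivity) (norm_nonneg _)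
    rw [← norm_pow, ← norm_mul] at hk
    set η := π ^ k * ξ with hη
    have hη0 : η ≠ 0 := mul_ne_zero (pow_ne_zero _ hπ0) hξ
    have k1 : ‖η‖ < ε := hk.trans_le ((min_le_left _ _).trans (min_le_left _ _))
    have k2 : ‖η‖ < ε' := hk.trans_le ((min_le_left _ _).trans (min_le_right _ _))
    have k3 : ‖t ^ 2 * η‖ < ε := by
      rw [norm_mul, mul_comm]
      exact (lt_div_iff₀ ht2n).1 (hk.trans_le (min_le_right _ _))
    have hcomm : π ^ k * (t ^ 2 * ξ) = t ^ 2 * η := by rw [hη]; ring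
    rw [hkey k ξ hξ k1, hkey k _ (mul_ne_zero ht2 hξ) (by rw [hcomm]; exact k3), hcomm, ← hη]
    -- the additive constant cancels
    have g1 := hf' η hη0 k2
    have g2 := hf' (π * η) (mul_ne_zero hπ0 hη0) (by simpa using hsmall 1 η ε' k2)
    have g3 := hG η hη0 k1
    have g4 := hG (t ^ 2 * η) (mul_ne_zero ht2 hη0) k3
    rw [show π * (t ^ 2 * η) = t ^ 2 * (π * η) by ring, g2, g1] at g4
    have g5 : f (π * η) = a * (f η - C) + C := by rw [← g3]; ring
    rw [g5] at g4
    have hκt : (((‖t‖ ^ d * (‖t‖ ^ 2)⁻¹ : ℝ)) : ℂ) = (κ t : ℂ) := rfl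
    rw [hκt] at g1 g4
    have g6 : (1 - (a:ℂ)) * (κ t * C + c' - C) = 0 := by linear_combination g4
    have g7 := (mul_eq_zero.1 g6).resolve_left ha1'
    have hwc : (w η : ℂ) ≠ 0 := by exact_mod_cast (hwpos η hη0).ne'
    have hkc : (κ t : ℂ) ≠ 0 := by exact_mod_cast (hκpos t ht).ne'
    simp only [hh₀]
    rw [hwκ t η ht, g1]
    push_cast
    rw [← mul_div_mul_left (f η - C) _ hkc]
    congr 1
    linear_combination g7
  · intro ξ hξ hξε
    have k1 : ‖ξ‖ < ε := hξε.trans_le (min_le_left _ _)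
    have k2 : ‖ξ‖ < 1 := hξε.trans_le (min_le_right _ _)
    have hwc : (w ξ : ℂ) ≠ 0 := by exact_mod_cast (hwpos ξ hξ).ne'
    rw [Set.indicator_of_mem (by simpa using k2.le), hkey 0 ξ hξ (by simpa using k1)]
    simp only [pow_zero, one_mul, hh₀]
    have : (((‖ξ‖ ^ (((d : ℝ) - 2) / 2) : ℝ)) : ℂ) = (w ξ : ℂ) := rfl
    rw [div_mul_cancel₀ _ hwc]; ring

end germ

/-- germ of the pushforward of a Schwartz–Bruhat measure under the split
quadratic form on `ℚ_p^d`, `d ≥ 3` odd: there is a unique locally constant density `f`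
away from `0`; it vanishes outside a compact set, and near `0` it has the form
`C₀(ξ) + h(ξ)·|ξ|_p^{(d−2)/2}` with `C₀` Schwartz–Bruhat and `h` locally constant
away from `0` and invariant under multiplication by nonzero squares. -/
theorem germ_pushforward_padic_odd (p : ℕ) [Fact p.Prime]
    [MeasurableSpace ℚ_[p]] [BorelSpace ℚ_[p]]
    (μ : Measure ℚ_[p]) [μ.IsAddHaarMeasure]
    (d : ℕ) (hd : 3 ≤ d) (hdo : Odd d)
    (μd : Measure (Fin d → ℚ_[p])) [μd.IsAddHaarMeasure]
    (Φ : (Fin d → ℚ_[p]) → ℂ) (hΦ : IsSchwartzBruhat Φ) :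
    ∃ f : ℚ_[p] → ℂ,
      LocallyConstantOn f ({0}ᶜ : Set ℚ_[p]) ∧
      (∀ g : ℚ_[p] → ℂ, Continuous g → HasCompactSupport g → (0 : ℚ_[p]) ∉ tsupport g →
        ∫ x, g (splitQP p d x) * Φ x ∂μd = ∫ ξ, g ξ * f ξ ∂μ) ∧
      (∀ f' : ℚ_[p] → ℂ, LocallyConstantOn f' ({0}ᶜ : Set ℚ_[p]) →
        (∀ g : ℚ_[p] → ℂ, Continuous g → HasCompactSupport g → (0 : ℚ_[p]) ∉ tsupport g →
          ∫ x, g (splitQP p d x) * Φ x ∂μd = ∫ ξ, g ξ * f' ξ ∂μ) →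
        Set.EqOn f' f ({0}ᶜ : Set ℚ_[p])) ∧
      (∃ K : Set ℚ_[p], IsCompact K ∧ ∀ ξ ∉ K, f ξ = 0) ∧
      (∃ C₀ : ℚ_[p] → ℂ, ∃ h : ℚ_[p] → ℂ, ∃ ε : ℝ,
        IsSchwartzBruhat C₀ ∧
        LocallyConstantOn h ({0}ᶜ : Set ℚ_[p]) ∧
        (∀ t : ℚ_[p], t ≠ 0 → ∀ ξ : ℚ_[p], ξ ≠ 0 → h (t ^ 2 * ξ) = h ξ) ∧
        0 < ε ∧
        ∀ ξ : ℚ_[p], ξ ≠ 0 → ‖ξ‖ < ε →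
          f ξ = C₀ ξ + h ξ * ((‖ξ‖ ^ (((d : ℝ) - 2) / 2) : ℝ) : ℂ)) := by
  obtain ⟨f, hf, hfd, hK⟩ := exists_dens μ hd hdo μd Φ hΦ
  refine ⟨f, hf, hfd, ?_, hK, germ_of_scale d hd f hf
    (fun t ht => dens_scale μ hd hdo μd Φ hΦ f hf hfd t ht)⟩
  intro f' hf' hfd' ξ hξ
  refine uniq_at μ hξ (hf' ξ hξ) (hf ξ hξ) ?_
  intro g hg hgc hgξ
  have hg0 : (0 : ℚ_[p]) ∉ tsupport g :=
    zero_notin (norm_pos_iff.2 hξ) (fun η hη => hgξ η hη.ne)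
  rw [← hfd' g hg hgc hg0, hfd g hg hgc hg0]
end
end

section
/- Let d ≥ 2. For every ψ ∈ 𝒮(ℝ) there exists Φ ∈ 𝒮(ℝ^d), vanishing identically on a neighborhood of the origin of ℝ^d, such that ∫_{ℝ^d} g(q_d(x)) Φ(x) dx = ∫_ℝ g(ξ) ψ(ξ) dξ for every continuous compactly supported g : ℝ → ℂ. In other words, every Schwartz measure on ℝ is the pushforward under the split quadratic form q_d of a Schwartz measure on ℝ^d supported away from the origin. -/
open MeasureTheory Filter

noncomputable section

/-- Extension of a vector in `ℝ^d` by zeros, for convenient indexing. -/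
def padR {d : ℕ} (x : Fin d → ℝ) (n : ℕ) : ℝ :=
  if h : n < d then x ⟨n, h⟩ else 0

/-- The split quadratic form `q_d` on `ℝ^d`. -/
def splitQR (d : ℕ) (x : Fin d → ℝ) : ℝ :=
  if Even d then ∑ i ∈ Finset.range (d / 2), padR x (2 * i) * padR x (2 * i + 1)
  else padR x 0 ^ 2 + ∑ i ∈ Finset.range (d / 2), padR x (2 * i + 1) * padR x (2 * i + 2)

open scoped ContDiff in
/-- Exterior product of two Schwartz functions. -/
theorem exists_schwartz_prod {E F : Type*} [NormedAddCommGroup E] [NormedSpace ℝ E]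
    [NormedAddCommGroup F] [NormedSpace ℝ F] (f : SchwartzMap E ℂ) (g : SchwartzMap F ℂ) :
    ∃ H : SchwartzMap (E × F) ℂ, ∀ p, H p = f p.1 * g p.2 := by
  have hf : ContDiff ℝ ∞ (f ∘ (ContinuousLinearMap.fst ℝ E F)) :=
    (f.smooth ⊤).comp (ContinuousLinearMap.contDiff _)
  have hg : ContDiff ℝ ∞ (g ∘ (ContinuousLinearMap.snd ℝ E F)) :=
    (g.smooth ⊤).comp (ContinuousLinearMap.contDiff _)
  have hf' : ∀ (i : ℕ) (p : E × F),
      ‖iteratedFDeriv ℝ i (f ∘ (ContinuousLinearMap.fst ℝ E F)) p‖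
        ≤ ‖iteratedFDeriv ℝ i f p.1‖ := by
    intro i p
    rw [ContinuousLinearMap.iteratedFDeriv_comp_right _ (f.smooth ⊤) p (mod_cast le_top)]
    refine (ContinuousMultilinearMap.norm_compContinuousLinearMap_le _ _).trans ?_
    refine mul_le_of_le_one_right (norm_nonneg _) ?_
    exact Finset.prod_le_one (fun _ _ => norm_nonneg _)
      (fun _ _ => ContinuousLinearMap.norm_fst_le ℝ E F)
  have hg' : ∀ (i : ℕ) (p : E × F),
      ‖iteratedFDeriv ℝ i (g ∘ (ContinuousLinearMap.snd ℝ E F)) p‖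
        ≤ ‖iteratedFDeriv ℝ i g p.2‖ := by
    intro i p
    rw [ContinuousLinearMap.iteratedFDeriv_comp_right _ (g.smooth ⊤) p (mod_cast le_top)]
    refine (ContinuousMultilinearMap.norm_compContinuousLinearMap_le _ _).trans ?_
    refine mul_le_of_le_one_right (norm_nonneg _) ?_
    exact Finset.prod_le_one (fun _ _ => norm_nonneg _)
      (fun _ _ => ContinuousLinearMap.norm_snd_le ℝ E F)
  refine ⟨⟨fun p => (f ∘ (ContinuousLinearMap.fst ℝ E F)) p *
    (g ∘ (ContinuousLinearMap.snd ℝ E F)) p, hf.mul hg, fun k n => ?_⟩, fun p => rfl⟩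
  choose Cf hCf using f.decay'
  choose Cg hCg using g.decay'
  refine ⟨∑ i ∈ Finset.range (n + 1), (n.choose i : ℝ) *
    (Cf k i * Cg 0 (n - i) + Cf 0 i * Cg k (n - i)), fun p => ?_⟩
  refine (mul_le_mul_of_nonneg_left
    (norm_iteratedFDeriv_mul_le hf hg p (mod_cast le_top)) (by positivity)).trans ?_
  rw [Finset.mul_sum]
  refine Finset.sum_le_sum fun i _ => ?_
  have h1 := hCf k i p.1
  have h2 := hCf 0 i p.1
  have h3 := hCg k (n - i) p.2
  have h4 := hCg 0 (n - i) p.2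
  have h5 := hf' i p
  have h6 := hg' (n - i) p
  change ‖p.1‖ ^ k * ‖iteratedFDeriv ℝ i f p.1‖ ≤ _ at h1
  change ‖p.1‖ ^ 0 * ‖iteratedFDeriv ℝ i f p.1‖ ≤ _ at h2
  change ‖p.2‖ ^ k * ‖iteratedFDeriv ℝ (n - i) g p.2‖ ≤ _ at h3
  change ‖p.2‖ ^ 0 * ‖iteratedFDeriv ℝ (n - i) g p.2‖ ≤ _ at h4
  rw [pow_zero, one_mul] at h2 h4
  have hp : ‖p‖ ^ k ≤ ‖p.1‖ ^ k + ‖p.2‖ ^ k := by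
    rcases max_cases ‖p.1‖ ‖p.2‖ with h | h
    · rw [Prod.norm_def, h.1]; exact le_add_of_nonneg_right (by positivity)
    · rw [Prod.norm_def, h.1]; exact le_add_of_nonneg_left (by positivity)
  have hA := norm_nonneg (iteratedFDeriv ℝ i f p.1)
  have hB := norm_nonneg (iteratedFDeriv ℝ (n - i) g p.2)
  generalize ‖iteratedFDeriv ℝ i f p.1‖ = A at *
  generalize ‖iteratedFDeriv ℝ (n - i) g p.2‖ = B at *
  calc _ ≤ (‖p.1‖ ^ k + ‖p.2‖ ^ k) * ((n.choose i : ℝ) * A * B) := by gcongr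
    _ = (n.choose i : ℝ) * ((‖p.1‖ ^ k * A) * B + A * (‖p.2‖ ^ k * B)) := by ring
    _ ≤ _ := by
      gcongr
      · exact le_trans (by positivity) h1
      · exact le_trans (by positivity) h2

theorem splitQR_snoc (m : ℕ) (z : Fin (m + 1) → ℝ) (b : ℝ) :
    splitQR (m + 2) (Fin.snoc z b : Fin (m + 2) → ℝ) =
      z (Fin.last m) * b + splitQR (m + 2) (Fin.snoc z 0 : Fin (m + 2) → ℝ) := by
  have h1 : ∀ c : ℝ, ∀ j, j < m + 1 →
      padR (Fin.snoc z c : Fin (m + 2) → ℝ) j = padR z j := by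
    intro c j hj
    have : j < m + 2 := by omega
    simp only [padR, hj, this, dif_pos, Fin.snoc]
    rfl
  have h2 : ∀ c : ℝ, padR (Fin.snoc z c : Fin (m + 2) → ℝ) (m + 1) = c := by
    intro c
    simp [padR, Fin.snoc]
  have h3 : padR z m = z (Fin.last m) := by
    simp [padR, Fin.last]
  unfold splitQR
  split_ifs with h
  · obtain ⟨k, rfl⟩ : ∃ k, m = 2 * k := by
      obtain ⟨r, hr⟩ := h
      exact ⟨r - 1, by omega⟩
    have hk : (2 * k + 2) / 2 = k + 1 := by omega
    rw [hk, Finset.sum_range_succ, Finset.sum_range_succ, h2, h2, h1 _ _ (by omega), h3,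
      mul_zero, add_zero, add_comm]
    congr 1
    refine Finset.sum_congr rfl fun i hi => ?_
    have := Finset.mem_range.1 hi
    rw [h1 _ _ (by omega), h1 _ _ (by omega), h1 _ _ (by omega), h1 _ _ (by omega)]
  · obtain ⟨k, rfl⟩ : ∃ k, m = 2 * k + 1 := by
      obtain ⟨r, hr⟩ := Nat.not_even_iff_odd.1 h
      exact ⟨r - 1, by omega⟩
    have hk : (2 * k + 1 + 2) / 2 = k + 1 := by omega
    rw [hk, Finset.sum_range_succ, Finset.sum_range_succ]
    have h2' : ∀ c : ℝ, padR (Fin.snoc z c : Fin (2 * k + 1 + 2) → ℝ) (2 * k + 2) = c := h2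
    rw [h2', h2', h1 _ (2 * k + 1) (by omega), h1 _ (2 * k + 1) (by omega), h3, h1 _ 0 (by omega), h1 _ 0 (by omega),
      mul_zero, add_zero]
    have : ∑ i ∈ Finset.range k, padR (Fin.snoc z b : Fin (2 * k + 1 + 2) → ℝ) (2 * i + 1) *
          padR (Fin.snoc z b : Fin (2 * k + 1 + 2) → ℝ) (2 * i + 2) =
        ∑ i ∈ Finset.range k, padR (Fin.snoc z 0 : Fin (2 * k + 1 + 2) → ℝ) (2 * i + 1) *
          padR (Fin.snoc z 0 : Fin (2 * k + 1 + 2) → ℝ) (2 * i + 2) := by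
      refine Finset.sum_congr rfl fun i hi => ?_
      have := Finset.mem_range.1 hi
      rw [h1 _ _ (by omega), h1 _ _ (by omega), h1 _ _ (by omega), h1 _ _ (by omega)]
    rw [this]
    ring

theorem tg_padR {d : ℕ} (n : ℕ) :
    Function.HasTemperateGrowth (fun x : Fin d → ℝ => padR x n) := by
  unfold padR
  split_ifs with h
  · exact (ContinuousLinearMap.proj (R := ℝ) (φ := fun _ : Fin d => ℝ) ⟨n, h⟩).hasTemperateGrowth
  · exact Function.HasTemperateGrowth.const 0

theorem tg_splitQR (d : ℕ) : Function.HasTemperateGrowth (splitQR d) := by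
  have : splitQR d = fun x => splitQR d x := rfl
  rw [this]
  unfold splitQR
  split_ifs with h
  · exact Function.HasTemperateGrowth.sum fun i _ => (tg_padR _).mul (tg_padR _)
  · exact ((tg_padR _).pow 2).add
      (Function.HasTemperateGrowth.sum fun i _ => (tg_padR _).mul (tg_padR _))

/-- The continuous linear map `z ↦ (z, 0)`. -/
def snocZ (n : ℕ) : (Fin n → ℝ) →L[ℝ] (Fin (n + 1) → ℝ) :=
  LinearMap.toContinuousLinearMap
    { toFun := fun z => Fin.snoc z 0
      map_add' := by
        intro x y
        ext i
        refine Fin.lastCases ?_ (fun j => ?_) i <;> simp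
      map_smul' := by
        intro c x
        ext i
        refine Fin.lastCases ?_ (fun j => ?_) i <;> simp }

/-- The continuous linear map forgetting the last coordinate. -/
def initL (n : ℕ) : (Fin (n + 1) → ℝ) →L[ℝ] (Fin n → ℝ) :=
  ContinuousLinearMap.pi fun i => ContinuousLinearMap.proj (R := ℝ) (φ := fun _ : Fin (n+1) => ℝ)
    i.castSucc

theorem tg_prodMk {D E F : Type*} [NormedAddCommGroup D] [NormedSpace ℝ D]
    [NormedAddCommGroup E] [NormedSpace ℝ E]
    [NormedAddCommGroup F] [NormedSpace ℝ F] {f : D → E} {g : D → F}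
    (hf : f.HasTemperateGrowth) (hg : g.HasTemperateGrowth) :
    Function.HasTemperateGrowth (fun x => (f x, g x)) := by
  have h1 := (ContinuousLinearMap.inl ℝ E F).hasTemperateGrowth.comp hf
  have h2 := (ContinuousLinearMap.inr ℝ E F).hasTemperateGrowth.comp hg
  convert! h1.add h2 using 1
  ext x <;> simp

/-- Pulling back exterior products along `(z, b) ↦ (h z * b + P z, z)`. -/
theorem exists_schwartz_pull (n : ℕ) (ψ : SchwartzMap ℝ ℂ) (η : SchwartzMap (Fin n → ℝ) ℂ)
    (h P : (Fin n → ℝ) → ℝ) (hh : h.HasTemperateGrowth) (hP : P.HasTemperateGrowth)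
    (hlow : ∀ z, 1 / 2 ≤ h z) :
    ∃ Φ : SchwartzMap (Fin (n + 1) → ℝ) ℂ,
      ∀ x, Φ x = ψ (h (initL n x) * x (Fin.last n) + P (initL n x)) * η (initL n x) := by
  obtain ⟨H, hH⟩ := exists_schwartz_prod ψ η
  have hlast : Function.HasTemperateGrowth (fun x : Fin (n + 1) → ℝ => x (Fin.last n)) :=
    (ContinuousLinearMap.proj (R := ℝ) (φ := fun _ : Fin (n+1) => ℝ)
      (Fin.last n)).hasTemperateGrowth
  have hG : Function.HasTemperateGrowth (fun x : Fin (n + 1) → ℝ =>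
      (h (initL n x) * x (Fin.last n) + P (initL n x), initL n x)) :=
    tg_prodMk (((hh.comp (initL n).hasTemperateGrowth).mul hlast).add
      (hP.comp (initL n).hasTemperateGrowth)) (initL n).hasTemperateGrowth
  obtain ⟨k, C, hC⟩ := hP.2 0
  have hC0 : 0 ≤ C := by
    have := hC 0
    simp only [norm_zero, add_zero, one_pow, mul_one] at this
    exact (norm_nonneg _).trans this
  have hup : ∃ (k : ℕ) (C : ℝ), ∀ x : Fin (n + 1) → ℝ, ‖x‖ ≤ C *
      (1 + ‖(h (initL n x) * x (Fin.last n) + P (initL n x), initL n x)‖) ^ k := by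
    refine ⟨k + 1, 2 + 2 * C, fun x => ?_⟩
    set z := initL n x with hz
    set b := x (Fin.last n)
    set N := ‖(h z * b + P z, z)‖ with hN
    have hN0 : 0 ≤ N := norm_nonneg _
    have hzN : ‖z‖ ≤ N := le_max_right _ _
    have hxN : |h z * b + P z| ≤ N := le_max_left _ _
    have hPz : |P z| ≤ C * (1 + N) ^ k := by
      have := hC z
      rw [norm_iteratedFDeriv_zero] at this
      refine this.trans ?_
      gcongr
    have hb : |b| ≤ 2 * (N + C * (1 + N) ^ k) := by
      have h1 : |h z * b| ≤ N + C * (1 + N) ^ k := by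
        calc |h z * b| = |(h z * b + P z) - P z| := by congr 1; ring
          _ ≤ |h z * b + P z| + |P z| := abs_sub _ _
          _ ≤ _ := add_le_add hxN hPz
      rw [abs_mul, abs_of_pos (by linarith [hlow z] : 0 < h z)] at h1
      nlinarith [hlow z, abs_nonneg b]
    have hpow : (1:ℝ) ≤ (1 + N) ^ k := one_le_pow₀ (by linarith)
    have hfin : 2 * (N + C * (1 + N) ^ k) ≤ (2 + 2 * C) * (1 + N) ^ (k + 1) := by
      rw [pow_succ]
      nlinarith [mul_nonneg hN0 (sub_nonneg.2 hpow), mul_nonneg hC0 (zero_le_one.trans hpow),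
        mul_nonneg (mul_nonneg hC0 (zero_le_one.trans hpow)) hN0]
    have hCp : 0 ≤ C * (1 + N) ^ k := by positivity
    rw [pi_norm_le_iff_of_nonneg (by positivity)]
    intro i
    refine Fin.lastCases ?_ (fun j => ?_) i
    · exact hb.trans hfin
    · have : ‖x j.castSucc‖ ≤ ‖z‖ := norm_le_pi_norm z j
      linarith
  exact ⟨SchwartzMap.compCLM ℝ hG hup H, fun x => by simp [hH]⟩

theorem inner_int (g : ℝ → ℂ) (ψ : ℝ → ℂ) (a c : ℝ) (ha : 0 < a) :
    ∫ b : ℝ, g (a * b + c) * ψ (a * b + c) = (a : ℂ)⁻¹ * ∫ ξ, g ξ * ψ ξ := by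
  have h1 := Measure.integral_comp_mul_left (fun t => g (t + c) * ψ (t + c)) a
  have h2 := integral_add_right_eq_self (μ := volume) (fun t => g t * ψ t) c
  rw [h1, h2, abs_of_pos (inv_pos.2 ha)]
  simp

theorem int_snoc (n : ℕ) (f : (Fin (n + 1) → ℝ) → ℂ) (hf : Integrable f) :
    ∫ x, f x = ∫ z : Fin n → ℝ, ∫ b : ℝ, f (Fin.snoc z b : Fin (n + 1) → ℝ) := by
  have hmp := (volume_preserving_piFinSuccAbove (fun _ : Fin (n + 1) => ℝ) (Fin.last n)).symm
  have he : ∀ p : ℝ × (Fin n → ℝ),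
      (MeasurableEquiv.piFinSuccAbove (fun _ : Fin (n + 1) => ℝ) (Fin.last n)).symm p =
        (Fin.snoc p.2 p.1 : Fin (n + 1) → ℝ) := by
    intro p
    simp [MeasurableEquiv.piFinSuccAbove, Fin.insertNthEquiv, Fin.insertNth_last']
  have h1 := hmp.integral_comp' f
  have h2 := (hmp.integrable_comp_emb (MeasurableEquiv.measurableEmbedding _)).2 hf
  rw [← h1]
  have := integral_prod_symm _ h2
  refine this.trans ?_
  refine integral_congr_ae (Eventually.of_forall fun z => ?_)
  refine integral_congr_ae (Eventually.of_forall fun b => ?_)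
  exact congrArg f (he (b, z))

theorem main_aux (m : ℕ) (ψ : SchwartzMap ℝ ℂ) :
    ∃ Φ : SchwartzMap (Fin (m + 2) → ℝ) ℂ,
      (∀ᶠ x in nhds (0 : Fin (m + 2) → ℝ), Φ x = 0) ∧
      ∀ g : ℝ → ℂ, Continuous g → HasCompactSupport g →
        ∫ x : Fin (m + 2) → ℝ, g (splitQR (m + 2) x) * Φ x = ∫ ξ : ℝ, g ξ * ψ ξ := by
  let z0 : Fin (m + 1) → ℝ := fun _ => 1
  let χ : ContDiffBump z0 := ⟨1 / 4, 1 / 2, by norm_num, by norm_num⟩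
  let β : ContDiffBump z0 := ⟨1 / 8, 1 / 4, by norm_num, by norm_num⟩
  let ℓ : (Fin (m + 1) → ℝ) →L[ℝ] ℝ :=
    ContinuousLinearMap.proj (R := ℝ) (φ := fun _ : Fin (m + 1) => ℝ) (Fin.last m)
  let η : (Fin (m + 1) → ℝ) → ℝ := β.normed volume
  let h : (Fin (m + 1) → ℝ) → ℝ := fun z => 1 + χ z * (ℓ z - 1)
  let P : (Fin (m + 1) → ℝ) → ℝ := fun z => splitQR (m + 2) (snocZ (m + 1) z)
  have hℓ : ∀ z, |ℓ z - 1| ≤ dist z z0 := fun z => dist_le_pi_dist z z0 (Fin.last m)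
  have hχ : Function.HasTemperateGrowth (χ : (Fin (m + 1) → ℝ) → ℝ) :=
    (χ.hasCompactSupport.toSchwartzMap χ.contDiff).hasTemperateGrowth
  have hh : h.HasTemperateGrowth :=
    (Function.HasTemperateGrowth.const 1).add
      (hχ.mul (ℓ.hasTemperateGrowth.sub (Function.HasTemperateGrowth.const 1)))
  have hP : P.HasTemperateGrowth := (tg_splitQR (m + 2)).comp (snocZ (m + 1)).hasTemperateGrowth
  have hlow : ∀ z, 1 / 2 ≤ h z := by
    intro z
    change 1 / 2 ≤ 1 + χ z * (ℓ z - 1)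
    by_cases hz : dist z z0 < 1 / 2
    · have h1 := abs_le.1 ((hℓ z).trans hz.le)
      nlinarith [χ.nonneg (x := z), χ.le_one (x := z)]
    · rw [χ.zero_of_le_dist (by simpa [χ] using hz)]
      norm_num
  have hη0 : ∀ z, 1 / 4 ≤ dist z z0 → η z = 0 := by
    intro z hz
    by_contra hne
    have : z ∈ Function.support (β.normed volume) := hne
    rw [β.support_normed_eq] at this
    have := Metric.mem_ball.1 this
    change dist z z0 < 1 / 4 at this
    linarith
  have hhη : ∀ z, η z ≠ 0 → h z = ℓ z ∧ 0 < ℓ z := by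
    intro z hz
    have hd : dist z z0 < 1 / 4 := by
      by_contra hc
      exact hz (hη0 z (not_lt.1 hc))
    refine ⟨?_, ?_⟩
    · change 1 + χ z * (ℓ z - 1) = ℓ z
      rw [χ.one_of_mem_closedBall (Metric.mem_closedBall.2 hd.le)]
      ring
    · have := abs_le.1 ((hℓ z).trans hd.le)
      linarith
  let θf : (Fin (m + 1) → ℝ) → ℂ := fun z => ((η z * ℓ z : ℝ) : ℂ)
  have hθs : HasCompactSupport θf := by
    refine HasCompactSupport.comp_left (g := fun t : ℝ => (t : ℂ)) ?_ (by simp)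
    exact β.hasCompactSupport_normed.mul_right
  have hθc : ContDiff ℝ (⊤ : ℕ∞) θf :=
    Complex.ofRealCLM.contDiff.comp (β.contDiff_normed.mul ℓ.contDiff)
  obtain ⟨Φ, hΦ⟩ := exists_schwartz_pull (m + 1) ψ (hθs.toSchwartzMap hθc) h P hh hP hlow
  have hΦ' : ∀ x, Φ x = ψ (h (initL (m + 1) x) * x (Fin.last (m + 1)) + P (initL (m + 1) x)) *
      ((η (initL (m + 1) x) * ℓ (initL (m + 1) x) : ℝ) : ℂ) := hΦ
  refine ⟨Φ, ?_, fun g hg hgs => ?_⟩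
  · filter_upwards [Metric.ball_mem_nhds (0 : Fin (m + 2) → ℝ) (show (0:ℝ) < 1 / 2 by norm_num)]
      with x hx
    have : η (initL (m + 1) x) = 0 := by
      apply hη0
      have h1 := hℓ (initL (m + 1) x)
      have h2 : |ℓ (initL (m + 1) x)| ≤ ‖x‖ := norm_le_pi_norm x _
      have h3 : ‖x‖ < 1 / 2 := by simpa using hx
      have h4 := abs_le.1 h2
      have h5 := neg_abs_le (ℓ (initL (m + 1) x) - 1)
      linarith
    rw [hΦ', this]
    simp
  · obtain ⟨M, hM⟩ := hg.bounded_above_of_compact_support hgs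
    have hint : Integrable (fun x => g (splitQR (m + 2) x) * Φ x) :=
      (Φ.integrable (μ := volume)).bdd_mul (c := M)
        (hg.comp (tg_splitQR (m + 2)).1.continuous).aestronglyMeasurable
        (Eventually.of_forall fun x => hM _)
    rw [int_snoc _ _ hint]
    have key : ∀ z : Fin (m + 1) → ℝ,
        ∫ b : ℝ, g (splitQR (m + 2) (Fin.snoc z b : Fin (m + 2) → ℝ)) *
          Φ (Fin.snoc z b : Fin (m + 2) → ℝ) = (η z : ℂ) * ∫ ξ, g ξ * ψ ξ := by
      intro z
      have hinit : ∀ b : ℝ, initL (m + 1) (Fin.snoc z b : Fin (m + 2) → ℝ) = z := by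
        intro b
        ext i
        simp [initL]
      have hval : ∀ b : ℝ, g (splitQR (m + 2) (Fin.snoc z b : Fin (m + 2) → ℝ)) *
          Φ (Fin.snoc z b : Fin (m + 2) → ℝ) = ((η z * ℓ z : ℝ) : ℂ) *
            (g (ℓ z * b + P z) * ψ (ℓ z * b + P z)) := by
        intro b
        rw [hΦ', hinit, splitQR_snoc]
        by_cases hz : η z = 0
        · simp [hz]
        · rw [(hhη z hz).1, Fin.snoc_last]
          change g (ℓ z * b + P z) * _ = _
          ring
      simp_rw [hval]
      rw [integral_const_mul]
      by_cases hz : η z = 0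
      · simp [hz]
      · have hpos := (hhη z hz).2
        rw [inner_int _ _ _ _ hpos]
        have : (ℓ z : ℂ) ≠ 0 := by exact_mod_cast hpos.ne'
        push_cast
        field_simp
    simp_rw [key]
    rw [integral_mul_const, integral_complex_ofReal]
    have : ∫ z, η z = 1 := β.integral_normed
    rw [this]
    simp

/-- every Schwartz measure on `ℝ` is the pushforward under the split
quadratic form `q_d` of a Schwartz measure on `ℝ^d` supported away from the origin. -/
theorem schwartz_pushforward_surjective_real (d : ℕ) (hd : 2 ≤ d)
    (ψ : SchwartzMap ℝ ℂ) :
    ∃ Φ : SchwartzMap (Fin d → ℝ) ℂ,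
      (∀ᶠ x in nhds (0 : Fin d → ℝ), Φ x = 0) ∧
      ∀ g : ℝ → ℂ, Continuous g → HasCompactSupport g →
        ∫ x : Fin d → ℝ, g (splitQR d x) * Φ x = ∫ ξ : ℝ, g ξ * ψ ξ := by
  obtain ⟨m, rfl⟩ : ∃ m, d = m + 2 := ⟨d - 2, by omega⟩
  exact main_aux m ψ
end
end

section
/- Let d ≥ 2. For every Schwartz–Bruhat function ψ on ℚ_p there exists a Schwartz–Bruhat function Φ on ℚ_p^d, vanishing identically on a neighborhood of the origin of ℚ_p^d, such that ∫_{ℚ_p^d} g(q_d(x)) Φ(x) dx = ∫_{ℚ_p} g(ξ) ψ(ξ) dξ for every continuous compactly supported g : ℚ_p → ℂ. In other words, every Schwartz–Bruhat measure on ℚ_p is the pushforward under the split quadratic form q_d of a Schwartz–Bruhat measure on ℚ_p^d supported away from the origin. -/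
open MeasureTheory Filter

noncomputable section

namespace SchwartzAux

variable {p : ℕ} [Fact p.Prime]

lemma padP_continuous {d : ℕ} (n : ℕ) :
    Continuous (fun x : Fin d → ℚ_[p] => padP x n) := by
  unfold padP
  by_cases h : n < d
  · simp only [h, dite_true]; exact continuous_apply _
  · simp only [h, dite_false]; exact continuous_const

lemma splitQP_continuous (d : ℕ) : Continuous (splitQP p d) := by
  have := fun n => padP_continuous (p := p) (d := d) n
  unfold splitQP
  by_cases h : Even d
  · simp only [h, if_true]
    fun_prop
  · simp only [h, if_false]
    fun_prop

lemma padP_snoc_lt {n : ℕ} (z : Fin (n+1) → ℚ_[p]) (t : ℚ_[p]) (k : ℕ) (hk : k < n + 1) :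
    padP (Fin.snoc z t : Fin (n+2) → ℚ_[p]) k = z ⟨k, hk⟩ := by
  unfold padP
  rw [dif_pos (by omega)]
  exact Fin.snoc_castSucc (α := fun _ => ℚ_[p]) t z ⟨k, hk⟩

lemma padP_snoc_last {n : ℕ} (z : Fin (n+1) → ℚ_[p]) (t : ℚ_[p]) :
    padP (Fin.snoc z t : Fin (n+2) → ℚ_[p]) (n+1) = t := by
  unfold padP
  rw [dif_pos (by omega)]
  exact Fin.snoc_last (α := fun _ => ℚ_[p]) t z

lemma splitQP_snoc {n : ℕ} (z : Fin (n+1) → ℚ_[p]) (t : ℚ_[p]) :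
    splitQP p (n+2) (Fin.snoc z t) = z (Fin.last n) * t + splitQP p (n+2) (Fin.snoc z 0) := by
  have hlt : ∀ k, k < n + 1 → padP (Fin.snoc z t : Fin (n+2) → ℚ_[p]) k =
      padP (Fin.snoc z 0 : Fin (n+2) → ℚ_[p]) k := fun k hk => by
    rw [padP_snoc_lt z t k hk, padP_snoc_lt z 0 k hk]
  have hdiv : (n + 2) / 2 = n / 2 + 1 := by omega
  have hn : ∀ s, padP (Fin.snoc z s : Fin (n+2) → ℚ_[p]) n = z (Fin.last n) := fun s =>
    padP_snoc_lt z s n (by omega)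
  unfold splitQP
  by_cases h : Even (n + 2)
  · have h2 : 2 * (n / 2) = n := by grind
    simp only [h, if_true, hdiv, Finset.sum_range_succ, h2, hn, padP_snoc_last]
    rw [Finset.sum_congr rfl (g := fun i => padP (Fin.snoc z 0 : Fin (n+2) → ℚ_[p]) (2 * i) *
      padP (Fin.snoc z 0 : Fin (n+2) → ℚ_[p]) (2 * i + 1))]
    · ring
    · intro i hi
      rw [Finset.mem_range] at hi
      rw [hlt _ (by omega), hlt _ (by omega)]
  · have h2 : 2 * (n / 2) + 1 = n := by grind
    have h3 : 2 * (n / 2) + 2 = n + 1 := by omega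
    simp only [h, if_false, hdiv, Finset.sum_range_succ, h2, h3, hn, padP_snoc_last]
    rw [Finset.sum_congr rfl (g := fun i => padP (Fin.snoc z 0 : Fin (n+2) → ℚ_[p]) (2 * i + 1) *
      padP (Fin.snoc z 0 : Fin (n+2) → ℚ_[p]) (2 * i + 2)), hlt 0 (by omega)]
    · ring
    · intro i hi
      rw [Finset.mem_range] at hi
      rw [hlt _ (by omega), hlt _ (by omega)]

lemma map_mul_unit [MeasurableSpace ℚ_[p]] [BorelSpace ℚ_[p]]
    (μ : Measure ℚ_[p]) [μ.IsAddHaarMeasure] (y : ℚ_[p]) (hy : ‖y‖ = 1) :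
    μ.map (fun t => y * t) = μ := by
  have hy0 : y ≠ 0 := by rintro rfl; simp at hy
  have hH : (μ.map (fun t => y * t)).IsAddHaarMeasure :=
    Measure.isAddHaarMeasure_map μ (AddMonoidHom.mulLeft y) (continuous_const.mul continuous_id)
      (Homeomorph.mulLeft₀ y hy0).surjective
      (Homeomorph.mulLeft₀ y hy0).isClosedEmbedding.tendsto_cocompact
  have h := Measure.isAddLeftInvariant_eq_smul (μ.map (fun t => y * t)) μ
  set c := Measure.addHaarScalarFactor (μ.map (fun t => y * t)) μ
  have hB := congrArg (fun ν : Measure ℚ_[p] => ν (Metric.closedBall 0 1)) h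
  rw [Measure.map_apply (measurable_const_mul y) measurableSet_closedBall] at hB
  have hpre : (fun t => y * t) ⁻¹' (Metric.closedBall (0 : ℚ_[p]) 1) = Metric.closedBall 0 1 := by
    ext t; simp [hy]
  have h0 : μ (Metric.closedBall 0 1) ≠ 0 := (Metric.measure_closedBall_pos μ 0 one_pos).ne'
  have h1 : μ (Metric.closedBall 0 1) ≠ ⊤ := (isCompact_closedBall _ _).measure_ne_top
  rw [hpre, Measure.smul_apply, ENNReal.smul_def, smul_eq_mul] at hB
  have hc : (c : ENNReal) = 1 := by
    have : 1 * μ (Metric.closedBall 0 1) = c * μ (Metric.closedBall 0 1) := by rwa [one_mul]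
    exact ((ENNReal.mul_left_inj h0 h1).1 this).symm
  have hc' : c = 1 := by exact_mod_cast hc
  rw [h, hc', one_smul]

lemma integral_affine [MeasurableSpace ℚ_[p]] [BorelSpace ℚ_[p]]
    (μ : Measure ℚ_[p]) [μ.IsAddHaarMeasure] (y : ℚ_[p]) (hy : ‖y‖ = 1) (r : ℚ_[p])
    (h : ℚ_[p] → ℂ) : ∫ t, h (y * t + r) ∂μ = ∫ t, h t ∂μ := by
  have hy0 : y ≠ 0 := by rintro rfl; simp at hy
  rw [← integral_add_right_eq_self (μ := μ) h r]
  conv_rhs => rw [← map_mul_unit μ y hy]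
  exact ((Homeomorph.mulLeft₀ y hy0).measurableEmbedding.integral_map
    (fun t => h (t + r))).symm

def W (p : ℕ) [Fact p.Prime] (n : ℕ) : Set (Fin (n+1) → ℚ_[p]) :=
  {z | ‖z (Fin.last n)‖ = 1} ∩ Metric.closedBall 0 1

lemma W_clopen (n : ℕ) : IsClopen (W p n) := by
  apply IsClopen.inter
  · have : {z : Fin (n+1) → ℚ_[p] | ‖z (Fin.last n)‖ = 1} =
        (fun z : Fin (n+1) → ℚ_[p] => z (Fin.last n)) ⁻¹' Metric.sphere 0 1 := by ext; simp
    rw [this]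
    exact (IsUltrametricDist.isClopen_sphere 0 one_ne_zero).preimage (continuous_apply _)
  · exact IsUltrametricDist.isClopen_closedBall 0 one_ne_zero

lemma W_compact (n : ℕ) : IsCompact (W p n) :=
  (isCompact_closedBall _ _).inter_left
    (isClosed_eq (continuous_apply _).norm continuous_const)

lemma W_nonempty (n : ℕ) : (W p n).Nonempty :=
  ⟨fun _ => 1, by simp, by simp [pi_norm_const]⟩

lemma init_continuous (n : ℕ) :
    Continuous (fun x : Fin (n+2) → ℚ_[p] => (Fin.init x : Fin (n+1) → ℚ_[p])) :=
  continuous_pi fun _ => continuous_apply _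

def Phi (n : ℕ) (ψ : ℚ_[p] → ℂ) (x : Fin (n+2) → ℚ_[p]) : ℂ :=
  (W p n).indicator (fun _ => (1 : ℂ)) (Fin.init x) * ψ (splitQP p (n+2) x)

lemma Phi_lc (n : ℕ) (ψ : ℚ_[p] → ℂ) (hψ : IsLocallyConstant ψ) :
    IsLocallyConstant (Phi n ψ) := by
  have h1 : IsLocallyConstant ((W p n).indicator (1 : (Fin (n+1) → ℚ_[p]) → ℂ)) := by
    rw [← LocallyConstant.coe_charFn ℂ (W_clopen n)]
    exact LocallyConstant.isLocallyConstant _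
  exact (h1.comp_continuous (init_continuous n)).mul
    (hψ.comp_continuous (splitQP_continuous _))

lemma Phi_cs (n : ℕ) (ψ : ℚ_[p] → ℂ) (hψ : HasCompactSupport ψ) :
    HasCompactSupport (Phi n ψ) := by
  let F : (Fin (n+1) → ℚ_[p]) × ℚ_[p] → (Fin (n+2) → ℚ_[p]) := fun a =>
    Fin.snoc a.1 ((a.1 (Fin.last n))⁻¹ * (a.2 - splitQP p (n+2) (Fin.snoc a.1 0)))
  have hne : ∀ z ∈ W p n, z (Fin.last n) ≠ 0 := by
    intro z hz h0
    have := hz.1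
    simp [h0] at this
  have hK : IsCompact (F '' (W p n ×ˢ tsupport ψ)) := by
    apply ((W_compact n).prod hψ).image_of_continuousOn
    have hc : ContinuousOn (fun a : (Fin (n+1) → ℚ_[p]) × ℚ_[p] => (a.1 (Fin.last n))⁻¹)
        (W p n ×ˢ tsupport ψ) := by
      apply ContinuousOn.inv₀
      · fun_prop
      · intro a ha; exact hne _ ha.1
    have hs : Continuous (fun a : (Fin (n+1) → ℚ_[p]) × ℚ_[p] =>
        splitQP p (n+2) (Fin.snoc a.1 0)) :=
      (splitQP_continuous _).comp
        (Continuous.finSnoc (A := fun _ => ℚ_[p]) continuous_fst continuous_const)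
    have hm : ContinuousOn (fun a : (Fin (n+1) → ℚ_[p]) × ℚ_[p] => (a.1 (Fin.last n))⁻¹ *
        (a.2 - splitQP p (n+2) (Fin.snoc a.1 0))) (W p n ×ˢ tsupport ψ) :=
      hc.mul (continuousOn_snd.sub hs.continuousOn)
    intro a ha
    exact Filter.Tendsto.finSnoc (A := fun _ => ℚ_[p])
      (continuousOn_fst a ha) (hm a ha)
  refine HasCompactSupport.of_support_subset_isCompact hK ?_
  intro x hx
  have hx' : Phi n ψ x ≠ 0 := hx
  unfold Phi at hx'
  have hw : Fin.init x ∈ W p n := Set.mem_of_indicator_ne_zero (left_ne_zero_of_mul hx')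
  have hq := right_ne_zero_of_mul hx'
  refine ⟨(Fin.init x, splitQP p (n+2) x), ⟨hw, subset_tsupport _ hq⟩, ?_⟩
  have e := splitQP_snoc (Fin.init x : Fin (n+1) → ℚ_[p]) (x (Fin.last (n+1)))
  have e2 : (Fin.snoc (Fin.init x : Fin (n+1) → ℚ_[p]) (x (Fin.last (n+1))) :
    Fin (n+2) → ℚ_[p]) = x := Fin.snoc_init_self (α := fun _ => ℚ_[p]) x
  rw [e2] at e
  have h0 := hne _ hw
  show Fin.snoc (Fin.init x) _ = x
  conv_rhs => rw [← e2]
  congr 1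
  simp only
  rw [e]
  field_simp
  ring

lemma Phi_zero (n : ℕ) (ψ : ℚ_[p] → ℂ) :
    ∀ᶠ x in nhds (0 : Fin (n+2) → ℚ_[p]), Phi n ψ x = 0 := by
  have h : ∀ᶠ x in nhds (0 : Fin (n+2) → ℚ_[p]), (Fin.init x : Fin (n+1) → ℚ_[p]) ∈ (W p n)ᶜ := by
    apply (init_continuous n).continuousAt.eventually_mem
    apply (W_clopen n).1.isOpen_compl.mem_nhds
    intro h
    have := h.1
    simp [Fin.init] at this
  filter_upwards [h] with x hx
  simp [Phi, Set.indicator_of_notMem hx]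

lemma main_integral [MeasurableSpace ℚ_[p]] [BorelSpace ℚ_[p]]
    (μ : Measure ℚ_[p]) [μ.IsAddHaarMeasure] (n : ℕ)
    (ψ : ℚ_[p] → ℂ) (hψ : IsSchwartzBruhat ψ) (g : ℚ_[p] → ℂ) (hg : Continuous g) :
    ∫ x, g (splitQP p (n+2) x) * Phi n ψ x ∂(Measure.pi fun _ : Fin (n+2) => μ) =
      ((Measure.pi fun _ : Fin (n+1) => μ).real (W p n) : ℂ) * ∫ ξ, g ξ * ψ ξ ∂μ := by
  have hint : Integrable (fun x => g (splitQP p (n+2) x) * Phi n ψ x)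
      (Measure.pi fun _ : Fin (n+2) => μ) := by
    apply Continuous.integrable_of_hasCompactSupport
    · exact (hg.comp (splitQP_continuous _)).mul (Phi_lc n ψ hψ.1).continuous
    · exact (Phi_cs n ψ hψ.2).mul_left
  have mp := (measurePreserving_piFinSuccAbove (fun _ : Fin (n+2) => μ) (Fin.last (n+1))).symm
  have key : ∀ a : ℚ_[p] × (Fin (n+1) → ℚ_[p]),
      (MeasurableEquiv.piFinSuccAbove (fun _ : Fin (n+2) => ℚ_[p]) (Fin.last (n+1))).symm a
        = Fin.snoc a.2 a.1 := fun a => Fin.insertNth_last' a.1 a.2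
  rw [← mp.integral_comp (MeasurableEquiv.measurableEmbedding _)]
  have hint2 := (mp.integrable_comp_emb (MeasurableEquiv.measurableEmbedding _)).2 hint
  refine (integral_prod_symm _ hint2).trans ?_
  simp only [Function.comp_apply]
  have inner : ∀ z : Fin (n+1) → ℚ_[p],
      ∫ t, g (splitQP p (n+2) (Fin.snoc z t)) * Phi n ψ (Fin.snoc z t) ∂μ =
        (W p n).indicator (fun _ => ∫ ξ, g ξ * ψ ξ ∂μ) z := by
    intro z
    by_cases hz : z ∈ W p n
    · rw [Set.indicator_of_mem hz, ← integral_affine μ _ hz.1 (splitQP p (n+2) (Fin.snoc z 0))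
        (fun ξ => g ξ * ψ ξ)]
      congr 1
      ext t
      have : (Fin.init (Fin.snoc z t : Fin (n+2) → ℚ_[p]) : Fin (n+1) → ℚ_[p]) = z :=
        Fin.init_snoc (α := fun _ => ℚ_[p]) t z
      rw [Phi, this, Set.indicator_of_mem hz, one_mul, splitQP_snoc]
    · rw [Set.indicator_of_notMem hz]
      have : ∀ t, (Fin.init (Fin.snoc z t : Fin (n+2) → ℚ_[p]) : Fin (n+1) → ℚ_[p]) = z :=
        fun t => Fin.init_snoc (α := fun _ => ℚ_[p]) t z
      simp [Phi, this, Set.indicator_of_notMem hz]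
  simp only [key]
  refine (integral_congr_ae (Eventually.of_forall inner)).trans ?_
  rw [integral_indicator_const _ (W_clopen n).1.measurableSet, Complex.real_smul]

end SchwartzAux

open SchwartzAux in
/-- every Schwartz–Bruhat measure on `ℚ_p` is the pushforward under the
split quadratic form `q_d` of a Schwartz–Bruhat measure on `ℚ_p^d` supported away from
the origin. -/
theorem schwartz_pushforward_surjective_padic (p : ℕ) [Fact p.Prime]
    [MeasurableSpace ℚ_[p]] [BorelSpace ℚ_[p]]
    (μ : Measure ℚ_[p]) [μ.IsAddHaarMeasure]
    (d : ℕ) (hd : 2 ≤ d)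
    (μd : Measure (Fin d → ℚ_[p])) [μd.IsAddHaarMeasure]
    (ψ : ℚ_[p] → ℂ) (hψ : IsSchwartzBruhat ψ) :
    ∃ Φ : (Fin d → ℚ_[p]) → ℂ,
      IsSchwartzBruhat Φ ∧
      (∀ᶠ x in nhds (0 : Fin d → ℚ_[p]), Φ x = 0) ∧
      ∀ g : ℚ_[p] → ℂ, Continuous g → HasCompactSupport g →
        ∫ x, g (splitQP p d x) * Φ x ∂μd = ∫ ξ, g ξ * ψ ξ ∂μ := by
  obtain ⟨n, rfl⟩ : ∃ n, d = n + 2 := ⟨d - 2, by omega⟩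
  have hH := Measure.isAddLeftInvariant_eq_smul μd (Measure.pi fun _ : Fin (n+2) => μ)
  have hcpos := Measure.addHaarScalarFactor_pos_of_isAddHaarMeasure μd
    (Measure.pi fun _ : Fin (n+2) => μ)
  set c := Measure.addHaarScalarFactor μd (Measure.pi fun _ : Fin (n+2) => μ)
  have hm : (Measure.pi fun _ : Fin (n+1) => μ).real (W p n) ≠ 0 := by
    rw [Measure.real, ENNReal.toReal_ne_zero]
    exact ⟨((W_clopen n).2.measure_pos _ (W_nonempty n)).ne', (W_compact n).measure_ne_top⟩
  set m := (Measure.pi fun _ : Fin (n+1) => μ).real (W p n) with hmdef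
  have hc0 : ((c : ℝ) : ℂ) ≠ 0 := by exact_mod_cast hcpos.ne'
  have hm0 : (m : ℂ) ≠ 0 := by exact_mod_cast hm
  refine ⟨fun x => (((c : ℝ) : ℂ) * m)⁻¹ * Phi n ψ x, ⟨?_, ?_⟩, ?_, ?_⟩
  · exact (IsLocallyConstant.const _).mul (Phi_lc n ψ hψ.1)
  · exact (Phi_cs n ψ hψ.2).mul_left
  · filter_upwards [Phi_zero n ψ] with x hx
    rw [hx, mul_zero]
  · intro g hg _
    rw [hH, integral_smul_nnreal_measure]
    simp_rw [mul_left_comm _ (((c : ℝ) : ℂ) * m)⁻¹]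
    rw [integral_const_mul, main_integral μ n ψ hψ g hg, ← hmdef, NNReal.smul_def,
      Complex.real_smul]
    field_simp
end
end
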